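/- Let F be a totally real number field, o_F its ring of integers, n a nonzero ideal, and Γ^1 = Γ_1^1(o_F, n) = { ((a,b),(c,d)) ∈ SL_2(o_F) : c ∈ n, d ≡ 1 mod n }. If ℘ is a prime number coprime to 6·n and to the order of o_{F,+}^×/o_{F,n}^{×2}, then the abelianization of Γ_1(o_F,n)/(Γ_1(o_F,n) ∩ F^×) has no ℘-torsion. -/

import Mathlib

section PartD1
open NumberField

namespace PD
/-- number of ideals of norm n -/
noncomputable def cnt (E : Type*) [Field E] [NumberField E] (n : ℕ) : ℕ :=
  Nat.card {I : Ideal (𝓞 E) // Ideal.absNorm I = n}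

section
variable (E : Type*) [Field E] [NumberField E]

instance (n : ℕ) : Finite {I : Ideal (𝓞 E) // Ideal.absNorm I = n} :=
  Ideal.finite_setOfPred_absNorm_eq n

lemma cnt_one : cnt E 1 = 1 := by
  unfold cnt
  have : Unique {I : Ideal (𝓞 E) // Ideal.absNorm I = 1} :=
    { default := ⟨⊤, by simp⟩
      uniq := fun I => Subtype.ext (Ideal.absNorm_eq_one_iff.1 I.2) }
  simp

lemma sup_span_coprime {m n : ℕ} (h : m.Coprime n) {I : Ideal (𝓞 E)} (hI : (n : 𝓞 E) ∈ I) :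
    I ⊔ Ideal.span {(m : 𝓞 E)} = ⊤ := by
  have h1 : IsCoprime (m : 𝓞 E) (n : 𝓞 E) := by
    have := (Nat.isCoprime_iff_coprime.2 h).map (Int.castRingHom (𝓞 E))
    simpa using this
  obtain ⟨u, v, huv⟩ := h1
  rw [Ideal.eq_top_iff_one, ← huv]
  rw [add_comm]
  exact Submodule.add_mem_sup (Ideal.mul_mem_left _ _ hI)
    (Ideal.mul_mem_left _ _ (Ideal.mem_span_singleton_self _))

lemma cnt_mul {m n : ℕ} (h : m.Coprime n) : cnt E (m * n) = cnt E m * cnt E n := by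
  unfold cnt
  rw [← Nat.card_prod]
  symm
  refine Nat.card_congr (Equiv.ofBijective
    (fun x => ⟨x.1.1 * x.2.1, by rw [map_mul, x.1.2, x.2.2]⟩) ⟨?_, ?_⟩)
  · have key : ∀ {m n : ℕ} (_ : m.Coprime n) (I J : Ideal (𝓞 E)) (_ : Ideal.absNorm I = m)
        (_ : Ideal.absNorm J = n), I = I * J ⊔ Ideal.span {(m : 𝓞 E)} := by
      intro m n h I J hI hJ
      have hm : (m : 𝓞 E) ∈ I := by rw [← hI]; exact Ideal.absNorm_mem I
      have hn : (n : 𝓞 E) ∈ J := by rw [← hJ]; exact Ideal.absNorm_mem J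
      apply le_antisymm
      · calc I = I * (J ⊔ Ideal.span {(m : 𝓞 E)}) := by
              rw [sup_span_coprime E h hn, Ideal.mul_top]
          _ = I * J ⊔ I * Ideal.span {(m : 𝓞 E)} := Ideal.mul_sup _ _ _
          _ ≤ _ := sup_le_sup le_rfl Ideal.mul_le_right
      · exact sup_le Ideal.mul_le_left ((Ideal.span_singleton_le_iff_mem _).2 hm)
    rintro ⟨⟨I, hI⟩, ⟨J, hJ⟩⟩ ⟨⟨I', hI'⟩, ⟨J', hJ'⟩⟩ hh
    simp only [Subtype.mk.injEq] at hh
    simp only [Prod.mk.injEq, Subtype.mk.injEq]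
    constructor
    · rw [key h I J hI hJ, key h I' J' hI' hJ', hh]
    · rw [key h.symm J I hJ hI, key h.symm J' I' hJ' hI', mul_comm J, mul_comm J', hh]
  · rintro ⟨K, hK⟩
    have hmn : ((m * n : ℕ) : 𝓞 E) ∈ K := by rw [← hK]; exact Ideal.absNorm_mem K
    set I := K ⊔ Ideal.span {(m : 𝓞 E)} with hI
    set J := K ⊔ Ideal.span {(n : 𝓞 E)} with hJ
    have hmI : (m : 𝓞 E) ∈ I := by
      exact Ideal.mem_sup_right (Ideal.mem_span_singleton_self _)
    have hnJ : (n : 𝓞 E) ∈ J := by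
      exact Ideal.mem_sup_right (Ideal.mem_span_singleton_self _)
    have hIJ : I * J = K := by
      apply le_antisymm
      · rw [hI, hJ, Ideal.sup_mul, Ideal.mul_sup]
        refine sup_le (sup_le Ideal.mul_le_left Ideal.mul_le_left) ?_
        rw [Ideal.mul_sup]
        refine sup_le Ideal.mul_le_right ?_
        rw [Ideal.span_singleton_mul_span_singleton, Ideal.span_singleton_le_iff_mem]
        simpa using hmn
      · have ht : I ⊔ J = ⊤ := by
          rw [eq_top_iff, ← sup_span_coprime E h (I := J) hnJ, sup_comm]
          exact sup_le_sup ((Ideal.span_singleton_le_iff_mem _).2 hmI) le_rfl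
        calc K = K * (I ⊔ J) := by rw [ht, Ideal.mul_top]
          _ = K * I ⊔ K * J := Ideal.mul_sup _ _ _
          _ ≤ I * J := by
            refine sup_le ?_ ?_
            · rw [mul_comm]; exact Ideal.mul_mono le_rfl le_sup_left
            · exact Ideal.mul_mono le_sup_left le_rfl
    have hN : Ideal.absNorm I * Ideal.absNorm J = m * n := by rw [← map_mul, hIJ, hK]
    have c : ∀ {m n : ℕ} (_ : m.Coprime n) (I : Ideal (𝓞 E)) (_ : (m : 𝓞 E) ∈ I),
        (Ideal.absNorm I).Coprime n := by
      intro m n h I hmI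
      have h1 : Ideal.absNorm I ∣ Ideal.absNorm (Ideal.span {(m : 𝓞 E)}) :=
        Ideal.absNorm_dvd_absNorm_of_le ((Ideal.span_singleton_le_iff_mem _).2 hmI)
      rw [Ideal.absNorm_span_natCast] at h1
      exact Nat.Coprime.coprime_dvd_left h1 (Nat.Coprime.pow_left _ h)
    have c1 := c h I hmI
    have c2 := c h.symm J hnJ
    have d1 : Ideal.absNorm I ∣ m := c1.dvd_of_dvd_mul_right (Dvd.intro _ hN)
    have d2 : Ideal.absNorm J ∣ n := c2.dvd_of_dvd_mul_left (Dvd.intro_left _ hN)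
    have d3 : m ∣ Ideal.absNorm I := c2.symm.dvd_of_dvd_mul_right (Dvd.intro _ hN.symm)
    have d4 : n ∣ Ideal.absNorm J := c1.symm.dvd_of_dvd_mul_left (Dvd.intro_left _ hN.symm)
    exact ⟨⟨⟨I, Nat.dvd_antisymm d1 d3⟩, ⟨J, Nat.dvd_antisymm d2 d4⟩⟩, Subtype.ext hIJ⟩

open UniqueFactorizationMonoid in
lemma cnt_pow_le {l : ℕ} (hl : l.Prime) (e : ℕ) :
    cnt E (l ^ e) ≤ (e + 1) ^ (Module.finrank ℚ E) := by
  classical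
  have hmax : (Ideal.span {(l : ℤ)}).IsMaximal :=
    Ideal.IsPrime.isMaximal ((Ideal.span_singleton_prime (by exact_mod_cast hl.ne_zero)).2
      (Nat.prime_iff_prime_int.1 hl)) (by simpa using hl.ne_zero)
  have hb : Ideal.span {(l : ℤ)} ≠ ⊥ := by simpa using hl.ne_zero
  set S := IsDedekindDomain.primesOverFinset (Ideal.span {(l : ℤ)}) (𝓞 E) with hSdef
  have hS : S.card ≤ Module.finrank ℚ E := by
    have := Ideal.card_primesOverFinset_le_finrank (R := ℤ) (S := 𝓞 E) ℚ E
      (p := Ideal.span {(l : ℤ)}) hb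
    exact this
  have hmemS : ∀ P : Ideal (𝓞 E), P.IsPrime → (l : 𝓞 E) ∈ P → P ∈ S := by
    intro P hP hl'
    rw [hSdef, IsDedekindDomain.mem_primesOverFinset_iff hb]
    rw [Ideal.mem_primesOver_iff_mem_normalizedFactors _ hb,
      Ideal.mem_normalizedFactors_iff (Ideal.map_ne_bot_of_ne_bot hb)]
    refine ⟨hP, ?_⟩
    rw [Ideal.map_span, Ideal.span_le]
    simpa using hl'
  have hcount : ∀ I : Ideal (𝓞 E), Ideal.absNorm I = l ^ e → ∀ P,
      (normalizedFactors I).count P ≤ e := by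
    intro I hI P
    have hI0 : I ≠ 0 := by
      rintro rfl
      have h0 : l ^ e = 0 := by rw [← hI]; simp
      exact pow_ne_zero _ hl.ne_zero h0
    by_cases hP : P ∈ normalizedFactors I
    · have hPp := prime_of_normalized_factor P hP
      have hd : P ^ ((normalizedFactors I).count P) ∣ I := by
        have h1 : (Multiset.replicate ((normalizedFactors I).count P) P) ≤ normalizedFactors I :=
          Multiset.le_count_iff_replicate_le.1 le_rfl
        have h2 := Multiset.prod_dvd_prod_of_le h1
        rw [Multiset.prod_replicate] at h2
        exact h2.trans (prod_normalizedFactors hI0).dvd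
      have h3 := map_dvd (Ideal.absNorm) hd
      rw [map_pow, hI] at h3
      have h4 : Ideal.absNorm P ∣ l ^ e := by
        rw [← hI]; exact map_dvd _ (dvd_of_mem_normalizedFactors hP)
      obtain ⟨j, hj, hj'⟩ := (Nat.dvd_prime_pow hl).1 h4
      have hj0 : j ≠ 0 := by
        rintro rfl
        rw [pow_zero, Ideal.absNorm_eq_one_iff] at hj'
        exact hPp.not_isUnit (by rw [hj', ← Ideal.one_eq_top]; exact isUnit_one)
      rw [hj', ← pow_mul] at h3
      have h5 := (Nat.pow_dvd_pow_iff_le_right hl.one_lt).1 h3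
      nlinarith [Nat.pos_of_ne_zero hj0]
    · rw [Multiset.count_eq_zero_of_notMem hP]; exact Nat.zero_le _
  have hmain : cnt E (l ^ e) ≤ Nat.card (S → Fin (e + 1)) := by
    unfold cnt
    refine Nat.card_le_card_of_injective
      (fun I P => ⟨(normalizedFactors I.1).count P.1, Nat.lt_succ_of_le (hcount I.1 I.2 P.1)⟩) ?_
    rintro ⟨I, hI⟩ ⟨J, hJ⟩ hIJ
    have hne : ∀ I : Ideal (𝓞 E), Ideal.absNorm I = l ^ e → I ≠ 0 := by
      rintro _ hI rfl
      have h0 : l ^ e = 0 := by rw [← hI]; simp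
      exact pow_ne_zero _ hl.ne_zero h0
    have hz : ∀ I : Ideal (𝓞 E), Ideal.absNorm I = l ^ e → ∀ P, P ∉ S →
        (normalizedFactors I).count P = 0 := by
      intro I hI P hP
      apply Multiset.count_eq_zero_of_notMem
      intro hP'
      have hPp := Ideal.isPrime_of_prime (prime_of_normalized_factor P hP')
      apply hP (hmemS P hPp _)
      have h1 : ((l ^ e : ℕ) : 𝓞 E) ∈ P := by
        rw [← hI]
        exact Ideal.le_of_dvd (dvd_of_mem_normalizedFactors hP') (Ideal.absNorm_mem I)
      rw [Nat.cast_pow] at h1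
      exact hPp.mem_of_pow_mem _ h1
    have hfac : normalizedFactors I = normalizedFactors J := by
      ext P
      by_cases hP : P ∈ S
      · have := congrFun hIJ ⟨P, hP⟩
        simpa using this
      · rw [hz I hI P hP, hz J hJ P hP]
    have := (prod_normalizedFactors (hne I hI)).symm.trans
      (hfac ▸ prod_normalizedFactors (hne J hJ))
    exact Subtype.ext (associated_iff_eq.1 this)
  refine hmain.trans ?_
  rw [Nat.card_eq_fintype_card, Fintype.card_fun, Fintype.card_fin, Fintype.card_coe]
  exact Nat.pow_le_pow_right (Nat.succ_pos _) hS
end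
end PD
end PartD1

section PartD2
open NumberField Filter Topology

namespace PD

lemma log_one_add_ge {y : ℝ} (hy : 0 ≤ y) : y - y ^ 2 ≤ Real.log (1 + y) := by
  have h := Real.one_sub_inv_le_log_of_pos (show 0 < 1 + y by linarith)
  refine le_trans ?_ h
  have : 1 - (1 + y)⁻¹ - (y - y ^ 2) = y ^ 3 / (1 + y) := by
    field_simp; ring
  have h2 : 0 ≤ y ^ 3 / (1 + y) := by positivity
  linarith

lemma log_one_add_le {y : ℝ} (hy : 0 ≤ y) : Real.log (1 + y) ≤ y := by
  have := Real.log_le_sub_one_of_pos (show 0 < 1 + y by linarith)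
  linarith

/-- local factor estimate -/
lemma local_est (n : ℕ) : ∃ D : ℝ, 0 ≤ D ∧ ∀ (g : ℕ → ℝ) (x : ℝ), 0 ≤ x → x ≤ 1 / 2 → g 0 = 1 →
    (∀ e, 0 ≤ g e) → (∀ e, g e ≤ ((e : ℝ) + 1) ^ n * x ^ e) →
    0 < ∑' e, g e ∧ |Real.log (∑' e, g e) - g 1| ≤ D * x ^ 2 := by
  have hsumB : Summable (fun e : ℕ => ((e : ℝ) + 3) ^ n * (1 / 2 : ℝ) ^ e) := by
    have h0 := summable_pow_mul_geometric_of_norm_lt_one (R := ℝ) n (r := 1 / 2)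
      (by rw [Real.norm_eq_abs, abs_of_pos] <;> norm_num)
    have h1 := (summable_nat_add_iff 3).2 h0
    have h2 := h1.mul_left 8
    refine h2.congr fun e => ?_
    push_cast
    rw [pow_add]; ring
  set B := ∑' e : ℕ, ((e : ℝ) + 3) ^ n * (1 / 2 : ℝ) ^ e with hB
  have hB0 : 0 ≤ B := tsum_nonneg fun e => by positivity
  refine ⟨B + (2 ^ n + B) ^ 2, by positivity, ?_⟩
  intro g x hx hx2 hg0 hg hle
  have hterm : ∀ e, g (e + 2) ≤ x ^ 2 * (((e : ℝ) + 3) ^ n * (1 / 2 : ℝ) ^ e) := by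
    intro e
    refine (hle (e + 2)).trans ?_
    push_cast
    have : x ^ e ≤ (1 / 2) ^ e := pow_le_pow_left₀ hx hx2 e
    have h3 : ((e : ℝ) + 2 + 1) = e + 3 := by ring
    rw [h3, pow_add]
    have h4 : 0 ≤ ((e : ℝ) + 3) ^ n := by positivity
    have h5 : 0 ≤ x ^ 2 := by positivity
    calc ((e : ℝ) + 3) ^ n * (x ^ e * x ^ 2) ≤ ((e : ℝ) + 3) ^ n * ((1 / 2) ^ e * x ^ 2) := by
          gcongr
      _ = _ := by ring
  have hs2 : Summable (fun e => g (e + 2)) :=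
    Summable.of_nonneg_of_le (fun e => hg _) hterm (hsumB.mul_left _)
  have hs : Summable g := (summable_nat_add_iff 2).1 hs2
  have hdecomp : ∑' e, g e = 1 + (g 1 + ∑' e, g (e + 2)) := by
    rw [← hs.sum_add_tsum_nat_add 2]
    simp [Finset.sum_range_succ, hg0]; ring
  have ht : ∑' e, g (e + 2) ≤ B * x ^ 2 := by
    rw [mul_comm, hB, ← tsum_mul_left]
    exact hs2.tsum_le_tsum hterm (hsumB.mul_left _)
  have ht0 : 0 ≤ ∑' e, g (e + 2) := tsum_nonneg fun e => hg _
  set t := ∑' e, g (e + 2)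
  have hg1 : g 1 ≤ 2 ^ n * x := by
    have := hle 1
    norm_num at this
    exact this
  have hg1' := hg 1
  rw [hdecomp]
  have hy0 : 0 ≤ g 1 + t := by positivity
  refine ⟨by linarith, ?_⟩
  have hub := log_one_add_le hy0
  have hlb := log_one_add_ge hy0
  have hy : g 1 + t ≤ (2 ^ n + B) * x := by
    have : B * x ^ 2 ≤ B * x := by
      have : x ^ 2 ≤ x := by nlinarith
      gcongr
    nlinarith
  have hyy : (g 1 + t) ^ 2 ≤ (2 ^ n + B) ^ 2 * x ^ 2 := by
    rw [← mul_pow]; exact pow_le_pow_left₀ hy0 hy 2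
  have h7 : 0 ≤ B * x ^ 2 := by positivity
  have h8 : 0 ≤ (2 ^ n + B) ^ 2 * x ^ 2 := by positivity
  rw [abs_le]
  constructor <;> nlinarith

/-- Euler product estimate -/
lemma euler_est (n : ℕ) : ∃ C : ℝ, ∀ (a : ℕ → ℕ), a 1 = 1 →
    (∀ {k m : ℕ}, k.Coprime m → a (k * m) = a k * a m) →
    (∀ {l : ℕ}, l.Prime → ∀ e, a (l ^ e) ≤ (e + 1) ^ n) →
    ∀ s : ℝ, 1 < s → Summable (fun k : ℕ => (a k : ℝ) * (k : ℝ) ^ (-s)) →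
    |Real.log (∑' k : ℕ, (a k : ℝ) * (k : ℝ) ^ (-s)) -
      ∑' l : ℕ, if l.Prime then (a l : ℝ) * (l : ℝ) ^ (-s) else 0| ≤ C := by
  obtain ⟨D, hD0, hD⟩ := local_est n
  have hs2 : Summable (fun k : ℕ => ((k : ℝ) ^ 2)⁻¹) := by
    simpa using (Real.summable_nat_pow_inv (p := 2)).2 (by norm_num)
  refine ⟨D * ∑' k : ℕ, ((k : ℝ) ^ 2)⁻¹, ?_⟩
  intro a ha1 hmul hpow s hs hsum
  set f : ℕ → ℝ := fun k => (a k : ℝ) * (k : ℝ) ^ (-s) with hf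
  have hf0 : f 0 = 0 := by
    simp [hf, Real.zero_rpow (show -s ≠ 0 by linarith)]
  have hf1 : f 1 = 1 := by simp [hf, ha1]
  have hfn : ∀ k, 0 ≤ f k := fun k => by positivity
  have hfm : ∀ {k m : ℕ}, k.Coprime m → f (k * m) = f k * f m := by
    intro k m h
    simp only [hf, hmul h, Nat.cast_mul]
    rw [Real.mul_rpow (by positivity) (by positivity)]; ring
  have hE := EulerProduct.eulerProduct hf1 hfm (by simpa using hsum.norm) hf0
  have hloc : ∀ l : ℕ, l.Prime → 0 < ∑' e, f (l ^ e) ∧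
      |Real.log (∑' e, f (l ^ e)) - f l| ≤ D * ((l : ℝ) ^ 2)⁻¹ := by
    intro l hl
    have hl2 : (2 : ℝ) ≤ l := by exact_mod_cast hl.two_le
    have hx0 : 0 ≤ (l : ℝ) ^ (-s) := by positivity
    have hxl : (l : ℝ) ^ (-s) ≤ (l : ℝ)⁻¹ := by
      rw [← Real.rpow_neg_one]
      exact Real.rpow_le_rpow_of_exponent_le (by linarith) (by linarith)
    have hx2 : (l : ℝ) ^ (-s) ≤ 1 / 2 := by
      refine hxl.trans ?_
      rw [one_div]
      exact inv_anti₀ (by norm_num) hl2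
    have := hD (fun e => f (l ^ e)) _ hx0 hx2 (by simpa using hf1) (fun e => hfn _) (by
      intro e
      have h1 : ((a (l ^ e) : ℕ) : ℝ) ≤ ((e : ℝ) + 1) ^ n := by exact_mod_cast hpow hl e
      have h2 : ((l ^ e : ℕ) : ℝ) ^ (-s) = ((l : ℝ) ^ (-s)) ^ e := by
        push_cast
        rw [← Real.rpow_natCast, ← Real.rpow_natCast, ← Real.rpow_mul (by positivity),
          ← Real.rpow_mul (by positivity), mul_comm]
      simp only [hf, h2]
      gcongr)
    refine ⟨this.1, ?_⟩
    have h3 := this.2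
    simp only [pow_one] at h3
    refine h3.trans ?_
    have : ((l : ℝ) ^ (-s)) ^ 2 ≤ ((l : ℝ) ^ 2)⁻¹ := by
      rw [← inv_pow]; exact pow_le_pow_left₀ hx0 hxl 2
    gcongr
  have hZ1 : 1 ≤ ∑' k, f k := by
    have := hsum.le_tsum 1 (fun j _ => hfn j)
    simpa [hf1] using this
  have hlog := (Real.continuousAt_log (show ∑' k, f k ≠ 0 by linarith)).tendsto.comp hE
  have hsp : Summable (fun l : ℕ => if l.Prime then f l else 0) := by
    refine Summable.of_nonneg_of_le (fun l => ?_) (fun l => ?_) hsum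
    · split_ifs <;> [exact hfn l; exact le_rfl]
    · split_ifs <;> [exact le_rfl; exact hfn l]
  have hten := hlog.sub hsp.hasSum.tendsto_sum_nat
  refine le_of_tendsto hten.abs (Eventually.of_forall fun N => ?_)
  simp only [Function.comp_apply]
  rw [Real.log_prod (fun l hl => (hloc l (Nat.prime_of_mem_primesBelow hl)).1.ne')]
  rw [← Finset.sum_filter]
  change |_ - ∑ l ∈ N.primesBelow, f l| ≤ _
  rw [← Finset.sum_sub_distrib]
  refine (Finset.abs_sum_le_sum_abs _ _).trans ?_
  refine (Finset.sum_le_sum fun l hl => (hloc l (Nat.prime_of_mem_primesBelow hl)).2).trans ?_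
  rw [← Finset.mul_sum]
  gcongr
  exact hs2.sum_le_tsum _ (fun k _ => by positivity)

lemma zeta_est (E : Type*) [Field E] [NumberField E] : ∃ C : ℝ, ∀ᶠ s in 𝓝[>] (1 : ℝ),
    Summable (fun k : ℕ => (cnt E k : ℝ) * (k : ℝ) ^ (-s)) ∧
    |(∑' l : ℕ, if l.Prime then (cnt E l : ℝ) * (l : ℝ) ^ (-s) else 0) -
      Real.log (1 / (s - 1))| ≤ C := by
  obtain ⟨C, hC⟩ := euler_est (Module.finrank ℚ E)
  have hT := tendsto_sub_one_mul_dedekindZeta_nhdsGT E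
  have hr := dedekindZeta_residue_pos E
  set r := dedekindZeta_residue E
  have hterm : ∀ s : ℝ, 1 < s → ∀ k : ℕ,
      LSeries.term (fun n ↦ (Nat.card {I : Ideal (𝓞 E) // Ideal.absNorm I = n} : ℂ)) s k =
      ((((cnt E k : ℝ) * (k : ℝ) ^ (-s) : ℝ)) : ℂ) := by
    intro s hs k
    rw [LSeries.term_def]
    split_ifs with hk
    · subst hk
      rw [Nat.cast_zero, Real.zero_rpow (by linarith)]; simp
    · push_cast
      rw [Complex.ofReal_cpow (by positivity)]
      push_cast
      rw [Complex.cpow_neg]; rfl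
  have hZ : ∀ s : ℝ, 1 < s → dedekindZeta E s =
      ((∑' k : ℕ, (cnt E k : ℝ) * (k : ℝ) ^ (-s) : ℝ) : ℂ) := by
    intro s hs
    rw [dedekindZeta, LSeries, Complex.ofReal_tsum]
    exact tsum_congr (hterm s hs)
  have hTR : Tendsto (fun s : ℝ => (s - 1) * ∑' k : ℕ, (cnt E k : ℝ) * (k : ℝ) ^ (-s)) (𝓝[>] 1)
      (𝓝 r) := by
    have h1 := (Complex.continuous_re.tendsto _).comp hT
    simp only [Complex.ofReal_re] at h1
    refine h1.congr' ?_
    filter_upwards [self_mem_nhdsWithin] with s hs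
    simp only [Function.comp_apply]
    rw [hZ s hs]
    rw [← Complex.ofReal_one, ← Complex.ofReal_sub, ← Complex.ofReal_mul, Complex.ofReal_re]
  have hL := (Real.continuousAt_log hr.ne').tendsto.comp hTR
  refine ⟨C + (|Real.log r| + 1), ?_⟩
  have hb : ∀ᶠ s in 𝓝[>] (1 : ℝ),
      |Real.log ((s - 1) * ∑' k : ℕ, (cnt E k : ℝ) * (k : ℝ) ^ (-s))| < |Real.log r| + 1 :=
    hL.abs.eventually_lt_const (by linarith)
  filter_upwards [self_mem_nhdsWithin, hTR.eventually_const_lt hr, hb] with s hs hpos hbd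
  have hs1 : (1 : ℝ) < s := hs
  have hsum : Summable (fun k : ℕ => (cnt E k : ℝ) * (k : ℝ) ^ (-s)) := by
    by_contra hns
    rw [tsum_eq_zero_of_not_summable hns] at hpos
    simp at hpos
  refine ⟨hsum, ?_⟩
  have hz := pos_of_mul_pos_right hpos (by linarith)
  have h1 := hC (cnt E) (cnt_one E) (fun h => cnt_mul E h) (fun hl e => cnt_pow_le E hl e) s hs1 hsum
  have hlm : Real.log ((s - 1) * ∑' k : ℕ, (cnt E k : ℝ) * (k : ℝ) ^ (-s)) =
    Real.log (∑' k : ℕ, (cnt E k : ℝ) * (k : ℝ) ^ (-s)) - Real.log (1 / (s - 1)) := by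
    rw [Real.log_mul (by linarith) hz.ne', one_div, Real.log_inv]; ring
  rw [hlm] at hbd
  rw [abs_le] at *
  rw [abs_lt] at hbd
  constructor <;> linarith [h1.1, h1.2, hbd.1, hbd.2]

end PD
end PartD2

section PartD3
open NumberField Filter Topology
open scoped Pointwise

namespace PD

section
variable (K : Type*) [Field K] [NumberField K]

/-- trivial inertia above l -/
def TrivIn (l : ℕ) : Prop := ∀ Q : Ideal (𝓞 K), Q.IsPrime → (l : 𝓞 K) ∈ Q → ∀ σ : Gal(K/ℚ),
  (∀ x : 𝓞 K, σ • x - x ∈ Q) → σ = 1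

/-- Frobenius of l lies in V (for some prime above l) -/
def Fr (V : Subgroup Gal(K/ℚ)) (l : ℕ) : Prop := ∃ Q : Ideal (𝓞 K), Q.IsPrime ∧ (l : 𝓞 K) ∈ Q ∧
  ∃ σ ∈ V, ∀ x : 𝓞 K, σ • x - x ^ l ∈ Q

lemma absNorm_dvd_pow {l : ℕ} {Q : Ideal (𝓞 K)} (h : (l : 𝓞 K) ∈ Q) :
    Ideal.absNorm Q ∣ l ^ (Module.finrank ℤ (𝓞 K)) := by
  have h1 : Ideal.absNorm Q ∣ Ideal.absNorm (Ideal.span {(l : 𝓞 K)}) :=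
    Ideal.absNorm_dvd_absNorm_of_le ((Ideal.span_singleton_le_iff_mem _).2 h)
  rwa [Ideal.absNorm_span_natCast] at h1

lemma dvd_absNorm {l : ℕ} (hl : l.Prime) {Q : Ideal (𝓞 K)} (hQ : Q.IsPrime) (h : (l : 𝓞 K) ∈ Q) :
    l ∣ Ideal.absNorm Q := by
  obtain ⟨j, hj, hj'⟩ := (Nat.dvd_prime_pow hl).1 (absNorm_dvd_pow K h)
  have hj0 : j ≠ 0 := by
    rintro rfl
    rw [pow_zero, Ideal.absNorm_eq_one_iff] at hj'
    exact hQ.ne_top hj'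
  rw [hj']; exact dvd_pow_self _ hj0

lemma exists_trivIn : ∃ B : ℕ, 0 < B ∧ ∀ l : ℕ, l.Prime → ¬ l ∣ B → TrivIn K l := by
  classical
  have hx : ∀ σ : Gal(K/ℚ), ∃ x : 𝓞 K, σ ≠ 1 → σ • x - x ≠ 0 := by
    intro σ
    by_contra hc
    push Not at hc
    have hσ := (hc 0).1
    apply hσ
    ext y
    obtain ⟨a, b, hb, rfl⟩ := IsFractionRing.div_surjective (A := 𝓞 K) y
    have ha := (hc a).2
    have hb' := (hc b).2
    rw [sub_eq_zero] at ha hb'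
    have ha' : σ (algebraMap (𝓞 K) K a) = algebraMap (𝓞 K) K a := congrArg (algebraMap (𝓞 K) K) ha
    have hb'' : σ (algebraMap (𝓞 K) K b) = algebraMap (𝓞 K) K b := congrArg (algebraMap (𝓞 K) K) hb'
    rw [map_div₀, ha', hb'']; rfl
  choose x hx using hx
  set Δ : 𝓞 K := ∏ σ ∈ (Finset.univ.erase (1 : Gal(K/ℚ))), (σ • x σ - x σ) with hΔ
  have hΔ0 : Δ ≠ 0 := by
    rw [hΔ, Finset.prod_ne_zero_iff]
    intro σ hσ
    exact hx σ (Finset.ne_of_mem_erase hσ)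
  refine ⟨Ideal.absNorm (Ideal.span {Δ}), ?_, ?_⟩
  · rw [Nat.pos_iff_ne_zero, Ne, Ideal.absNorm_eq_zero_iff]
    simpa using hΔ0
  · intro l hl hB Q hQ hlQ σ hσ
    by_contra hne
    apply hB
    refine (dvd_absNorm K hl hQ hlQ).trans (Ideal.absNorm_dvd_absNorm_of_le ?_)
    rw [Ideal.span_singleton_le_iff_mem, hΔ,
      ← Finset.mul_prod_erase _ _ (Finset.mem_erase.2 ⟨hne, Finset.mem_univ σ⟩)]
    exact Ideal.mul_mem_right _ _ (hσ _)

lemma absNorm_smul (σ : Gal(K/ℚ)) (P : Ideal (𝓞 K)) :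
    Ideal.absNorm (σ • P) = Ideal.absNorm P := by
  symm
  refine Nat.card_congr (Ideal.quotientEquiv P (σ • P)
    (MulSemiringAction.toRingEquiv Gal(K/ℚ) (𝓞 K) σ) ?_).toEquiv
  rfl

variable {K}
lemma norm_prime {l : ℕ} (hl : l.Prime) {P : Ideal (𝓞 K)} (h : Ideal.absNorm P = l) :
    P.IsPrime ∧ (l : 𝓞 K) ∈ P := by
  refine ⟨Ideal.isPrime_of_irreducible_absNorm (by rw [h]; exact hl), ?_⟩
  rw [← h]; exact Ideal.absNorm_mem P

lemma under_eq {l : ℕ} (hl : l.Prime) {P : Ideal (𝓞 K)} (hP : P.IsPrime) (h : (l : 𝓞 K) ∈ P) :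
    P.under ℤ = Ideal.span {(l : ℤ)} := by
  have hmax : (Ideal.span {(l : ℤ)}).IsMaximal :=
    Ideal.IsPrime.isMaximal ((Ideal.span_singleton_prime (by exact_mod_cast hl.ne_zero)).2
      (Nat.prime_iff_prime_int.1 hl)) (by simpa using hl.ne_zero)
  symm
  apply hmax.eq_of_le
  · exact (Ideal.IsPrime.under ℤ P).ne_top
  · rw [Ideal.span_singleton_le_iff_mem, Ideal.mem_comap]
    simpa using h

lemma int_surj {l : ℕ} (hl : l.Prime) {P : Ideal (𝓞 K)} (h : Ideal.absNorm P = l) (x : 𝓞 K) :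
    ∃ n : ℤ, x - n ∈ P := by
  have hc : Nat.card (𝓞 K ⧸ P) = l := h
  haveI := Fact.mk hl
  have hP := (norm_prime hl h).1
  have h1 : (1 : 𝓞 K ⧸ P) ≠ 0 := by
    haveI := Ideal.Quotient.nontrivial_iff.2 hP.ne_top
    exact one_ne_zero
  have := mem_zmultiples_of_prime_card (p := l) hc h1 (g' := Ideal.Quotient.mk P x)
  obtain ⟨n, hn⟩ := AddSubgroup.mem_zmultiples_iff.1 this
  refine ⟨n, ?_⟩
  rw [← Ideal.Quotient.eq, ← hn]
  simp

lemma cnt_galois [IsGalois ℚ K] {l : ℕ} (hl : l.Prime) (ht : TrivIn K l) {P : Ideal (𝓞 K)}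
    (h : Ideal.absNorm P = l) : cnt K l = Module.finrank ℚ K := by
  rw [← IsGalois.card_aut_eq_finrank]
  unfold cnt
  symm
  refine Nat.card_congr (Equiv.ofBijective (fun σ : Gal(K/ℚ) => ⟨σ • P, by rw [absNorm_smul, h]⟩)
    ⟨?_, ?_⟩)
  · intro σ τ hst
    simp only [Subtype.mk.injEq] at hst
    have h1 : (τ⁻¹ * σ) • P = P := by rw [mul_smul, hst, inv_smul_smul]
    have h2 := ht P (norm_prime hl h).1 (norm_prime hl h).2 (τ⁻¹ * σ) (by
      intro x
      obtain ⟨n, hn⟩ := int_surj hl h x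
      have h3 : (τ⁻¹ * σ) • (x - n) ∈ P := by
        have := Ideal.smul_mem_pointwise_smul (τ⁻¹ * σ) _ _ hn
        rwa [h1] at this
      have h4 : (τ⁻¹ * σ) • (n : 𝓞 K) = n := map_intCast (MulSemiringAction.toRingHom _ (𝓞 K) (τ⁻¹ * σ)) n
      rw [smul_sub, h4] at h3
      have := P.sub_mem h3 hn
      rwa [sub_sub_sub_cancel_right] at this)
    exact (inv_mul_eq_one.1 h2).symm
  · rintro ⟨I, hI⟩
    haveI := (norm_prime hl h).1
    haveI := (norm_prime hl hI).1
    obtain ⟨g, hg⟩ := Algebra.IsInvariant.exists_smul_of_under_eq ℤ (𝓞 K) Gal(K/ℚ) P I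
      (by rw [under_eq hl (norm_prime hl h).1 (norm_prime hl h).2,
        under_eq hl (norm_prime hl hI).1 (norm_prime hl hI).2])
    exact ⟨g, Subtype.ext hg.symm⟩

lemma exists_frob [IsGalois ℚ K] {l : ℕ} (hl : l.Prime) {Q : Ideal (𝓞 K)} (hQ : Q.IsPrime)
    (h : (l : 𝓞 K) ∈ Q) : ∃ σ : Gal(K/ℚ), IsArithFrobAt ℤ σ Q ∧ ∀ x : 𝓞 K, σ • x - x ^ l ∈ Q := by
  haveI : Finite (𝓞 K ⧸ Q) := by
    apply Ideal.finiteQuotientOfFreeOfNeBot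
    rintro rfl
    exact hl.ne_zero (by simpa using h)
  obtain ⟨σ, hσ⟩ := IsArithFrobAt.exists_of_isInvariant ℤ Gal(K/ℚ) Q
  refine ⟨σ, hσ, fun x => ?_⟩
  have := hσ x
  rw [under_eq hl hQ h] at this
  rw [show Nat.card (ℤ ⧸ Ideal.span {(l : ℤ)}) = l by
    rw [← Submodule.cardQuot_apply, ← Ideal.absNorm_apply]; simp] at this
  exact this

/-- any prime above l -/
lemma Fr.all [IsGalois ℚ K] {l : ℕ} (hl : l.Prime) {V : Subgroup Gal(K/ℚ)} (hV : V.Normal)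
    (h : Fr K V l) {Q : Ideal (𝓞 K)} (hQ : Q.IsPrime) (hlQ : (l : 𝓞 K) ∈ Q) :
    ∃ σ ∈ V, ∀ x : 𝓞 K, σ • x - x ^ l ∈ Q := by
  obtain ⟨Q', hQ', hlQ', σ, hσ, hx⟩ := h
  obtain ⟨g, hg⟩ := Algebra.IsInvariant.exists_smul_of_under_eq ℤ (𝓞 K) Gal(K/ℚ) Q' Q
      (by rw [under_eq hl hQ' hlQ', under_eq hl hQ hlQ])
  refine ⟨g * σ * g⁻¹, hV.conj_mem σ hσ g, fun x => ?_⟩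
  have := Ideal.smul_mem_pointwise_smul g _ _ (hx (g⁻¹ • x))
  rw [← hg] at this
  rw [smul_sub, smul_pow', smul_inv_smul] at this
  rwa [mul_smul, mul_smul]

end
end PD
end PartD3

section PartD3b
open NumberField Filter Topology
open scoped Pointwise

namespace PD
section
variable {K E : Type*} [Field K] [NumberField K] [Field E] [NumberField E] [Algebra E K]

lemma card_le_of_pow {R : Type*} [CommRing R] [IsDomain R] [Finite R] {l : ℕ} (hl : 1 < l)
    (h : ∀ x : R, x ^ l = x) : Nat.card R ≤ l := by
  classical
  have := Fintype.ofFinite R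
  rw [Nat.card_eq_fintype_card]
  let p : Polynomial R := Polynomial.X ^ l - Polynomial.X
  have hdeg : p.natDegree = l := by
    have : (Polynomial.X : Polynomial R).natDegree < (Polynomial.X ^ l : Polynomial R).natDegree := by
      simpa using hl
    rw [Polynomial.natDegree_sub_eq_left_of_natDegree_lt this, Polynomial.natDegree_X_pow]
  have hp0 : p ≠ 0 := by
    intro h0
    rw [h0, Polynomial.natDegree_zero] at hdeg
    omega
  rw [← hdeg]
  refine le_trans ?_ (Polynomial.card_roots' p)
  refine le_trans ?_ (Multiset.toFinset_card_le _)
  rw [← Finset.card_univ]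
  apply Finset.card_le_card
  intro y _
  rw [Multiset.mem_toFinset, Polynomial.mem_roots hp0]
  simp only [p, Polynomial.IsRoot, Polynomial.eval_sub, Polynomial.eval_pow, Polynomial.eval_X]
  rw [h, sub_self]

lemma absNorm_eq_of_pow {l : ℕ} (hl : l.Prime) {P : Ideal (𝓞 E)} (hPp : P.IsPrime)
    (hlP : (l : 𝓞 E) ∈ P) (hpow : ∀ x : 𝓞 E, x ^ l - x ∈ P) : Ideal.absNorm P = l := by
  have hPb : P ≠ ⊥ := by
    intro hb
    rw [hb] at hlP
    exact hl.ne_zero (by simpa using hlP)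
  have : Finite (𝓞 E ⧸ P) := Ideal.finiteQuotientOfFreeOfNeBot P hPb
  have hle : Nat.card (𝓞 E ⧸ P) ≤ l := by
    refine card_le_of_pow hl.one_lt fun y => ?_
    obtain ⟨x, rfl⟩ := Ideal.Quotient.mk_surjective y
    rw [← map_pow, Ideal.Quotient.eq]
    exact hpow x
  have hd := dvd_absNorm E hl hPp hlP
  have hpos : 0 < Ideal.absNorm P := by
    rw [Nat.pos_iff_ne_zero, Ne, Ideal.absNorm_eq_zero_iff]; exact hPb
  exact le_antisymm hle (Nat.le_of_dvd hpos hd)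

lemma cnt_fr1 [IsGalois ℚ K] [IsGalois ℚ E] {l : ℕ} (hl : l.Prime) (V : Subgroup Gal(K/ℚ))
    (hVE : ∀ σ ∈ V, ∀ x : E, σ (algebraMap E K x) = algebraMap E K x)
    (ht : TrivIn E l) (h : Fr K V l) : cnt E l = Module.finrank ℚ E := by
  obtain ⟨Q, hQ, hlQ, σ, hσ, hx⟩ := h
  have hPp : (Q.comap (algebraMap (𝓞 E) (𝓞 K))).IsPrime := Ideal.comap_isPrime _ _
  have hlP : (l : 𝓞 E) ∈ (Q.comap (algebraMap (𝓞 E) (𝓞 K))) := by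
    rw [Ideal.mem_comap, map_natCast]; exact hlQ
  refine cnt_galois hl ht (absNorm_eq_of_pow hl hPp hlP fun x => ?_)
  rw [Ideal.mem_comap]
  have h1 := hx (algebraMap (𝓞 E) (𝓞 K) x)
  have h2 : σ • (algebraMap (𝓞 E) (𝓞 K) x) = algebraMap (𝓞 E) (𝓞 K) x := by
    apply RingOfIntegers.ext
    exact hVE σ hσ (x : E)
  rw [h2] at h1
  rw [map_sub, map_pow, ← neg_mem_iff, neg_sub]
  exact h1

lemma cnt_fr0 [IsGalois ℚ K] [IsGalois ℚ E] [IsScalarTower ℚ E K] {l : ℕ} (hl : l.Prime)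
    (V : Subgroup Gal(K/ℚ))
    (hVE : ∀ σ : Gal(K/ℚ), (∀ x : E, σ (algebraMap E K x) = algebraMap E K x) → σ ∈ V)
    (ht : TrivIn E l) (hF : ¬ Fr K V l) : cnt E l = 0 := by
  by_contra hc
  have : Nonempty {I : Ideal (𝓞 E) // Ideal.absNorm I = l} := by
    by_contra he
    rw [not_nonempty_iff] at he
    exact hc (by unfold cnt; exact Nat.card_of_isEmpty)
  obtain ⟨P, hP⟩ := this
  obtain ⟨hPp, hlP⟩ := norm_prime hl hP
  have hint : Algebra.IsIntegral (𝓞 E) (𝓞 K) := inferInstance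
  obtain ⟨Q, hQp, hQ⟩ := Ideal.exists_ideal_over_prime_of_isIntegral_of_isDomain (S := 𝓞 K) P
    (by
      rw [(RingHom.injective_iff_ker_eq_bot _).1 (FaithfulSMul.algebraMap_injective (𝓞 E) (𝓞 K))]
      exact bot_le)
  have hmem : ∀ x, x ∈ P ↔ algebraMap (𝓞 E) (𝓞 K) x ∈ Q := by
    intro x; rw [← hQ, Ideal.mem_comap]
  have hlQ : (l : 𝓞 K) ∈ Q := by
    have h1 := (hmem _).1 hlP
    rwa [map_natCast] at h1
  obtain ⟨σ, -, hσ⟩ := exists_frob hl hQp hlQ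
  apply hF
  refine ⟨Q, hQp, hlQ, σ, hVE σ ?_, hσ⟩
  have h1 : σ.restrictNormal E = 1 := by
    refine ht P hPp hlP _ fun x => ?_
    obtain ⟨n, hn⟩ := int_surj hl hP x
    have h2 : algebraMap (𝓞 E) (𝓞 K) (σ.restrictNormal E • x) =
        σ • (algebraMap (𝓞 E) (𝓞 K) x) := by
      apply RingOfIntegers.ext
      exact AlgEquiv.restrictNormal_commutes σ E (x : E)
    have h4 : σ • (n : 𝓞 K) = n := map_intCast (MulSemiringAction.toRingHom _ (𝓞 K) σ) n
    have h3 := (hmem _).1 hn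
    have h5 : σ • (algebraMap (𝓞 E) (𝓞 K) (x - n)) ∈ Q := by
      have h6 := hσ (algebraMap (𝓞 E) (𝓞 K) (x - n))
      have h7 := Ideal.pow_mem_of_mem Q h3 l hl.pos
      have := Q.add_mem h6 h7
      rwa [sub_add_cancel] at this
    rw [hmem, map_sub, h2]
    rw [map_sub, map_intCast] at h3 h5
    rw [smul_sub, h4] at h5
    have := Q.sub_mem h5 h3
    rwa [sub_sub_sub_cancel_right] at this
  intro x
  have := AlgEquiv.restrictNormal_commutes σ E x
  rw [h1] at this
  exact this.symm
end
end PD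
end PartD3b

section PartD4
open NumberField Filter Topology
open scoped Pointwise

namespace PD
section
variable (K : Type*) [Field K] [NumberField K]

open Classical in
noncomputable def SV (V : Subgroup Gal(K/ℚ)) (s : ℝ) (l : ℕ) : ℝ :=
  if l.Prime ∧ Fr K V l then (l : ℝ) ^ (-s) else 0

lemma rpow_le_one' {l : ℕ} {s : ℝ} (hl : l.Prime) (hs : 1 < s) : (l : ℝ) ^ (-s) ≤ 1 := by
  apply Real.rpow_le_one_of_one_le_of_nonpos
  · exact_mod_cast hl.one_lt.le
  · linarith

lemma SV_nonneg (V : Subgroup Gal(K/ℚ)) (s : ℝ) (l : ℕ) : 0 ≤ SV K V s l := by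
  unfold SV; split_ifs
  · positivity
  · exact le_rfl

lemma SV_summable (V : Subgroup Gal(K/ℚ)) {s : ℝ} (hs : 1 < s) : Summable (SV K V s) := by
  refine Summable.of_nonneg_of_le (SV_nonneg K V s) (fun l => ?_)
    (Real.summable_nat_rpow.2 (show -s < -1 by linarith))
  unfold SV; split_ifs
  · exact le_rfl
  · positivity

lemma tsum_finite_bound (B : ℕ) (hB : 0 < B) (f : ℕ → ℝ) (c : ℕ → ℝ) (hf : ∀ l, ¬ l ∣ B → f l ≤ 0)
    (hc0 : ∀ l, 0 ≤ c l) (hc : ∀ l, f l ≤ c l) (hs : Summable f) :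
    ∑' l, f l ≤ ∑ l ∈ B.divisors, c l := by
  classical
  have h1 : ∀ l, f l ≤ if l ∈ B.divisors then c l else 0 := by
    intro l
    split_ifs with h
    · exact hc l
    · rw [Nat.mem_divisors] at h
      apply hf
      intro h'; exact h ⟨h', hB.ne'⟩
  have h2 : HasSum (fun l => if l ∈ B.divisors then c l else 0) (∑ l ∈ B.divisors, c l) := by
    have := hasSum_sum_of_ne_finset_zero (f := fun l => if l ∈ B.divisors then c l else 0)
      (s := B.divisors) (L := SummationFilter.unconditional ℕ) (fun b hb => by simp only [hb, if_false])
    convert this using 1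
    exact Finset.sum_congr rfl fun x hx => by simp [hx]
  exact hasSum_le h1 hs.hasSum h2

lemma abs_tsum_finite_bound (B : ℕ) (hB : 0 < B) (f : ℕ → ℝ) (c : ℕ → ℝ)
    (hf : ∀ l, ¬ l ∣ B → f l = 0)
    (hc : ∀ l, |f l| ≤ c l) (hs : Summable f) :
    |∑' l, f l| ≤ ∑ l ∈ B.divisors, c l := by
  have hc0 : ∀ l, 0 ≤ c l := fun l => (abs_nonneg _).trans (hc l)
  rw [abs_le]
  constructor
  · have := tsum_finite_bound B hB (fun l => - f l) c (fun l h => by simp [hf l h]) hc0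
      (fun l => (neg_le_abs _).trans (hc l)) hs.neg
    rw [tsum_neg] at this
    linarith
  · exact tsum_finite_bound B hB f c (fun l h => (hf l h).le) hc0
      (fun l => (le_abs_self _).trans (hc l)) hs

open Classical in
lemma fr_est_aux {E : Type*} [Field E] [NumberField E] [IsGalois ℚ K] [IsGalois ℚ E] [Algebra E K]
    [IsScalarTower ℚ E K] (V : Subgroup Gal(K/ℚ))
    (hVE : ∀ σ : Gal(K/ℚ), σ ∈ V ↔ (∀ x : E, σ (algebraMap E K x) = algebraMap E K x)) :
    ∃ C, ∀ᶠ s in 𝓝[>] (1:ℝ),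
      |(Module.finrank ℚ E : ℝ) * (∑' l, SV K V s l) - Real.log (1/(s-1))| ≤ C := by
  obtain ⟨B, hB, hT⟩ := exists_trivIn E
  obtain ⟨C, hC⟩ := zeta_est E
  refine ⟨C + ∑ l ∈ B.divisors, ((cnt E l : ℝ) + Module.finrank ℚ E), ?_⟩
  filter_upwards [hC, self_mem_nhdsWithin] with s hs hs1
  have hs1 : 1 < s := hs1
  obtain ⟨hsum, hb⟩ := hs
  have hA : Summable (fun l : ℕ => if l.Prime then (cnt E l : ℝ) * (l : ℝ) ^ (-s) else 0) := by
    refine Summable.of_nonneg_of_le (fun l => ?_) (fun l => ?_) hsum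
    · split_ifs
      · positivity
      · exact le_rfl
    · split_ifs
      · exact le_rfl
      · positivity
  have hS := (SV_summable K V hs1).mul_left (Module.finrank ℚ E : ℝ)
  have key := abs_tsum_finite_bound B hB
    (fun l => (Module.finrank ℚ E : ℝ) * SV K V s l -
      (if l.Prime then (cnt E l : ℝ) * (l : ℝ) ^ (-s) else 0))
    (fun l => (cnt E l : ℝ) + Module.finrank ℚ E) ?_ ?_ (hS.sub hA)
  · rw [Summable.tsum_sub hS hA, tsum_mul_left] at key
    rw [abs_le] at *
    constructor <;> linarith [hb.1, hb.2, key.1, key.2]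
  · intro l hl
    by_cases hp : l.Prime
    · simp only [SV, hp, true_and, if_true]
      by_cases hF : Fr K V l
      · rw [if_pos hF, cnt_fr1 hp V (fun σ hσ => (hVE σ).1 hσ) (hT l hp hl) hF, sub_self]
      · rw [if_neg hF, cnt_fr0 hp V (fun σ hσ => (hVE σ).2 hσ) (hT l hp hl) hF]
        simp
    · simp [SV, hp]
  · intro l
    by_cases hp : l.Prime
    · have h1 : 0 ≤ SV K V s l := SV_nonneg K V s l
      have h3 := rpow_le_one' hp hs1
      have h4 : 0 ≤ (l : ℝ) ^ (-s) := by positivity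
      have h2 : SV K V s l ≤ 1 := by
        unfold SV; split_ifs
        · exact h3
        · exact zero_le_one
      rw [if_pos hp, abs_le]
      have c0 : (0 : ℝ) ≤ cnt E l := by positivity
      have e0 : (0 : ℝ) ≤ Module.finrank ℚ E := by positivity
      constructor <;> nlinarith
    · simp only [SV, hp, false_and, if_false, mul_zero, sub_self, abs_zero]
      positivity

lemma fr_est [IsGalois ℚ K] (V : Subgroup Gal(K/ℚ)) [hV : V.Normal] :
    ∃ C, ∀ᶠ s in 𝓝[>] (1:ℝ),
      |(∑' l, SV K V s l) * Nat.card Gal(K/ℚ) - Nat.card V * Real.log (1/(s-1))| ≤ C := by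
  have : IsGalois ℚ (IntermediateField.fixedField V) := IsGalois.of_fixedField_normal_subgroup V
  obtain ⟨C, hC⟩ := fr_est_aux K (E := IntermediateField.fixedField V) V (by
    intro σ
    conv_lhs => rw [← IntermediateField.fixingSubgroup_fixedField V]
    rw [IntermediateField.mem_fixingSubgroup_iff]
    exact ⟨fun h x => h _ x.2, fun h x hx => h ⟨x, hx⟩⟩)
  have hcard : Nat.card V * Module.finrank ℚ (IntermediateField.fixedField V) =
      Nat.card Gal(K/ℚ) := by
    rw [← IntermediateField.finrank_fixedField_eq_card V, IsGalois.card_aut_eq_finrank, mul_comm,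
      Module.finrank_mul_finrank]
  refine ⟨Nat.card V * C, ?_⟩
  filter_upwards [hC] with s hs
  rw [← hcard]
  push_cast
  have : (∑' l, SV K V s l) * ((Nat.card V : ℝ) * Module.finrank ℚ (IntermediateField.fixedField V))
    - Nat.card V * Real.log (1/(s-1)) = Nat.card V *
      ((Module.finrank ℚ (IntermediateField.fixedField V) : ℝ) * (∑' l, SV K V s l)
        - Real.log (1/(s-1))) := by ring
  rw [this, abs_mul, Nat.abs_cast]
  gcongr

variable {K}
lemma Fr.mono {V W : Subgroup Gal(K/ℚ)} (h : V ≤ W) {l : ℕ} (hF : Fr K V l) : Fr K W l := by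
  obtain ⟨Q, a, b, σ, hσ, hx⟩ := hF
  exact ⟨Q, a, b, σ, h hσ, hx⟩

theorem cover [IsGalois ℚ K] (V H W : Subgroup Gal(K/ℚ)) [V.Normal] [H.Normal] [W.Normal]
    (hVW : V ≤ W) (hHW : H ≤ W) (B : ℕ) (hB : 0 < B)
    (h : ∀ l : ℕ, l.Prime → ¬ l ∣ B → Fr K W l → Fr K V l ∨ Fr K H l) : W = V ∨ W = H := by
  classical
  have hcard : Nat.card W + Nat.card (V ⊓ H : Subgroup _) ≤ Nat.card V + Nat.card H := by
    by_contra hlt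
    push Not at hlt
    obtain ⟨C1, h1⟩ := fr_est K V
    obtain ⟨C2, h2⟩ := fr_est K H
    obtain ⟨C3, h3⟩ := fr_est K W
    obtain ⟨C4, h4⟩ := fr_est K (V ⊓ H)
    have htend : Tendsto (fun s : ℝ => Real.log (1/(s-1))) (𝓝[>] 1) atTop := by
      apply Real.tendsto_log_atTop.comp
      simp only [one_div]
      apply tendsto_inv_nhdsGT_zero.comp
      rw [tendsto_nhdsWithin_iff]
      constructor
      · have : Tendsto (fun s : ℝ => s - 1) (𝓝 1) (𝓝 (1 - 1)) := (continuous_id.sub continuous_const).tendsto 1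
        rw [sub_self] at this
        exact this.mono_left nhdsWithin_le_nhds
      · filter_upwards [self_mem_nhdsWithin] with s hs
        exact Set.mem_Ioi.2 (sub_pos.2 (Set.mem_Ioi.1 hs))
    set g : ℝ := ((Nat.card Gal(K/ℚ) : ℕ) : ℝ) with hg
    have hg0 : 0 ≤ g := by positivity
    set M := (∑ l ∈ B.divisors, (2 : ℝ)) with hM
    have h5 := htend.eventually_gt_atTop (C1 + C2 + C3 + C4 + M * g)
    obtain ⟨s, h1, h2, h3, h4, h5, h6, hs⟩ := (h1.and (h2.and (h3.and (h4.and (h5.and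
      ((htend.eventually_gt_atTop 0).and self_mem_nhdsWithin)))))).exists
    have hs : 1 < s := hs
    have sV := SV_summable K V hs
    have sH := SV_summable K H hs
    have sW := SV_summable K W hs
    have sI := SV_summable K (V ⊓ H) hs
    have key := tsum_finite_bound B hB
      (fun l => (SV K W s l + SV K (V ⊓ H) s l) - (SV K V s l + SV K H s l)) (fun _ => 2) ?_
      (fun _ => by norm_num) ?_ ((sW.add sI).sub (sV.add sH))
    · rw [Summable.tsum_sub (sW.add sI) (sV.add sH), Summable.tsum_add sW sI,
        Summable.tsum_add sV sH] at key
      have key2 := mul_le_mul_of_nonneg_right key hg0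
      rw [abs_le] at h1 h2 h3 h4
      have hlt' : (Nat.card V : ℝ) + Nat.card H + 1 ≤ Nat.card W + Nat.card (V ⊓ H : Subgroup _) := by
        exact_mod_cast hlt
      have := mul_le_mul_of_nonneg_right hlt' h6.le
      rw [← hM] at key2
      nlinarith [h1.1, h1.2, h2.1, h2.2, h3.1, h3.2, h4.1, h4.2]
    · intro l hl
      by_cases hp : l.Prime
      · have hx : 0 ≤ (l : ℝ) ^ (-s) := by positivity
        simp only [SV, hp, true_and]
        by_cases hI : Fr K (V ⊓ H) l
        · rw [if_pos hI, if_pos (hI.mono inf_le_left), if_pos (hI.mono inf_le_right),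
            if_pos (hI.mono (inf_le_left.trans hVW))]
          linarith
        · rw [if_neg hI]
          by_cases hW : Fr K W l
          · rw [if_pos hW]
            rcases h l hp hl hW with h' | h'
            · rw [if_pos h']; split_ifs <;> linarith
            · rw [if_pos h']; split_ifs <;> linarith
          · rw [if_neg hW]; split_ifs <;> linarith
      · simp [SV, hp]
    · intro l
      have a1 := SV_nonneg K V s l
      have a2 := SV_nonneg K H s l
      have a3 : ∀ V : Subgroup Gal(K/ℚ), SV K V s l ≤ 1 := by
        intro V
        unfold SV; split_ifs with hh
        · exact rpow_le_one' hh.1 hs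
        · exact zero_le_one
      linarith [a3 W, a3 (V ⊓ H)]
  by_contra hne
  push Not at hne
  have half : ∀ V : Subgroup Gal(K/ℚ), V ≤ W → W ≠ V → 2 * Nat.card V ≤ Nat.card W := by
    intro V hV hn
    obtain ⟨k, hk⟩ := Subgroup.card_dvd_of_le hV
    have hpos : 0 < Nat.card W := Nat.card_pos
    have hk0 : k ≠ 0 := by rintro rfl; omega
    have hk1 : k ≠ 1 := by
      rintro rfl
      exact hn (Subgroup.eq_of_le_of_card_ge hV (by omega)).symm
    have : 2 ≤ k := by omega
    rw [hk, mul_comm]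
    exact Nat.mul_le_mul_left _ this
  have e1 := half V hVW hne.1
  have e2 := half H hHW hne.2
  have : 0 < Nat.card (V ⊓ H : Subgroup _) := Nat.card_pos
  omega
end
end PD
end PartD4

section PartD5
open NumberField Filter Topology
open scoped Pointwise

namespace PD
section
variable (F : Type*) [Field F] [NumberField F]

def Sp (Q a : ℕ) : Prop := 0 < a ∧ ∃ M : ℕ, M.Coprime Q ∧ ∀ x : 𝓞 F, IsCoprime x (a : 𝓞 F) →
  (a : 𝓞 F) ∣ x ^ (2 * M) - 1

lemma Sp.one (Q : ℕ) : Sp F Q 1 := ⟨one_pos, 1, Nat.coprime_one_left Q, fun x _ => by simp⟩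

variable {F}
lemma Sp.mul {Q a b : ℕ} (hc : a.Coprime Q) (ha : Sp F Q a) (hb : Sp F Q b) : Sp F Q (a * b) := by
  obtain ⟨ha0, M1, hM1, h1⟩ := ha
  obtain ⟨hb0, M2, hM2, h2⟩ := hb
  refine ⟨Nat.mul_pos ha0 hb0, M1 * M2 * a, (hM1.mul_left hM2).mul_left hc, fun x hx => ?_⟩
  push_cast at hx ⊢
  have ca : (a : 𝓞 F) ∣ x ^ (2 * M1 * M2) - 1 := by
    refine (h1 x (IsCoprime.of_mul_right_left hx)).trans ?_
    rw [pow_mul _ (2 * M1)]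
    exact sub_one_dvd_pow_sub_one _ _
  have cb : (b : 𝓞 F) ∣ x ^ (2 * M1 * M2) - 1 := by
    refine (h2 x (IsCoprime.of_mul_right_right hx)).trans ?_
    rw [mul_right_comm, pow_mul _ (2 * M2)]
    exact sub_one_dvd_pow_sub_one _ _
  rw [show 2 * (M1 * M2 * a) = 2 * M1 * M2 * a by ring, pow_mul]
  set u := x ^ (2 * M1 * M2)
  rw [← geom_sum_mul u a]
  refine mul_dvd_mul ?_ cb
  have : (∑ i ∈ Finset.range a, u ^ i) = (∑ i ∈ Finset.range a, (u ^ i - 1)) + a := by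
    rw [Finset.sum_sub_distrib]; simp
  rw [this]
  refine dvd_add (Finset.dvd_sum fun i _ => ca.trans (sub_one_dvd_pow_sub_one u i)) dvd_rfl

lemma coprime_half {Q l : ℕ} (h4 : 4 ∣ Q) (hl : Odd l) (h : Q ∣ l + 1) : ((l - 1) / 2).Coprime Q := by
  obtain ⟨k, rfl⟩ := hl
  obtain ⟨q, rfl⟩ := h4
  have e : (2 * k + 1 - 1) / 2 = k := by omega
  rw [e]
  have h2 : 2 * q ∣ k + 1 := by
    obtain ⟨t, ht⟩ := h
    exact ⟨t, by linarith⟩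
  have : k.Coprime (2 * q) := Nat.Coprime.coprime_dvd_right h2 (by simp)
  have h3 : k.Coprime 2 := this.coprime_mul_right_right
  rw [show 4 * q = 2 * (2 * q) by ring]
  exact h3.mul_right this

lemma Sp_of_rad {Q l : ℕ} (h4 : 4 ∣ Q) (hl : l.Prime) (hlo : Odd l) (h : Q ∣ l + 1) 
    (hr : ∀ P : Ideal (𝓞 F), P.IsPrime → (l : 𝓞 F) ∈ P → ∀ x : 𝓞 F, x ^ l - x ∈ P) : Sp F Q l := by
  have hlQ : l.Coprime Q := Nat.Coprime.coprime_dvd_right h (by simp)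
  obtain ⟨k, hk⟩ := (Ideal.span {(l : 𝓞 F)}).exists_radical_pow_le_of_fg
    (IsNoetherian.noetherian _)
  refine ⟨hl.pos, (l - 1) / 2 * l ^ k, (coprime_half h4 hlo h).mul_left (hlQ.pow_left k), ?_⟩
  intro x hx
  have e : 2 * ((l - 1) / 2 * l ^ k) = (l - 1) * l ^ k := by
    obtain ⟨t, rfl⟩ := hlo
    have e : (2 * t + 1 - 1) / 2 = t := by omega
    rw [e, ← mul_assoc]; simp
  rw [e, pow_mul]
  have h1 : x ^ l - x ∈ (Ideal.span {(l : 𝓞 F)}).radical := by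
    rw [Ideal.radical_eq_sInf, Submodule.mem_sInf]
    rintro P ⟨hP, hPp⟩
    exact hr P hPp ((Ideal.span_singleton_le_iff_mem _).1 hP) x
  have h2 := hk (Ideal.pow_mem_pow h1 k)
  rw [Ideal.mem_span_singleton] at h2
  have h3 : (l : 𝓞 F) ∣ (x ^ (l - 1) - 1) ^ k := by
    refine IsCoprime.dvd_of_dvd_mul_left (x := (l : 𝓞 F)) (y := x ^ k) hx.symm.pow_right ?_
    rw [← mul_pow, mul_sub, ← pow_succ', Nat.sub_add_cancel hl.pos, mul_one]
    exact h2
  obtain ⟨r, hr⟩ := exists_add_pow_prime_pow_eq hl (1 : 𝓞 F) (x ^ (l - 1) - 1) k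
  rw [add_sub_cancel, one_pow] at hr
  rw [hr]
  have h4 : (l : 𝓞 F) ∣ (x ^ (l - 1) - 1) ^ l ^ k :=
    h3.trans (pow_dvd_pow _ (Nat.lt_pow_self hl.one_lt).le)
  obtain ⟨c, hc⟩ := h4
  rw [hc]
  exact ⟨c + 1 * (x ^ (l - 1) - 1) * r, by ring⟩

variable {K : Type*} [Field K] [NumberField K] [Algebra F K]

variable (F K) in
def VL : Subgroup Gal(K/ℚ) where
  carrier := {σ | ∀ (τ : Gal(K/ℚ)) (x : F), σ (τ (algebraMap F K x)) = τ (algebraMap F K x)}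
  one_mem' := fun _ _ => rfl
  mul_mem' := by
    intro a b ha hb τ x
    rw [AlgEquiv.mul_apply, hb τ x, ha τ x]
  inv_mem' := by
    intro a ha τ x
    rw [AlgEquiv.aut_inv, AlgEquiv.symm_apply_eq, ha τ x]

lemma mem_VL {σ : Gal(K/ℚ)} : σ ∈ VL F K ↔
  ∀ (τ : Gal(K/ℚ)) (x : F), σ (τ (algebraMap F K x)) = τ (algebraMap F K x) := Iff.rfl

instance : (VL F K).Normal := by
  constructor
  intro σ hσ g τ x
  rw [AlgEquiv.mul_apply, AlgEquiv.mul_apply]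
  have := hσ (g⁻¹ * τ) x
  rw [AlgEquiv.mul_apply] at this
  rw [this, ← AlgEquiv.mul_apply, mul_inv_cancel]; rfl

lemma exists_conj [IsGalois ℚ K] (htot : ∀ v : InfinitePlace F, v.IsReal) {q : ℕ} (hq : 0 < q) {ζ : K}
    (hζ : IsPrimitiveRoot ζ q) : ∃ c ∈ VL F K, c ζ = ζ⁻¹ := by
  obtain ⟨φ⟩ : Nonempty (K →+* ℂ) := inferInstance
  obtain ⟨c, hc⟩ := ComplexEmbedding.exists_comp_symm_eq_of_comp_eq (k := ℚ) φ
    ((starRingEnd ℂ).comp φ) (RingHom.ext fun x => by simp)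
  have hc' : ∀ y, φ (c⁻¹ y) = (starRingEnd ℂ) (φ y) := fun y => by
    have := congrArg (fun f => f y) hc
    simpa using this
  refine ⟨c⁻¹, ?_, ?_⟩
  · intro τ x
    apply φ.injective
    rw [hc']
    have h1 : ComplexEmbedding.IsReal (φ.comp ((τ : K →+* K).comp (algebraMap F K))) :=
      InfinitePlace.isReal_of_mk_isReal (htot _)
    exact congrArg (fun f => f x) (ComplexEmbedding.isReal_iff.1 h1)
  · apply φ.injective
    rw [hc', map_inv₀]
    have h1 : (φ ζ) ^ q = 1 := by rw [← map_pow, hζ.pow_eq_one, map_one]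
    exact (Complex.inv_eq_conj (Complex.norm_eq_one_of_pow_eq_one h1 hq.ne')).symm

lemma frob_root {l : ℕ} (hl : l.Prime) {q : ℕ} (hlq : ¬ l ∣ q) {ζ : K}
    (hζ : ζ ^ q = 1) (hq : 0 < q) {Q : Ideal (𝓞 K)} (hQ : Q.IsPrime) (hlQ : (l : 𝓞 K) ∈ Q)
    {σ : Gal(K/ℚ)} (h : ∀ x : 𝓞 K, σ • x - x ^ l ∈ Q) : σ ζ = ζ ^ l := by
  have hint : IsIntegral ℤ ζ := by
    refine IsIntegral.of_pow hq ?_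
    rw [hζ]; exact isIntegral_one
  have H : IsArithFrobAt ℤ σ Q := by
    intro x
    rw [under_eq hl hQ hlQ]
    rw [show Nat.card (ℤ ⧸ Ideal.span {(l : ℤ)}) = l by
      rw [← Submodule.cardQuot_apply, ← Ideal.absNorm_apply]; simp]
    exact h x
  have hqQ : (q : 𝓞 K) ∉ Q := by
    intro hq'
    have hco : Nat.Coprime l q := (Nat.Prime.coprime_iff_not_dvd hl).2 hlq
    have h1 : IsCoprime (l : ℤ) (q : ℤ) := Nat.isCoprime_iff_coprime.2 hco
    obtain ⟨u, v, huv⟩ := h1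
    apply hQ.ne_top
    rw [Ideal.eq_top_iff_one]
    have : ((u * l + v * q : ℤ) : 𝓞 K) ∈ Q := by
      push_cast
      exact Q.add_mem (Q.mul_mem_left _ hlQ) (Q.mul_mem_left _ hq')
    rwa [huv, Int.cast_one] at this
  have := AlgHom.IsArithFrobAt.apply_of_pow_eq_one H (ζ := (⟨ζ, hint⟩ : 𝓞 K)) (m := q)
    (RingOfIntegers.ext hζ) hqQ
  rw [under_eq hl hQ hlQ] at this
  rw [show Nat.card (ℤ ⧸ Ideal.span {(l : ℤ)}) = l by
      rw [← Submodule.cardQuot_apply, ← Ideal.absNorm_apply]; simp] at this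
  exact congrArg (fun y : 𝓞 K => (y : K)) this

lemma chi_eq {q : ℕ} [NeZero q] {ζ : K} (hζ : IsPrimitiveRoot ζ q) {σ : Gal(K/ℚ)} {r : ℕ}
    (h : σ ζ = ζ ^ r) : ((hζ.autToPow ℚ σ : (ZMod q)ˣ) : ZMod q) = r := by
  have h1 := hζ.autToPow_spec ℚ σ
  rw [h, ← pow_mod_orderOf ζ r, ← hζ.eq_orderOf] at h1
  have h2 := hζ.pow_inj (ZMod.val_lt _) (Nat.mod_lt _ (NeZero.pos q)) h1
  rw [← ZMod.natCast_zmod_val ((hζ.autToPow ℚ σ : (ZMod q)ˣ) : ZMod q), h2, ZMod.natCast_mod]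

theorem partD_abs [IsGalois ℚ K] (htot : ∀ v : InfinitePlace F, v.IsReal) (Q m : ℕ) (hQ : 0 < Q)
    (h4 : 4 ∣ Q) (hm : 0 < m) {ζ : K} (hζ : IsPrimitiveRoot ζ (Q * m)) {σ : Gal(K/ℚ)}
    (hσ : σ ∈ VL F K) (r : ℕ) (hr : σ ζ = ζ ^ r) (hr1 : r ≡ 1 [MOD Q]) :
    ∃ a : ℕ, Sp F Q a ∧ a ≡ r [MOD (Q * m)] := by
  classical
  have hq0 : 0 < Q * m := Nat.mul_pos hQ hm
  have : NeZero (Q * m) := ⟨hq0.ne'⟩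
  have : NeZero Q := ⟨hQ.ne'⟩
  have hd : Q ∣ Q * m := dvd_mul_right _ _
  set χ := hζ.autToPow ℚ with hχ
  set ψ := (ZMod.unitsMap hd).comp χ with hψ
  have ψval : ∀ (τ : Gal(K/ℚ)) (r : ℕ), τ ζ = ζ ^ r → ((ψ τ : (ZMod Q)ˣ) : ZMod Q) = r := by
    intro τ r h
    have h1 := chi_eq hζ h
    have h2 : ((ψ τ : (ZMod Q)ˣ) : ZMod Q) = ZMod.castHom hd (ZMod Q) ((χ τ : (ZMod (Q * m))ˣ) : ZMod (Q*m)) := rfl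
    rw [h2, h1, map_natCast]
  set T : Set (ZMod (Q * m))ˣ := {t | ∃ l : ℕ, l.Prime ∧ l.Coprime (Q * m) ∧ Sp F Q l ∧ (l : ZMod (Q * m)) = t}
    with hT
  set W : Subgroup Gal(K/ℚ) := VL F K ⊓ (Subgroup.zpowers (-1)).comap ψ with hW
  set V : Subgroup Gal(K/ℚ) := VL F K ⊓ (⊥ : Subgroup _).comap ψ with hV
  set H : Subgroup Gal(K/ℚ) := W ⊓ (Subgroup.closure T).comap χ with hH
  have hVW : V ≤ W := inf_le_inf_left _ (Subgroup.comap_mono bot_le)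
  have cov := cover V H W hVW inf_le_left (Q * m) hq0 (by
    intro l hl hlq hF
    obtain ⟨P, hP, hlP, τ, hτ, hx⟩ := hF
    have hroot := frob_root hl hlq hζ.pow_eq_one hq0 hP hlP hx
    have hlc : l.Coprime (Q * m) := (Nat.Prime.coprime_iff_not_dvd hl).2 hlq
    obtain ⟨k, hk⟩ := Subgroup.mem_zpowers_iff.1 hτ.2
    rcases Int.even_or_odd k with he | ho
    · left
      refine ⟨P, hP, hlP, τ, ⟨hτ.1, ?_⟩, hx⟩
      rw [he.neg_one_zpow] at hk
      exact hk.symm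
    · right
      rw [ho.neg_one_zpow] at hk
      refine ⟨P, hP, hlP, τ, ⟨hτ, ?_⟩, hx⟩
      apply Subgroup.subset_closure
      refine ⟨l, hl, hlc, ?_, (chi_eq hζ hroot).symm⟩
      have hl1 : Q ∣ l + 1 := by
        have := ψval τ l hroot
        rw [← hk] at this
        rw [← ZMod.natCast_eq_zero_iff]
        push_cast
        rw [← this]; simp
      refine Sp_of_rad h4 hl ?_ hl1 ?_
      · rw [← Nat.not_even_iff_odd]
        intro he
        have h2 : 2 ∣ l + 1 := ((by norm_num : 2 ∣ 4).trans h4).trans hl1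
        have := he.two_dvd
        omega
      · intro p hp hlp x
        obtain ⟨P', hP'p, hP'⟩ := Ideal.exists_ideal_over_prime_of_isIntegral_of_isDomain (S := 𝓞 K) p
          (by
            rw [(RingHom.injective_iff_ker_eq_bot _).1 (FaithfulSMul.algebraMap_injective (𝓞 F) (𝓞 K))]
            exact bot_le)
        have hlP' : (l : 𝓞 K) ∈ P' := by
          rw [← hP', Ideal.mem_comap, map_natCast] at hlp; exact hlp
        obtain ⟨s, hs, hsx⟩ := Fr.all (V := VL F K) hl inferInstance ⟨P, hP, hlP, τ, hτ.1, hx⟩ hP'p hlP'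
        have h1 := hsx (algebraMap (𝓞 F) (𝓞 K) x)
        have h2 : s • (algebraMap (𝓞 F) (𝓞 K) x) = algebraMap (𝓞 F) (𝓞 K) x := by
          apply RingOfIntegers.ext
          exact hs 1 (x : F)
        rw [h2] at h1
        rw [← hP', Ideal.mem_comap, map_sub, map_pow, ← neg_mem_iff, neg_sub]
        exact h1)
  have hWH : W = H := by
    refine cov.resolve_left fun hWV => ?_
    obtain ⟨c, hc, hcζ⟩ := exists_conj htot hq0 hζ
    have hcζ' : c ζ = ζ ^ (Q * m - 1) := by
      rw [hcζ]
      apply inv_eq_of_mul_eq_one_left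
      rw [← pow_succ, Nat.sub_add_cancel hq0, hζ.pow_eq_one]
    have h1 : ψ c = -1 := by
      apply Units.ext
      rw [ψval c _ hcζ', Nat.cast_sub hq0]
      simp
    have h2 : c ∈ W := ⟨hc, by
      change ψ c ∈ Subgroup.zpowers (-1); rw [h1]; exact Subgroup.mem_zpowers _⟩
    rw [hWV] at h2
    have h3 : ψ c = 1 := h2.2
    rw [h1] at h3
    have h5 : 2 < Q := by have := Nat.le_of_dvd hQ h4; omega
    have := Fact.mk h5
    exact ZMod.neg_one_ne_one (congrArg Units.val h3)
  have hσV : σ ∈ V := ⟨hσ, by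
    change ψ σ ∈ (⊥ : Subgroup _); rw [Subgroup.mem_bot]
    apply Units.ext
    rw [ψval σ r hr, Units.val_one, ← Nat.cast_one, ZMod.natCast_eq_natCast_iff]
    exact hr1⟩
  have hσH : χ σ ∈ Subgroup.closure T := by
    have := hVW hσV
    rw [hWH] at this
    exact this.2
  have hσH : χ σ ∈ Submonoid.closure T := by
    rw [← Subgroup.closure_toSubmonoid_of_finite]; exact hσH
  have : ∀ t ∈ Submonoid.closure T, ∃ a : ℕ, a.Coprime (Q * m) ∧ Sp F Q a ∧ (a : ZMod (Q * m)) = t := by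
    intro t ht
    induction ht using Submonoid.closure_induction with
    | mem x hx => obtain ⟨l, -, h⟩ := hx; exact ⟨l, h⟩
    | one => exact ⟨1, Nat.coprime_one_left _, Sp.one F Q, by simp⟩
    | mul x y _ _ hx hy =>
      obtain ⟨a, h1, h2, h3⟩ := hx
      obtain ⟨b, h1', h2', h3'⟩ := hy
      exact ⟨a * b, h1.mul_left h1', h2.mul h1.coprime_mul_right_right h2', by
        push_cast; rw [h3, h3']⟩
  obtain ⟨a, -, ha, hat⟩ := this _ hσH
  refine ⟨a, ha, ?_⟩
  rw [← ZMod.natCast_eq_natCast_iff, hat]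
  exact chi_eq hζ hr
end
end PD
end PartD5

section PartD6
open NumberField Filter Topology
open scoped Pointwise

namespace PD
section

lemma exists_sigma {L K : Type*} [Field L] [NumberField L] [Field K] [NumberField K]
    [Algebra L K] [IsScalarTower ℚ L K] [IsGalois ℚ K] (m : ℕ) (hm : 0 < m)
    (hd : IsCoprime (m : ℤ) (discr L)) {ζ : K} (hζ : IsPrimitiveRoot ζ m) (r : ℕ) (hr : r.Coprime m) :
    ∃ σ : Gal(K/ℚ), (∀ x : L, σ (algebraMap L K x) = algebraMap L K x) ∧ σ ζ = ζ ^ r := by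
  have : NeZero m := ⟨hm.ne'⟩
  let K1 : IntermediateField ℚ K := IntermediateField.adjoin ℚ {ζ}
  let K2 : IntermediateField ℚ K := (IsScalarTower.toAlgHom ℚ L K).fieldRange
  have hcyc : IsCyclotomicExtension {m} ℚ K1 := hζ.intermediateField_adjoin_isCyclotomicExtension ℚ
  have hG : IsGalois ℚ K1 := IsCyclotomicExtension.isGalois {m} ℚ K1
  have hN : @Normal ℚ K1 _ _ K1.algebra' := by convert hG.to_normal; exact Subsingleton.elim _ _
  have e : discr K2 = discr L :=
    (discr_eq_discr_of_algEquiv L (AlgEquiv.ofInjectiveField (IsScalarTower.toAlgHom ℚ L K))).symm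
  have hdj : K1 ⊓ K2 = ⊥ := by
    refine IntermediateField.LinearDisjoint.inf_eq_bot
      (linearDisjoint_of_isGalois_isCoprime_discr K K1 K2 ?_)
    rw [e]
    have h1 : (discr K1) ∣ (m : ℤ) ^ (Nat.totient m) := by
      rw [← Int.natAbs_dvd_natAbs, IsCyclotomicExtension.Rat.natAbs_discr m K1, Int.natAbs_pow,
        Int.natAbs_natCast]
      exact Nat.div_dvd_of_dvd (Nat.prod_primeFactors_pow_totient_ediv_dvd hm)
    exact (hd.pow_left (m := Nat.totient m)).of_isCoprime_of_dvd_left h1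
  have hsurj := IntermediateField.restrictRestrictAlgEquivMapHom_surjective K1 K2 hdj
  have hζr : IsPrimitiveRoot (ζ ^ r) m := hζ.pow_of_coprime r hr
  obtain ⟨ρ, hρ⟩ := minpoly.exists_algEquiv_of_root' (K := ℚ) (x := ζ ^ r) (y := ζ)
    (Algebra.IsAlgebraic.isAlgebraic _) (by
      rw [← Polynomial.cyclotomic_eq_minpoly_rat hζ hm, Polynomial.cyclotomic_eq_minpoly_rat hζr hm,
        minpoly.aeval])
  obtain ⟨φ, hφ⟩ := hsurj (ρ.restrictNormal K1)
  refine ⟨φ.restrictScalars ℚ, ?_, ?_⟩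
  · intro x
    exact φ.commutes ⟨algebraMap L K x, ⟨x, rfl⟩⟩
  · have hz : ζ ∈ K1 := IntermediateField.mem_adjoin_simple_self ℚ ζ
    have h1 := IntermediateField.restrictRestrictAlgEquivMapHom_apply K1 K2 φ ⟨ζ, hz⟩
    rw [hφ] at h1
    have h2 := AlgEquiv.restrictNormal_commutes ρ K1 ⟨ζ, hz⟩
    change φ ζ = _
    rw [← hρ]
    exact h1.symm.trans h2

lemma partD_tower {F L K : Type*} [Field F] [NumberField F] [Field L] [NumberField L] [Field K] [NumberField K]
    [Algebra F L] [Algebra L K] [Algebra F K] [IsScalarTower F L K] [IsScalarTower ℚ L K] [IsGalois ℚ K]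
    [IsGalois ℚ L]
    (htot : ∀ v : InfinitePlace F, v.IsReal) (Q m : ℕ) (hQ : 0 < Q)
    (h4 : 4 ∣ Q) (hm : 0 < m) (hd : IsCoprime (m : ℤ) (discr L)) (hQm : Q.Coprime m)
    {ξ : L} (hξ : IsPrimitiveRoot ξ Q) {ζ : K} (hζ : IsPrimitiveRoot ζ m) (r : ℕ) (hr : r.Coprime m) :
    ∃ a : ℕ, Sp F Q a ∧ a ≡ 1 [MOD Q] ∧ a ≡ r [MOD m] := by
  obtain ⟨σ, hσ, hσζ⟩ := exists_sigma (L := L) m hm hd hζ r hr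
  have hξ' : IsPrimitiveRoot (algebraMap L K ξ) Q := hξ.map_of_injective (algebraMap L K).injective
  have hprim : IsPrimitiveRoot (algebraMap L K ξ * ζ) (Q * m) := by
    rw [IsPrimitiveRoot.iff_orderOf, (Commute.all _ _).orderOf_mul_eq_mul_orderOf_of_coprime,
      ← hξ'.eq_orderOf, ← hζ.eq_orderOf]
    rw [← hξ'.eq_orderOf, ← hζ.eq_orderOf]; exact hQm
  obtain ⟨k, hk1, hk2⟩ := Nat.chineseRemainder hQm 1 r
  obtain ⟨a, ha, hak⟩ := partD_abs (F := F) htot Q m hQ h4 hm hprim (σ := σ) (by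
    intro τ x
    rw [IsScalarTower.algebraMap_apply F L K, ← AlgEquiv.restrictNormal_commutes τ L, hσ]) k (by
    rw [map_mul, hσ, hσζ, mul_pow]
    congr 1
    · conv_lhs => rw [← pow_one (algebraMap L K ξ)]
      rw [← pow_mod_orderOf, ← pow_mod_orderOf _ k, ← hξ'.eq_orderOf]
      rw [hk1.symm]
    · rw [← pow_mod_orderOf, ← pow_mod_orderOf _ k, ← hζ.eq_orderOf]
      rw [hk2.symm]) hk1
  exact ⟨a, ha, (hak.of_mul_right _).trans hk1, (hak.of_mul_left _).trans hk2⟩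

/-- a Galois number field above F containing the n-th roots of unity -/
lemma exists_field (F : Type*) [Field F] [NumberField F] (n : ℕ) (hn : 0 < n) :
    ∃ (L : IntermediateField ℚ (AlgebraicClosure (CyclotomicField n F))),
      NumberField L ∧ IsGalois ℚ L ∧ Nonempty (F →+* L) ∧ ∃ ξ : L, IsPrimitiveRoot ξ n := by
  have : NeZero n := ⟨hn.ne'⟩
  have : CharZero (CyclotomicField n F) := charZero_of_injective_algebraMap (algebraMap F _).injective
  have : NumberField (CyclotomicField n F) := IsCyclotomicExtension.numberField {n} F _
  let A := AlgebraicClosure (CyclotomicField n F)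
  have : CharZero A := charZero_of_injective_algebraMap (algebraMap (CyclotomicField n F) _).injective
  let L := IntermediateField.normalClosure ℚ (CyclotomicField n F) A
  let f : CyclotomicField n F →+* L := algebraMap (CyclotomicField n F) L
  have hA : Algebra.IsAlgebraic ℚ A := Algebra.IsAlgebraic.trans ℚ (CyclotomicField n F) A
  have : IsAlgClosure ℚ A := ⟨inferInstance, hA⟩
  have hG : Normal ℚ L := normalClosure.normal ℚ (CyclotomicField n F) A
  have hfd : FiniteDimensional ℚ L := normalClosure.is_finiteDimensional ℚ (CyclotomicField n F) A
  refine ⟨L, { to_charZero := inferInstance, to_finiteDimensional := hfd }, ⟨⟩, ⟨f.comp (algebraMap F _)⟩,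
    f (IsCyclotomicExtension.zeta n F _), ?_⟩
  exact (IsCyclotomicExtension.zeta_spec n F _).map_of_injective f.injective

theorem partD (F : Type*) [Field F] [NumberField F] (htot : ∀ v : InfinitePlace F, v.IsReal)
    (Q : ℕ) (hQ : 0 < Q) (h4 : 4 ∣ Q) :
    ∃ D : ℕ, 0 < D ∧ ∀ m : ℕ, 0 < m → m.Coprime D → ∀ r : ℕ, r.Coprime m →
      ∃ a : ℕ, Sp F Q a ∧ a ≡ 1 [MOD Q] ∧ a ≡ r [MOD m] := by
  obtain ⟨L, hLn, hLg, ⟨f⟩, ξ, hξ⟩ := exists_field F Q hQ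
  let _ : Algebra F L := f.toAlgebra
  refine ⟨Q * (discr L).natAbs, Nat.mul_pos hQ (Int.natAbs_pos.2 (discr_ne_zero L)), ?_⟩
  intro m hm hmD r hr
  obtain ⟨K, hKn, hKg, ⟨g⟩, ζ, hζ⟩ := exists_field L m hm
  let _ : Algebra L K := g.toAlgebra
  let _ : Algebra F K := (g.comp f).toAlgebra
  have : IsScalarTower F L K := IsScalarTower.of_algebraMap_eq fun x => rfl
  refine partD_tower (L := L) (K := K) htot Q m hQ h4 hm ?_ (hmD.coprime_mul_right_right).symm hξ hζ r hr
  rw [Int.isCoprime_iff_nat_coprime]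
  exact hmD.coprime_mul_left_right
end
end PD
end PartD6

section PartN1
open NumberField
namespace PD

structure Nice {F : Type*} [Field F] [NumberField F] (N : ℕ) (s : 𝓞 F) (m : ℕ) : Prop where
  pos : 0 < m
  cop : m.Coprime N
  dvd_iff : ∀ t : ℤ, s ∣ (t : 𝓞 F) ↔ (m : ℤ) ∣ t
  rep : ∀ x : 𝓞 F, ∃ t : ℤ, s ∣ x - t

variable {F : Type*} [Field F] [NumberField F]

lemma dvd_natNorm (a : 𝓞 F) : a ∣ ((Ideal.absNorm (Ideal.span {a}) : ℕ) : 𝓞 F) := by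
  rw [← Ideal.mem_span_singleton]
  exact Ideal.absNorm_mem _

lemma natNorm_pos {a : 𝓞 F} (ha : a ≠ 0) : 0 < Ideal.absNorm (Ideal.span {a}) := by
  rw [Nat.pos_iff_ne_zero, Ne, Ideal.absNorm_eq_zero_iff, Ideal.span_singleton_eq_bot]
  exact ha

lemma nice_of (N : ℕ) (s θ : 𝓞 F) (k : ℤ) (J : ℕ) (hs : s ≠ 0)
    (hk : s ∣ θ - k) (hJ : ∀ x : 𝓞 F, (J : 𝓞 F) * x ∈ Algebra.adjoin ℤ {θ})
    (hc : IsCoprime s (J : 𝓞 F)) (hN : (N : 𝓞 F) ∣ s - 1) : ∃ m, Nice N s m := by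
  have hadj : ∀ y ∈ Algebra.adjoin ℤ {θ}, ∃ t : ℤ, s ∣ y - t := by
    intro y hy
    induction hy using Algebra.adjoin_induction with
    | mem x hx => obtain rfl : x = θ := hx; exact ⟨k, hk⟩
    | algebraMap r => exact ⟨r, by simp⟩
    | add x y _ _ hx hy =>
      obtain ⟨t, ht⟩ := hx
      obtain ⟨t', ht'⟩ := hy
      refine ⟨t + t', ?_⟩
      have := dvd_add ht ht'
      push_cast
      convert this using 1; ring
    | mul x y _ _ hx hy =>
      obtain ⟨t, c, ht⟩ := hx
      obtain ⟨t', c', ht'⟩ := hy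
      refine ⟨t * t', c * y + t * c', ?_⟩
      push_cast
      linear_combination y * ht + t * ht'
  have hfin : Finite (𝓞 F ⧸ Ideal.span {s}) :=
    Ideal.finiteQuotientOfFreeOfNeBot _ (by simpa using hs)
  obtain ⟨J', hJ'⟩ : ∃ J' : ℤ, s ∣ J' * J - 1 := by
    have hu : IsUnit (Ideal.Quotient.mk (Ideal.span {s}) (J : 𝓞 F)) := by
      obtain ⟨u, v, huv⟩ := hc
      refine IsUnit.of_mul_eq_one (Ideal.Quotient.mk _ v) ?_
      rw [← map_mul, ← map_one (Ideal.Quotient.mk (Ideal.span {s})), Ideal.Quotient.eq,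
        Ideal.mem_span_singleton]
      exact ⟨-u, by linear_combination huv⟩
    obtain ⟨w, hw⟩ := hu
    have h1 : w ^ (Nat.card (𝓞 F ⧸ Ideal.span {s})ˣ) = 1 := pow_card_eq_one'
    have h2 : 0 < Nat.card (𝓞 F ⧸ Ideal.span {s})ˣ := Nat.card_pos
    obtain ⟨e, he⟩ : ∃ e, Nat.card (𝓞 F ⧸ Ideal.span {s})ˣ = e + 1 := ⟨_, (Nat.succ_pred_eq_of_pos h2).symm⟩
    refine ⟨(J : ℤ) ^ e, ?_⟩
    rw [he, pow_succ] at h1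
    rw [← Ideal.mem_span_singleton, ← Ideal.Quotient.eq]
    have h3 := congrArg Units.val h1
    simp only [Units.val_mul, Units.val_pow_eq_pow_val, hw, Units.val_one] at h3
    simpa using h3
  have hrep : ∀ x : 𝓞 F, ∃ t : ℤ, s ∣ x - t := by
    intro x
    obtain ⟨t, c, ht⟩ := hadj _ (hJ x)
    obtain ⟨e, he⟩ := hJ'
    refine ⟨J' * t, J' * c - e * x, ?_⟩
    push_cast
    linear_combination J' * ht - x * he
  obtain ⟨g, hg⟩ := (inferInstance : ((Ideal.span {s}).comap (Int.castRingHom (𝓞 F))).IsPrincipal)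
  have hiff : ∀ t : ℤ, s ∣ (t : 𝓞 F) ↔ (g.natAbs : ℤ) ∣ t := by
    intro t
    rw [Int.natAbs_dvd]
    have : t ∈ (Ideal.span {s}).comap (Int.castRingHom (𝓞 F)) ↔ g ∣ t := by
      rw [hg]; exact Ideal.mem_span_singleton
    rw [← this, Ideal.mem_comap, Ideal.mem_span_singleton]; rfl
  refine ⟨g.natAbs, ?_, ?_, hiff, hrep⟩
  · rw [Nat.pos_iff_ne_zero]
    intro h0
    have := (hiff (Ideal.absNorm (Ideal.span {s}) : ℕ)).1 (by exact_mod_cast dvd_natNorm s)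
    rw [h0] at this
    have h4 := natNorm_pos hs
    have h7 : 0 ∣ Ideal.absNorm (Ideal.span {s}) := by exact_mod_cast this
    exact h4.ne' (zero_dvd_iff.1 h7)
  · obtain ⟨v, hv⟩ := hN
    obtain ⟨t, ht⟩ := hrep v
    have h5 : s ∣ ((N * t + 1 : ℤ) : 𝓞 F) := by
      obtain ⟨c, hc⟩ := ht
      refine ⟨1 - N * c, ?_⟩
      push_cast
      linear_combination -hv - N * hc
    have h6 := (hiff _).1 h5
    rw [← Nat.isCoprime_iff_coprime]
    obtain ⟨c, hc⟩ := h6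
    exact ⟨c, -t, by linear_combination -hc⟩

lemma exists_prim_shift (x : 𝓞 F) (k : 𝓞 F) (c : ℤ) (hc : c ≠ 0) (hk : k = c) : ∃ y : 𝓞 F,
    IntermediateField.adjoin ℚ {((x + k * y : 𝓞 F) : F)} = ⊤ := by
  obtain ⟨α, hα⟩ := Field.exists_primitive_element ℚ F
  obtain ⟨⟨τ, b⟩, hτ⟩ := IsLocalization.surj (Algebra.algebraMapSubmonoid (𝓞 F) (nonZeroDivisors ℤ)) α
  obtain ⟨n, hn, hb⟩ := b.2
  have hn0 : n ≠ 0 := nonZeroDivisors.ne_zero hn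
  have hfin : Finite (IntermediateField ℚ F) := Field.finite_intermediateField_of_exists_primitive_element ℚ F ⟨α, hα⟩
  obtain ⟨i, j, hij, he⟩ := Finite.exists_ne_map_eq_of_infinite
    (fun j : ℕ => IntermediateField.adjoin ℚ {((x + k * ((j : 𝓞 F) * τ) : 𝓞 F) : F)})
  refine ⟨i * τ, ?_⟩
  rw [eq_top_iff, ← hα, IntermediateField.adjoin_simple_le_iff]
  have h1 := IntermediateField.mem_adjoin_simple_self ℚ ((x + k * ((i : 𝓞 F) * τ) : 𝓞 F) : F)
  have h2 := IntermediateField.mem_adjoin_simple_self ℚ ((x + k * ((j : 𝓞 F) * τ) : 𝓞 F) : F)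
  rw [← he] at h2
  have h3 := sub_mem h1 h2
  have h4 : α = (algebraMap ℚ F (1 / (c * (i - j) * n))) * (((x + k * ((i : 𝓞 F) * τ) : 𝓞 F) : F) - ((x + k * ((j : 𝓞 F) * τ) : 𝓞 F) : F)) := by
    simp only at hτ
    rw [← hb] at hτ
    have e1 : ((c : F) * ((i : F) - j) * n) ≠ 0 := by
      have : ((c : F) * ((i : F) - j) * n) = (((c * ((i : ℤ) - j) * n : ℤ)) : F) := by push_cast; ring
      rw [this, Int.cast_ne_zero]
      have : (i : ℤ) - j ≠ 0 := by omega
      positivity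
    subst hk
    simp only [map_div₀, map_one, map_mul, map_sub, map_natCast, map_intCast]
    simp at hτ
    rw [one_div, inv_mul_eq_div, eq_div_iff e1]
    simp only [map_add, map_mul, map_natCast, map_intCast]
    rw [← hτ]; ring
  have h5 := mul_mem (IntermediateField.algebraMap_mem (IntermediateField.adjoin ℚ {((x + k * ((i : 𝓞 F) * τ) : 𝓞 F) : F)}) (1 / (c * (i - j) * n))) h3
  rw [← h4] at h5
  exact h5

lemma exists_index (θ : 𝓞 F) (hθ : IntermediateField.adjoin ℚ {(θ : F)} = ⊤) :
    ∃ J : ℕ, 0 < J ∧ ∀ x : 𝓞 F, (J : 𝓞 F) * x ∈ Algebra.adjoin ℤ {θ} := by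
  have h1 : ∀ x : F, ∃ J : ℕ, 0 < J ∧ ∃ y ∈ Algebra.adjoin ℤ {θ}, (J : F) * x = (y : F) := by
    intro x
    have hx : x ∈ IntermediateField.adjoin ℚ {(θ : F)} := by rw [hθ]; trivial
    rw [← IntermediateField.mem_toSubalgebra, IntermediateField.adjoin_simple_toSubalgebra_of_isAlgebraic (Algebra.IsAlgebraic.isAlgebraic _)] at hx
    induction hx using Algebra.adjoin_induction with
    | mem x hx => obtain rfl : x = θ := hx; exact ⟨1, one_pos, θ, Algebra.self_mem_adjoin_singleton _ _, by simp⟩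
    | algebraMap r =>
      refine ⟨r.den, r.den_pos, (r.num : 𝓞 F), ?_, ?_⟩
      · exact Subalgebra.intCast_mem _ _
      · have : (r.den : ℚ) * r = r.num := Rat.den_mul_eq_num r
        have := congrArg (algebraMap ℚ F) this
        rw [map_mul, map_natCast, map_intCast] at this
        simpa only [map_intCast] using this
    | add x y _ _ hx hy =>
      obtain ⟨J, hJ, z, hz, e⟩ := hx
      obtain ⟨J', hJ', z', hz', e'⟩ := hy
      refine ⟨J * J', Nat.mul_pos hJ hJ', J' * z + J * z', ?_, ?_⟩
      · exact add_mem (mul_mem (Subalgebra.natCast_mem _ _) hz) (mul_mem (Subalgebra.natCast_mem _ _) hz')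
      · push_cast
        linear_combination J' * e + J * e'
    | mul x y _ _ hx hy =>
      obtain ⟨J, hJ, z, hz, e⟩ := hx
      obtain ⟨J', hJ', z', hz', e'⟩ := hy
      refine ⟨J * J', Nat.mul_pos hJ hJ', z * z', mul_mem hz hz', ?_⟩
      push_cast
      linear_combination J' * y * e + z * e'
  have h2 : ∀ x : 𝓞 F, ∃ J : ℕ, 0 < J ∧ (J : 𝓞 F) * x ∈ Algebra.adjoin ℤ {θ} := by
    intro x
    obtain ⟨J, hJ, y, hy, e⟩ := h1 x
    refine ⟨J, hJ, ?_⟩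
    have : (J : 𝓞 F) * x = y := RingOfIntegers.coe_injective (by simpa using e)
    rwa [this]
  let b := RingOfIntegers.basis F
  choose J hJ hJm using fun i => h2 (b i)
  refine ⟨∏ i, J i, Finset.prod_pos fun i _ => hJ i, fun x => ?_⟩
  rw [← b.sum_repr x, Finset.mul_sum]
  refine sum_mem fun i _ => ?_
  rw [← Finset.prod_erase_mul _ _ (Finset.mem_univ i)]
  push_cast
  have : ((∏ x ∈ Finset.univ.erase i, (J x : 𝓞 F)) * J i) * (b.repr x i • b i) = (b.repr x i) • (((∏ x ∈ Finset.univ.erase i, J x : ℕ) : 𝓞 F) * (J i * b i)) := by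
    push_cast; rw [mul_smul_comm, mul_assoc]
  rw [this]
  exact Subalgebra.smul_mem _ (mul_mem (Subalgebra.natCast_mem _ _) (hJm i)) _

end PD
end PartN1

section PartN2
open NumberField
namespace PD
variable {F : Type*} [Field F] [NumberField F]

lemma isCoprime_iff_prime {R : Type*} [CommRing R] (a b : R) :
    IsCoprime a b ↔ ∀ P : Ideal R, P.IsPrime → a ∈ P → b ∉ P := by
  constructor
  · rintro ⟨u, v, h⟩ P hP ha hb
    exact hP.ne_top ((Ideal.eq_top_iff_one _).2 (h ▸ add_mem (P.mul_mem_left u ha) (P.mul_mem_left v hb)))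
  · intro h
    rw [← Ideal.isCoprime_span_singleton_iff, Ideal.isCoprime_iff_sup_eq]
    by_contra hne
    obtain ⟨P, hP, hle⟩ := Ideal.exists_le_maximal _ hne
    exact h P hP.isPrime (hle (Ideal.mem_sup_left (Ideal.mem_span_singleton_self a)))
      (hle (Ideal.mem_sup_right (Ideal.mem_span_singleton_self b)))

lemma mem_prime_of_nat {l : ℕ} (hl : l.Prime) {P : Ideal (𝓞 F)} (hP : P.IsPrime)
    (h : (l : 𝓞 F) ∈ P) {t : ℤ} (ht : (t : 𝓞 F) ∈ P) : (l : ℤ) ∣ t := by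
  by_contra hn
  have h1 : IsCoprime (l : ℤ) t := by
    rw [Int.isCoprime_iff_gcd_eq_one]
    rw [← Int.isCoprime_iff_gcd_eq_one]
    exact ((Nat.prime_iff_prime_int.1 hl).coprime_iff_not_dvd).2 hn
  have h2 := h1.map (Int.castRingHom (𝓞 F))
  exact (isCoprime_iff_prime _ _).1 h2 P hP (by simpa using h) (by simpa using ht)

lemma exists_prime_of_nat_mem {J : ℕ} (hJ : 0 < J) {P : Ideal (𝓞 F)} (hP : P.IsPrime)
    (h : (J : 𝓞 F) ∈ P) : ∃ l : ℕ, l.Prime ∧ l ∣ J ∧ (l : 𝓞 F) ∈ P := by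
  induction J using Nat.recOnMul with
  | zero => omega
  | one => exact absurd ((Ideal.eq_top_iff_one _).2 (by simpa using h)) hP.ne_top
  | prime p hp => exact ⟨p, hp, dvd_rfl, h⟩
  | mul a b ha hb =>
    push_cast at h
    rcases hP.mem_or_mem h with h | h
    · obtain ⟨l, h1, h2, h3⟩ := ha (Nat.pos_of_mul_pos_right hJ) h
      exact ⟨l, h1, h2.mul_right _, h3⟩
    · obtain ⟨l, h1, h2, h3⟩ := hb (Nat.pos_of_mul_pos_left hJ) h
      exact ⟨l, h1, h2.mul_left _, h3⟩

lemma avoid_prime {l : ℕ} (hl : l.Prime) (N : ℕ) (hsm : l ≤ Module.finrank ℚ F → l ∣ N)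
    (a β : 𝓞 F) (hab : IsCoprime a β) (hβ : (N : 𝓞 F) ∣ β - 1) :
    ∃ t : ℕ, ∀ P : Ideal (𝓞 F), P.IsPrime → (l : 𝓞 F) ∈ P → β + a * N * t ∉ P := by
  classical
  by_cases hN : l ∣ N
  · refine ⟨0, fun P hP hlP h => ?_⟩
    have hNP : (N : 𝓞 F) ∈ P := by
      obtain ⟨c, rfl⟩ := hN
      push_cast
      exact P.mul_mem_right _ hlP
    have h1 : β - 1 ∈ P := by
      obtain ⟨c, hc⟩ := hβ; rw [hc]; exact P.mul_mem_right _ hNP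
    apply hP.ne_top
    rw [Ideal.eq_top_iff_one]
    simp at h
    have := sub_mem h h1
    simpa using this
  have hd : Module.finrank ℚ F < l := by
    by_contra hh; exact hN (hsm (not_lt.1 hh))
  have hb : Ideal.span {(l : ℤ)} ≠ ⊥ := by simpa using hl.ne_zero
  have hmax : (Ideal.span {(l : ℤ)}).IsMaximal :=
    Ideal.IsPrime.isMaximal ((Ideal.span_singleton_prime (by exact_mod_cast hl.ne_zero)).2
      (Nat.prime_iff_prime_int.1 hl)) hb
  set S := IsDedekindDomain.primesOverFinset (Ideal.span {(l : ℤ)}) (𝓞 F) with hSdef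
  have hS : S.card ≤ Module.finrank ℚ F := by
    have := Ideal.card_primesOverFinset_le_finrank (R := ℤ) (S := 𝓞 F) ℚ F
      (p := Ideal.span {(l : ℤ)}) hb
    exact this
  have hmemS : ∀ P : Ideal (𝓞 F), P.IsPrime → (l : 𝓞 F) ∈ P → P ∈ S := by
    intro P hP hl'
    rw [hSdef, IsDedekindDomain.mem_primesOverFinset_iff hb]
    rw [Ideal.mem_primesOver_iff_mem_normalizedFactors _ hb,
      Ideal.mem_normalizedFactors_iff (Ideal.map_ne_bot_of_ne_bot hb)]
    refine ⟨hP, ?_⟩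
    rw [Ideal.map_span, Ideal.span_le]
    simpa using hl'
  by_contra! hcon
  choose P hP hlP hbad using hcon
  obtain ⟨i, hi, j, hj, hij, he⟩ := Finset.exists_ne_map_eq_of_card_lt_of_maps_to
    (s := Finset.range l) (t := S) (by rw [Finset.card_range]; omega) (f := P)
    (fun i _ => hmemS _ (hP i) (hlP i))
  have h1 := hbad i
  have h2 := hbad j
  rw [← he] at h2
  have h3 := sub_mem h1 h2
  have h4 : a * (N * (((i : ℤ) - j : ℤ) : 𝓞 F)) ∈ P i := by
    convert h3 using 1; push_cast; ring
  rcases (hP i).mem_or_mem h4 with h | h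
  · refine (isCoprime_iff_prime _ _).1 hab (P i) (hP i) h ?_
    have := sub_mem h1 (Ideal.mul_mem_right (N * i : 𝓞 F) _ h)
    convert this using 1; ring
  · rcases (hP i).mem_or_mem h with h | h
    · have := mem_prime_of_nat hl (hP i) (hlP i) (t := N) (by simpa using h)
      exact hN (by exact_mod_cast this)
    · have h5 := mem_prime_of_nat hl (hP i) (hlP i) h
      have h6 : (i : ℤ) - j = 0 := Int.eq_zero_of_abs_lt_dvd h5 (by
        rw [Finset.mem_range] at hi hj; rw [abs_lt]; omega)
      omega

theorem nice_exists (N : ℕ) (hN : 1 < N) (hsm : ∀ l : ℕ, l.Prime → l ≤ Module.finrank ℚ F → l ∣ N)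
    (a β : 𝓞 F) (ha : a ≠ 0) (hab : IsCoprime a β) (haN : IsCoprime a (N : 𝓞 F)) :
    ∃ s m, a ∣ s - β ∧ (N : 𝓞 F) ∣ s - 1 ∧ Nice N s m := by
  classical
  -- CRT
  obtain ⟨β0, h0a, h0N⟩ : ∃ β0 : 𝓞 F, a ∣ β0 - β ∧ (N : 𝓞 F) ∣ β0 - 1 := by
    obtain ⟨u, v, huv⟩ := haN
    exact ⟨u * a + v * N * β, ⟨u - u * β, by linear_combination β * huv⟩, ⟨v * β - v, by linear_combination huv⟩⟩
  obtain ⟨as, has⟩ := dvd_natNorm a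
  have hApos := natNorm_pos ha
  set A := Ideal.absNorm (Ideal.span {a}) with hA
  obtain ⟨y, hy⟩ := exists_prim_shift (as * β0) ((A : 𝓞 F) * N) (A * N : ℤ) (by positivity) (by push_cast; rfl)
  set β1 := β0 + a * N * y with hβ1
  have hθ : as * β0 + (A : 𝓞 F) * N * y = as * β1 := by rw [has, hβ1]; ring
  rw [hθ] at hy
  have h1a : a ∣ β1 - β := by
    obtain ⟨c, hc⟩ := h0a; exact ⟨c + N * y, by rw [hβ1]; linear_combination hc⟩
  have h1N : (N : 𝓞 F) ∣ β1 - 1 := by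
    obtain ⟨c, hc⟩ := h0N; exact ⟨c + a * y, by rw [hβ1]; linear_combination hc⟩
  have h1c : IsCoprime a β1 := by
    obtain ⟨c, hc⟩ := h1a
    obtain ⟨u, v, huv⟩ := hab
    exact ⟨u - v * c, v, by linear_combination huv + v * hc⟩
  obtain ⟨J, hJ, hJm⟩ := exists_index _ hy
  have hav : ∀ l : ℕ, ∃ t : ℕ, l ∈ J.primeFactors → ∀ P : Ideal (𝓞 F), P.IsPrime → (l : 𝓞 F) ∈ P → β1 + a * N * t ∉ P := by
    intro l
    by_cases hl : l ∈ J.primeFactors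
    · obtain ⟨t, ht⟩ := avoid_prime (Nat.prime_of_mem_primeFactors hl) N (hsm l (Nat.prime_of_mem_primeFactors hl)) a β1 h1c h1N
      exact ⟨t, fun _ => ht⟩
    · exact ⟨0, fun h => absurd h hl⟩
  choose t ht using hav
  obtain ⟨T, hT⟩ := Nat.chineseRemainderOfFinset t (fun l => l) J.primeFactors
    (fun l hl => (Nat.prime_of_mem_primeFactors hl).ne_zero)
    (fun l hl l' hl' hne => (Nat.coprime_primes (Nat.prime_of_mem_primeFactors hl) (Nat.prime_of_mem_primeFactors hl')).2 hne)
  set s := β1 + a * N * T with hs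
  have hsN : (N : 𝓞 F) ∣ s - 1 := by
    obtain ⟨c, hc⟩ := h1N; exact ⟨c + a * T, by rw [hs]; linear_combination hc⟩
  have hsa : a ∣ s - β := by
    obtain ⟨c, hc⟩ := h1a; exact ⟨c + N * T, by rw [hs]; linear_combination hc⟩
  have hs0 : s ≠ 0 := by
    intro h
    rw [h, zero_sub, dvd_neg] at hsN
    have h2 : IsUnit ((N : ℤ) : 𝓞 F) := isUnit_of_dvd_one (by exact_mod_cast hsN)
    have h3 := (Ideal.absNorm_eq_one_iff (I := Ideal.span {((N : ℕ) : 𝓞 F)})).2 (Ideal.span_singleton_eq_top.2 (by exact_mod_cast h2))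
    rw [Ideal.absNorm_span_natCast] at h3
    have h4 : Module.finrank ℤ (𝓞 F) ≠ 0 := by
      rw [RingOfIntegers.rank]; exact Module.finrank_pos.ne'
    have := (Nat.pow_eq_one.1 h3).resolve_right h4
    omega
  have hsJ : IsCoprime s (J : 𝓞 F) := by
    rw [isCoprime_iff_prime]
    intro P hP hsP hJP
    obtain ⟨l, hl, hlJ, hlP⟩ := exists_prime_of_nat_mem hJ hP hJP
    have hlm : l ∈ J.primeFactors := Nat.mem_primeFactors.2 ⟨hl, hlJ, hJ.ne'⟩
    refine ht l hlm P hP hlP ?_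
    have h5 := hT l hlm
    obtain ⟨c, hc⟩ := (Nat.modEq_iff_dvd.1 h5 : (l : ℤ) ∣ _)
    have hc' := congrArg (Int.castRingHom (𝓞 F)) hc
    simp at hc'
    have h6 := add_mem hsP (P.mul_mem_right (c * (a * N)) hlP)
    convert h6 using 1
    rw [hs]
    linear_combination (a * N) * hc'
  obtain ⟨m, hm⟩ := nice_of N s (as * β1) (-(A * N * T)) J hs0 (by
    refine ⟨as, ?_⟩
    push_cast
    rw [hs, has]; ring) hJm hsJ hsN
  exact ⟨s, m, hsa, hsN, hm⟩
end PD
end PartN2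

section PartM1
open NumberField
namespace PD

section basics
variable {R : Type*} [CommRing R]

abbrev SL (R : Type*) [CommRing R] := Matrix.SpecialLinearGroup (Fin 2) R

def ea (x : SL R) : R := x.1 0 0
def eb (x : SL R) : R := x.1 0 1
def ec (x : SL R) : R := x.1 1 0
def ed (x : SL R) : R := x.1 1 1

lemma edet (x : SL R) : ea x * ed x - eb x * ec x = 1 := by
  have := x.2; rw [Matrix.det_fin_two] at this; exact this

lemma ext4 {x y : SL R} (h1 : ea x = ea y) (h2 : eb x = eb y) (h3 : ec x = ec y)
    (h4 : ed x = ed y) : x = y := by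
  ext i j
  fin_cases i <;> fin_cases j
  · exact h1
  · exact h2
  · exact h3
  · exact h4

def mk2 (a b c d : R) (h : a * d - b * c = 1) : SL R :=
  ⟨!![a, b; c, d], by rw [Matrix.det_fin_two_of]; exact h⟩

@[simp] lemma ea_mk (a b c d : R) (h) : ea (mk2 a b c d h) = a := rfl
@[simp] lemma eb_mk (a b c d : R) (h) : eb (mk2 a b c d h) = b := rfl
@[simp] lemma ec_mk (a b c d : R) (h) : ec (mk2 a b c d h) = c := rfl
@[simp] lemma ed_mk (a b c d : R) (h) : ed (mk2 a b c d h) = d := rfl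
@[simp] lemma ea_one : ea (1 : SL R) = 1 := by simp [ea]
@[simp] lemma eb_one : eb (1 : SL R) = 0 := by simp [eb]
@[simp] lemma ec_one : ec (1 : SL R) = 0 := by simp [ec]
@[simp] lemma ed_one : ed (1 : SL R) = 1 := by simp [ed]
@[simp] lemma ea_mul (x y : SL R) : ea (x * y) = ea x * ea y + eb x * ec y := by
  simp [ea, eb, ec, Matrix.mul_apply, Fin.sum_univ_two]
@[simp] lemma eb_mul (x y : SL R) : eb (x * y) = ea x * eb y + eb x * ed y := by
  simp [ea, eb, ed, Matrix.mul_apply, Fin.sum_univ_two]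
@[simp] lemma ec_mul (x y : SL R) : ec (x * y) = ec x * ea y + ed x * ec y := by
  simp [ea, ec, ed, Matrix.mul_apply, Fin.sum_univ_two]
@[simp] lemma ed_mul (x y : SL R) : ed (x * y) = ec x * eb y + ed x * ed y := by
  simp [eb, ec, ed, Matrix.mul_apply, Fin.sum_univ_two]
@[simp] lemma ea_inv (x : SL R) : ea x⁻¹ = ed x := by
  rw [ea, Matrix.SpecialLinearGroup.SL2_inv_expl]; rfl
@[simp] lemma eb_inv (x : SL R) : eb x⁻¹ = -eb x := by
  rw [eb, Matrix.SpecialLinearGroup.SL2_inv_expl]; rfl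
@[simp] lemma ec_inv (x : SL R) : ec x⁻¹ = -ec x := by
  rw [ec, Matrix.SpecialLinearGroup.SL2_inv_expl]; rfl
@[simp] lemma ed_inv (x : SL R) : ed x⁻¹ = ea x := by
  rw [ed, Matrix.SpecialLinearGroup.SL2_inv_expl]; rfl

def uu (x : R) : SL R := mk2 1 x 0 1 (by ring)
def ll (x : R) : SL R := mk2 1 0 x 1 (by ring)
@[simp] lemma ea_uu (x : R) : ea (uu x) = 1 := rfl
@[simp] lemma eb_uu (x : R) : eb (uu x) = x := rfl
@[simp] lemma ec_uu (x : R) : ec (uu x) = 0 := rfl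
@[simp] lemma ed_uu (x : R) : ed (uu x) = 1 := rfl
@[simp] lemma ea_ll (x : R) : ea (ll x) = 1 := rfl
@[simp] lemma eb_ll (x : R) : eb (ll x) = 0 := rfl
@[simp] lemma ec_ll (x : R) : ec (ll x) = x := rfl
@[simp] lemma ed_ll (x : R) : ed (ll x) = 1 := rfl

lemma dvd_sub_one_mul {N a b : R} (ha : N ∣ a - 1) (hb : N ∣ b - 1) : N ∣ a * b - 1 := by
  obtain ⟨c, hc⟩ := ha
  obtain ⟨d, hd⟩ := hb
  exact ⟨c * b + d, by linear_combination b * hc + hd⟩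

/-- principal congruence subgroup -/
def Gm (N : R) : Subgroup (SL R) where
  carrier := {x | N ∣ ea x - 1 ∧ N ∣ eb x ∧ N ∣ ec x ∧ N ∣ ed x - 1}
  one_mem' := by simp
  mul_mem' := by
    rintro x y ⟨a1, b1, c1, d1⟩ ⟨a2, b2, c2, d2⟩
    refine ⟨?_, ?_, ?_, ?_⟩
    · have := dvd_add (dvd_sub_one_mul a1 a2) (b1.mul_right (ec y))
      rw [ea_mul]; convert this using 1; ring
    · rw [eb_mul]; exact dvd_add (b2.mul_left _) (b1.mul_right _)
    · rw [ec_mul]; exact dvd_add (c1.mul_right _) (c2.mul_left _)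
    · have := dvd_add (dvd_sub_one_mul d1 d2) (c1.mul_right (eb y))
      rw [ed_mul]; convert this using 1; ring
  inv_mem' := by
    rintro x ⟨a1, b1, c1, d1⟩
    exact ⟨by simpa using d1, by simpa using b1, by simpa using c1, by simpa using a1⟩

lemma mem_Gm {N : R} {x : SL R} : x ∈ Gm N ↔ N ∣ ea x - 1 ∧ N ∣ eb x ∧ N ∣ ec x ∧ N ∣ ed x - 1 :=
  Iff.rfl

lemma Gm_mono {N M : R} (h : N ∣ M) : Gm M ≤ Gm N := fun _ ⟨a, b, c, d⟩ =>
  ⟨h.trans a, h.trans b, h.trans c, h.trans d⟩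

lemma Gm_conj {N : R} {x : SL R} (hx : x ∈ Gm N) (g : SL R) : g * x * g⁻¹ ∈ Gm N := by
  obtain ⟨⟨a, ha⟩, ⟨b, hb⟩, ⟨c, hc⟩, ⟨d, hd⟩⟩ := hx
  have e := edet g
  refine ⟨⟨ea g * ed g * a + eb g * ed g * c - ea g * ec g * b - eb g * ec g * d, ?_⟩, ⟨-ea g * eb g * a - eb g * eb g * c + ea g * ea g * b + eb g * ea g * d, ?_⟩,
   ⟨ec g * ed g * a + ed g * ed g * c - ec g * ec g * b - ed g * ec g * d, ?_⟩, ⟨-ec g * eb g * a - eb g * ed g * c + ea g * ec g * b + ed g * ea g * d, ?_⟩⟩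
  · simp; linear_combination ea g * ed g * ha + eb g * ed g * hc - ea g * ec g * hb - eb g * ec g * hd + e
  · simp; linear_combination -ea g * eb g * ha - eb g * eb g * hc + ea g * ea g * hb + eb g * ea g * hd
  · simp; linear_combination ec g * ed g * ha + ed g * ed g * hc - ec g * ec g * hb - ed g * ec g * hd
  · simp; linear_combination -ec g * eb g * ha - eb g * ed g * hc + ea g * ec g * hb + ed g * ea g * hd + e

lemma uu_mem_Gm (N x : R) : uu (N * x) ∈ Gm N := by simp [mem_Gm]
lemma ll_mem_Gm (N x : R) : ll (N * x) ∈ Gm N := by simp [mem_Gm]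

/-- Additivity on a subgroup. -/
def AddOn {G A : Type*} [Group G] [AddCommGroup A] (H : Subgroup G) (f : G → A) : Prop :=
  ∀ x ∈ H, ∀ y ∈ H, f (x * y) = f x + f y

section addon
variable {G A : Type*} [Group G] [AddCommGroup A] {H K : Subgroup G} {f g : G → A}
lemma AddOn.one (h : AddOn H f) : f 1 = 0 := by
  have := h 1 H.one_mem 1 H.one_mem; simpa using this
lemma AddOn.inv (h : AddOn H f) {x : G} (hx : x ∈ H) : f x⁻¹ = -f x := by
  have := h x hx _ (H.inv_mem hx)
  rw [mul_inv_cancel, h.one] at this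
  exact (neg_eq_of_add_eq_zero_right this.symm).symm
lemma AddOn.mono (h : AddOn H f) (hk : K ≤ H) : AddOn K f :=
  fun x hx y hy => h x (hk hx) y (hk hy)
lemma AddOn.sub (h : AddOn H f) (h' : AddOn H g) : AddOn H (fun x => f x - g x) := by
  intro x hx y hy
  simp only [h x hx y hy, h' x hx y hy]; abel
lemma AddOn.pow (h : AddOn H f) {x : G} (hx : x ∈ H) (n : ℕ) : f (x ^ n) = n • f x := by
  induction n with
  | zero => simp [h.one]
  | succ n ih => rw [pow_succ, h _ (H.pow_mem hx n) x hx, ih, succ_nsmul]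
lemma AddOn.conj (h : AddOn H f) {x y : G} (hx : x ∈ H) (hy : y ∈ H) : f (x * y * x⁻¹) = f y := by
  rw [h _ (H.mul_mem hx hy) _ (H.inv_mem hx), h x hx y hy, h.inv hx]; abel
end addon

/-- the subgroup of lemma L -/
def Del (x : R) (J : Ideal R) : Subgroup (SL R) where
  carrier := {γ | ea γ - 1 ∈ Ideal.span {x} * J ∧ eb γ ∈ Ideal.span {x} ∧ ec γ ∈ J ∧ ed γ - 1 ∈ Ideal.span {x} * J}
  one_mem' := by simp
  mul_mem' := by
    rintro y z ⟨a1, b1, c1, d1⟩ ⟨a2, b2, c2, d2⟩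
    refine ⟨?_, ?_, ?_, ?_⟩
    · have := add_mem (add_mem (Ideal.mul_mem_right (ea z) _ a1) a2) (Ideal.mul_mem_mul b1 c2)
      rw [ea_mul]; convert this using 1; ring
    · rw [eb_mul]; exact add_mem (Ideal.mul_mem_left _ _ b2) (Ideal.mul_mem_right _ _ b1)
    · rw [ec_mul]; exact add_mem (Ideal.mul_mem_right _ _ c1) (Ideal.mul_mem_left _ _ c2)
    · have := add_mem (add_mem (Ideal.mul_mem_right (ed z) _ d1) d2) (Ideal.mul_mem_mul b2 c1)
      rw [ed_mul]; convert this using 1; ring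
  inv_mem' := by
    rintro y ⟨a1, b1, c1, d1⟩
    exact ⟨by simpa using d1, by simpa using b1, by simpa using c1, by simpa using a1⟩

lemma mem_Del {x : R} {J : Ideal R} {γ : SL R} : γ ∈ Del x J ↔ ea γ - 1 ∈ Ideal.span {x} * J ∧ eb γ ∈ Ideal.span {x} ∧ ec γ ∈ J := by
  constructor
  · exact fun ⟨a, b, c, _⟩ => ⟨a, b, c⟩
  · rintro ⟨a, b, c⟩
    refine ⟨a, b, c, ?_⟩
    have := sub_mem (Ideal.mul_mem_mul b c) (Ideal.mul_mem_left _ (ed γ) a)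
    convert this using 1
    linear_combination edet γ

lemma isCoprime_row (γ : SL R) : IsCoprime (ea γ) (eb γ) :=
  ⟨ed γ, -ec γ, by linear_combination edet γ⟩

end basics

section SR
variable {R : Type*} [CommRing R] [IsDedekindDomain R]

lemma exists_coprime_shift (a b r : R) (hab : IsCoprime a b) (hr : r ≠ 0) :
    ∃ y, IsCoprime (a + b * y) r := by
  classical
  have hr' : Ideal.span {r} ≠ ⊥ := by simpa using hr
  obtain ⟨y, hy⟩ := IsDedekindDomain.exists_forall_sub_mem_ideal
    (s := (UniqueFactorizationMonoid.normalizedFactors (Ideal.span {r})).toFinset) (fun P => P) (fun _ => 1)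
    (fun P hP => UniqueFactorizationMonoid.prime_of_normalized_factor P (Multiset.mem_toFinset.1 hP))
    (fun i _ j _ h => h) (fun P => if a ∈ P.1 then 1 else 0)
  refine ⟨y, ?_⟩
  rw [isCoprime_comm, isCoprime_iff_prime]
  intro P hP hrP h
  have hmem : P ∈ (UniqueFactorizationMonoid.normalizedFactors (Ideal.span {r})).toFinset := by
    rw [Multiset.mem_toFinset, Ideal.mem_normalizedFactors_iff hr']
    exact ⟨hP, by rwa [Ideal.span_singleton_le_iff_mem]⟩
  have h1 := hy P hmem
  rw [pow_one] at h1
  by_cases ha : a ∈ P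
  · simp only [ha, if_true] at h1
    have hb := (isCoprime_iff_prime a b).1 hab P hP ha
    have h2 : b * y ∈ P := by have := sub_mem h ha; simpa using this
    have h3 := (hP.mem_or_mem h2).resolve_left hb
    have := sub_mem h3 h1
    simp at this
    exact hP.ne_top ((Ideal.eq_top_iff_one _).2 this)
  · simp only [ha, if_false, sub_zero] at h1
    exact ha (by have := sub_mem h (P.mul_mem_left b h1); simpa using this)

variable {A : Type*} [AddCommGroup A]

theorem lemL (x : R) (J : Ideal R) (r : R) (hr : r ≠ 0) (g : SL R → A) (hg : AddOn (Del x J) g)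
    (hu : ∀ y, g (uu (x * y)) = 0) (hl : ∀ y ∈ J, g (ll y) = 0)
    (hR : ∀ γ ∈ Gm r, γ ∈ Del x J → g γ = 0) : ∀ γ ∈ Del x J, g γ = 0 := by
  have hum : ∀ y, uu (x * y) ∈ Del x J := fun y => by
    rw [mem_Del]; simp [Ideal.mem_span_singleton]
  have hlm : ∀ y ∈ J, ll y ∈ Del x J := fun y hy => by
    rw [mem_Del]; simpa using hy
  -- reduction of an element with a coprime to r
  have red : ∀ γ ∈ Del x J, ∀ α, r ∣ ea γ * α - 1 → ∃ γ' ∈ Del x J, g γ' = g γ ∧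
      ea γ' = ea γ ∧ r ∣ eb γ' ∧ r ∣ ec γ' ∧ r ∣ ed γ' - α := by
    intro γ hγ α hα
    obtain ⟨-, hb, hc⟩ := mem_Del.1 hγ
    obtain ⟨b0, hb0⟩ := Ideal.mem_span_singleton.1 hb
    have hc' : -(ec γ * α) ∈ J := neg_mem (J.mul_mem_right _ hc)
    have m1 := hum (-(b0 * α))
    have m2 := hlm _ hc'
    refine ⟨ll (-(ec γ * α)) * (γ * uu (x * (-(b0 * α)))), mul_mem m2 (mul_mem hγ m1), ?_, ?_, ?_, ?_, ?_⟩
    · rw [hg _ m2 _ (mul_mem hγ m1), hg _ hγ _ m1, hu, hl _ hc']; simp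
    · simp
    · obtain ⟨k, hk⟩ := hα
      refine ⟨-eb γ * k, ?_⟩
      simp; linear_combination (-eb γ) * hk + (ea γ * α) * hb0
    · obtain ⟨k, hk⟩ := hα
      refine ⟨-ec γ * k, ?_⟩
      simp; linear_combination (-ec γ) * hk
    · obtain ⟨k, hk⟩ := hα
      refine ⟨-ed γ * k + α * (ea γ * ed γ - eb γ * ec γ) * 0 + ec γ * α * eb γ * k, ?_⟩
      simp; linear_combination (-ed γ + ec γ * α * eb γ) * hk + (α) * edet γ + (-ec γ * α * (ea γ * α)+ ec γ * α) * hb0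
  intro γ hγ
  obtain ⟨ha, hb, hc⟩ := mem_Del.1 hγ
  obtain ⟨y', hy'⟩ := exists_coprime_shift (ea γ) (eb γ * (ea γ - 1)) r
    ((isCoprime_row γ).mul_right ⟨1, -1, by ring⟩) hr
  have haJ : ea γ - 1 ∈ J := (Ideal.mul_le_right : Ideal.span {x} * J ≤ J) ha
  have hyJ : (ea γ - 1) * y' ∈ J := J.mul_mem_right _ haJ
  obtain ⟨δ, hγ2, hg2, hy2⟩ : ∃ δ ∈ Del x J, g δ = g γ ∧ IsCoprime (ea δ) r := by
    refine ⟨γ * ll ((ea γ - 1) * y'), mul_mem hγ (hlm _ hyJ), ?_, ?_⟩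
    · rw [hg _ hγ _ (hlm _ hyJ), hl _ hyJ, add_zero]
    · have hea : ea (γ * ll ((ea γ - 1) * y')) = ea γ + eb γ * (ea γ - 1) * y' := by simp; ring
      rwa [hea]
  rw [← hg2]
  obtain ⟨α, v, hα⟩ := hy2
  obtain ⟨ha2, hb2, hc2⟩ := mem_Del.1 hγ2
  obtain ⟨y, hy, hxy⟩ := Ideal.mem_span_singleton_mul.1 ha2
  have hα' : r ∣ ea δ * α - 1 := ⟨-v, by linear_combination hα⟩
  have me : uu (x * 1) * ll y ∈ Del x J := mul_mem (hum _) (hlm _ hy)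
  have hae : ea (uu (x * 1) * ll y) = ea δ := by simp; linear_combination hxy
  obtain ⟨δ1, hm1, hg1, a1, b1, c1, d1⟩ := red δ hγ2 α hα'
  obtain ⟨e1, hme, hge, ae, be, ce, de⟩ := red _ me α (by rw [hae]; exact hα')
  rw [hg _ (hum _) _ (hlm _ hy), hu, hl _ hy, add_zero] at hge
  rw [hae] at ae
  have hm : δ1 * e1⁻¹ ∈ Del x J := mul_mem hm1 (inv_mem hme)
  have hGm : δ1 * e1⁻¹ ∈ Gm r := by
    obtain ⟨k, hk⟩ := hα'
    obtain ⟨k1, hk1⟩ := b1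
    obtain ⟨k2, hk2⟩ := c1
    obtain ⟨k3, hk3⟩ := d1
    obtain ⟨k4, hk4⟩ := be
    obtain ⟨k5, hk5⟩ := ce
    obtain ⟨k6, hk6⟩ := de
    refine ⟨⟨ea δ * k6 + k - eb δ1 * k5, ?_⟩, ⟨-ea δ * k4 + k1 * ea δ, ?_⟩, ⟨k2 * ed e1 - ed δ1 * k5, ?_⟩, ⟨-ec δ1 * k4 + k3 * ea δ + k, ?_⟩⟩
    · simp [a1]; linear_combination ea δ * hk6 + hk - eb δ1 * hk5
    · simp [a1, ae]; linear_combination -ea δ * hk4 + hk1 * ea δ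
    · simp; linear_combination hk2 * ed e1 - ed δ1 * hk5
    · simp [ae]; linear_combination -ec δ1 * hk4 + hk3 * ea δ + hk
  have h0 := hR _ hGm hm
  rw [hg _ hm1 _ (inv_mem hme), hg.inv hme, hge, hg1] at h0
  simpa using h0
end SR
end PD
end PartM1

section PartM2
open NumberField
namespace PD
section row
variable {R : Type*} [CommRing R] {A : Type*} [AddCommGroup A]

structure Good (N : R) (f : SL R → A) : Prop where
  add : AddOn (Gm N) f
  u : ∀ x, f (uu (N * x)) = 0
  l : ∀ x, f (ll (N * x)) = 0

lemma Good.mono {N M : R} {f : SL R → A} (h : Good N f) (hM : N ∣ M) : Good M f := by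
  obtain ⟨c, rfl⟩ := hM
  exact ⟨h.add.mono (Gm_mono (Dvd.intro _ rfl)), fun x => by rw [mul_assoc]; exact h.u _,
    fun x => by rw [mul_assoc]; exact h.l _⟩

lemma Good.u' {N : R} {f : SL R → A} (h : Good N f) {x : R} (hx : N ∣ x) : f (uu x) = 0 := by
  obtain ⟨y, rfl⟩ := hx; exact h.u y
lemma Good.l' {N : R} {f : SL R → A} (h : Good N f) {x : R} (hx : N ∣ x) : f (ll x) = 0 := by
  obtain ⟨y, rfl⟩ := hx; exact h.l y

structure Adm (N a b : R) : Prop where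
  ha : N ∣ a - 1
  hb : N ∣ b
  cop : IsCoprime a b

open Classical in
noncomputable def row (f : SL R → A) (N a b : R) : A :=
  if h : ∃ γ : SL R, γ ∈ Gm N ∧ ea γ = a ∧ eb γ = b then f h.choose else 0

lemma Adm.of_mem {N : R} {γ : SL R} (h : γ ∈ Gm N) : Adm N (ea γ) (eb γ) :=
  ⟨h.1, h.2.1, isCoprime_row γ⟩

lemma mem_Gm' {N : R} {γ : SL R} (ha : N ∣ ea γ - 1) (hb : N ∣ eb γ) (hc : N ∣ ec γ) : γ ∈ Gm N := by
  refine ⟨ha, hb, hc, ?_⟩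
  have := dvd_sub (hc.mul_left (eb γ)) (ha.mul_left (ed γ))
  convert this using 1
  linear_combination edet γ

lemma Adm.exists {N a b : R} (h : Adm N a b) : ∃ γ : SL R, γ ∈ Gm N ∧ ea γ = a ∧ eb γ = b := by
  obtain ⟨v, w, hvw⟩ := h.cop
  refine ⟨mk2 a b (-w + a * w) (v + b * w) (by linear_combination hvw), ?_, rfl, rfl⟩
  refine mem_Gm' h.ha h.hb ?_
  have := h.ha.mul_right w
  convert this using 1; simp; ring

lemma Good.eq_of_row {N : R} {f : SL R → A} (h : Good N f) {γ δ : SL R} (hγ : γ ∈ Gm N) (hδ : δ ∈ Gm N)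
    (ha : ea γ = ea δ) (hb : eb γ = eb δ) : f γ = f δ := by
  have h1 : γ = ll (ec γ * ed δ - ed γ * ec δ) * δ := by
    have e1 := edet γ
    have e2 := edet δ
    rw [ha, hb] at e1
    apply ext4
    · simp [ha]
    · simp [hb]
    · simp; linear_combination ec δ * e1 - ec γ * e2
    · simp; linear_combination ed δ * e1 - ed γ * e2
  have h2 : N ∣ (ec γ * ed δ - ed γ * ec δ) :=
    dvd_sub (hγ.2.2.1.mul_right _) (hδ.2.2.1.mul_left _)
  rw [h1, h.add _ _ _ hδ, h.l' h2, zero_add]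
  obtain ⟨k, hk⟩ := h2
  rw [hk]; exact ll_mem_Gm _ _

lemma Good.row {N : R} {f : SL R → A} (h : Good N f) {γ : SL R} (hγ : γ ∈ Gm N) {a b : R} (ha : ea γ = a)
    (hb : eb γ = b) : row f N a b = f γ := by
  have hex : ∃ γ : SL R, γ ∈ Gm N ∧ ea γ = a ∧ eb γ = b := ⟨γ, hγ, ha, hb⟩
  rw [PD.row, dif_pos hex]
  obtain ⟨h1, h2, h3⟩ := hex.choose_spec
  exact h.eq_of_row h1 hγ (h2.trans ha.symm) (h3.trans hb.symm)

lemma Good.row_b {N : R} {f : SL R → A} (h : Good N f) {a b b' : R} (h1 : Adm N a b) (hb' : N ∣ b')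
    (hd : a ∣ b' - b) : Adm N a b' ∧ PD.row f N a b' = PD.row f N a b := by
  obtain ⟨γ, hγ, ha, hb⟩ := h1.exists
  have h2 : a * N ∣ b' - b := by
    have hc : IsCoprime a N := by
      obtain ⟨k, hk⟩ := h1.ha
      exact ⟨1, -k, by linear_combination hk⟩
    exact hc.mul_dvd hd (dvd_sub hb' h1.hb)
  obtain ⟨k, hk⟩ := h2
  have m : γ * uu (N * k) ∈ Gm N := mul_mem hγ (uu_mem_Gm _ _)
  have e1 : ea (γ * uu (N * k)) = a := by simp [ha]
  have e2 : eb (γ * uu (N * k)) = b' := by simp [ha, hb]; linear_combination -hk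
  refine ⟨?_, ?_⟩
  · have := Adm.of_mem m; rwa [e1, e2] at this
  · rw [h.row m e1 e2, h.row hγ ha hb, h.add _ hγ _ (uu_mem_Gm _ _), h.u, add_zero]

lemma Good.row_a {N : R} {f : SL R → A} (h : Good N f) {a a' b : R} (h1 : Adm N a b)
    (hd : b * N ∣ a' - a) : Adm N a' b ∧ PD.row f N a' b = PD.row f N a b := by
  obtain ⟨γ, hγ, ha, hb⟩ := h1.exists
  obtain ⟨k, hk⟩ := hd
  have m : γ * ll (N * k) ∈ Gm N := mul_mem hγ (ll_mem_Gm _ _)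
  have e1 : ea (γ * ll (N * k)) = a' := by simp [ha, hb]; linear_combination -hk
  have e2 : eb (γ * ll (N * k)) = b := by simp [hb]
  refine ⟨?_, ?_⟩
  · have := Adm.of_mem m; rwa [e1, e2] at this
  · rw [h.row m e1 e2, h.row hγ ha hb, h.add _ hγ _ (ll_mem_Gm _ _), h.l, add_zero]

lemma Good.row_mul {N : R} {f : SL R → A} (h : Good N f) {a b a' b' c' d' : R} (h1 : Adm N a b)
    (ha' : N ∣ a' - 1) (hb' : N ∣ b') (hc' : N ∣ c') (hdet : a' * d' - b' * c' = 1) :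
    Adm N (a * a' + b * c') (a * b' + b * d') ∧
    PD.row f N (a * a' + b * c') (a * b' + b * d') = PD.row f N a b + PD.row f N a' b' := by
  obtain ⟨γ, hγ, ha, hb⟩ := h1.exists
  have m' : mk2 a' b' c' d' hdet ∈ Gm N := mem_Gm' ha' hb' hc'
  have m := mul_mem hγ m'
  have e1 : ea (γ * mk2 a' b' c' d' hdet) = a * a' + b * c' := by simp [ha, hb]
  have e2 : eb (γ * mk2 a' b' c' d' hdet) = a * b' + b * d' := by simp [ha, hb]
  refine ⟨?_, ?_⟩
  · have := Adm.of_mem m; rwa [e1, e2] at this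
  · rw [h.row m e1 e2, h.row hγ ha hb, h.row m' (ea_mk ..) (eb_mk ..), h.add _ hγ _ m']

/-- diagonal matrix of a unit -/
def hh (ε : Rˣ) : SL R := mk2 (ε : R) 0 0 ((ε⁻¹ : Rˣ) : R) (by simp)
@[simp] lemma ea_hh (x : Rˣ) : ea (hh x) = x := rfl
@[simp] lemma eb_hh (x : Rˣ) : eb (hh x) = 0 := rfl
@[simp] lemma ec_hh (x : Rˣ) : ec (hh x) = 0 := rfl
@[simp] lemma ed_hh (x : Rˣ) : ed (hh x) = ((x⁻¹ : Rˣ) : R) := rfl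

lemma hh_mul (x y : Rˣ) : hh (x * y) = hh x * hh y := by
  apply ext4 <;> simp [mul_comm]
lemma hh_one : hh (1 : Rˣ) = 1 := by
  apply ext4 <;> simp
lemma hh_inv (x : Rˣ) : hh (x⁻¹) = (hh x)⁻¹ := by
  apply ext4 <;> simp
lemma hh_pow (x : Rˣ) (k : ℕ) : hh (x ^ k) = (hh x) ^ k := by
  induction k with
  | zero => simp [hh_one]
  | succ k ih => rw [pow_succ, hh_mul, ih, pow_succ]

lemma hh_mem_Gm {N : R} {ε : Rˣ} (h : N ∣ (ε : R) - 1) : hh ε ∈ Gm N :=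
  mem_Gm' h (by simp) (by simp)

lemma hh_conj_uu (ε : Rˣ) (x : R) : hh ε * uu x * (hh ε)⁻¹ = uu ((ε : R) ^ 2 * x) := by
  apply ext4 <;> simp; ring
lemma hh_conj_ll (ε : Rˣ) (x : R) : (hh ε)⁻¹ * ll x * (hh ε) = ll ((ε : R) ^ 2 * x) := by
  apply ext4 <;> simp; ring

lemma uu_add (x y : R) : uu (x + y) = uu x * uu y := by apply ext4 <;> simp [add_comm]
lemma ll_add (x y : R) : ll (x + y) = ll x * ll y := by apply ext4 <;> simp
lemma uu_mem' {N x : R} (h : N ∣ x) : uu x ∈ Gm N := by simpa [mem_Gm] using h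
lemma ll_mem' {N x : R} (h : N ∣ x) : ll x ∈ Gm N := by simpa [mem_Gm] using h

lemma good_of_unit {N : R} {f : SL R → A} (h : AddOn (Gm N) f) {η : Rˣ} (hη : N ∣ (η : R) - 1)
    {M : R} (hM : N * ((η : R) ^ 2 - 1) ∣ M) : Good M f := by
  refine ⟨h.mono (Gm_mono (dvd_of_mul_right_dvd hM)), fun x => ?_, fun x => ?_⟩
  · obtain ⟨k, rfl⟩ := hM
    have h1 := h.conj (hh_mem_Gm hη) (uu_mem_Gm N (k * x))
    rw [hh_conj_uu] at h1
    have h2 : uu ((η : R) ^ 2 * (N * (k * x))) = uu (N * ((η : R) ^ 2 - 1) * k * x) * uu (N * (k * x)) := by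
      rw [← uu_add]; congr 1; ring
    rw [h2, h _ (uu_mem' (by rw [mul_assoc, mul_assoc]; exact Dvd.intro _ rfl)) _ (uu_mem_Gm _ _)] at h1
    simpa using h1
  · obtain ⟨k, rfl⟩ := hM
    have h1 := h.conj (inv_mem (hh_mem_Gm hη)) (ll_mem_Gm N (k * x))
    rw [inv_inv, hh_conj_ll] at h1
    have h2 : ll ((η : R) ^ 2 * (N * (k * x))) = ll (N * ((η : R) ^ 2 - 1) * k * x) * ll (N * (k * x)) := by
      rw [← ll_add]; congr 1; ring
    rw [h2, h _ (ll_mem' (by rw [mul_assoc, mul_assoc]; exact Dvd.intro _ rfl)) _ (ll_mem_Gm _ _)] at h1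
    simpa using h1
end row

section nf
variable {F : Type*} [Field F] [NumberField F] {A : Type*} [AddCommGroup A]

lemma pow_cong {N : 𝓞 F} (hN : N ≠ 0) : ∃ k : ℕ, 0 < k ∧ ∀ x : 𝓞 F, IsCoprime x N → N ∣ x ^ k - 1 := by
  have hfin : Finite (𝓞 F ⧸ Ideal.span {N}) :=
    Ideal.finiteQuotientOfFreeOfNeBot _ (by simpa using hN)
  refine ⟨Nat.card (𝓞 F ⧸ Ideal.span {N})ˣ, Nat.card_pos, fun x hc => ?_⟩
  have hu : IsUnit (Ideal.Quotient.mk (Ideal.span {N}) x) := by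
    obtain ⟨u, v, huv⟩ := hc
    refine IsUnit.of_mul_eq_one (Ideal.Quotient.mk _ u) ?_
    rw [← map_mul, ← map_one (Ideal.Quotient.mk (Ideal.span {N})), Ideal.Quotient.eq,
      Ideal.mem_span_singleton]
    exact ⟨-v, by linear_combination huv⟩
  obtain ⟨w, hw⟩ := hu
  have h1 : w ^ (Nat.card (𝓞 F ⧸ Ideal.span {N})ˣ) = 1 := pow_card_eq_one'
  have h3 := congrArg Units.val h1
  rw [Units.val_pow_eq_pow_val, hw, Units.val_one] at h3
  rw [← Ideal.mem_span_singleton, ← Ideal.Quotient.eq, map_pow, h3, map_one]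

lemma unit_cong {N : 𝓞 F} (hN : N ≠ 0) : ∃ k : ℕ, 0 < k ∧ ∀ ε : (𝓞 F)ˣ, N ∣ ((ε ^ k : (𝓞 F)ˣ) : 𝓞 F) - 1 := by
  obtain ⟨k, hk, h⟩ := pow_cong hN
  exact ⟨k, hk, fun ε => by
    rw [Units.val_pow_eq_pow_val]
    exact h _ ((isCoprime_one_left).of_isCoprime_of_dvd_left ε.isUnit.dvd)⟩

lemma exists_good (hη : ∃ ε : (𝓞 F)ˣ, ∀ k : ℕ, 0 < k → ε ^ k ≠ 1) (N : ℕ) (hN : 0 < N) :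
    ∃ M : ℕ, 0 < M ∧ N ∣ M ∧ ∀ f : SL (𝓞 F) → A, AddOn (Gm (N : 𝓞 F)) f → Good (M : 𝓞 F) f := by
  obtain ⟨ε, hε⟩ := hη
  obtain ⟨k, hk, hc⟩ := unit_cong (N := (N : 𝓞 F)) (by exact_mod_cast hN.ne')
  have h1 : (((ε ^ k : (𝓞 F)ˣ) : 𝓞 F) ^ 2 - 1) ≠ 0 := by
    intro h
    apply hε (k * 2) (by omega)
    ext1
    have := sub_eq_zero.1 h
    rw [pow_mul, Units.val_pow_eq_pow_val, this, Units.val_one]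
  refine ⟨N * Ideal.absNorm (Ideal.span {((ε ^ k : (𝓞 F)ˣ) : 𝓞 F) ^ 2 - 1}), Nat.mul_pos hN (natNorm_pos h1), Dvd.intro _ rfl, fun f hf => ?_⟩
  refine good_of_unit hf (hc ε) ?_
  push_cast
  exact mul_dvd_mul_left _ (dvd_natNorm _)
end nf
end PD
end PartM2

section PartA1
open NumberField
namespace PD
variable {F : Type*} [Field F] [NumberField F] {A : Type*} [AddCommGroup A]

lemma nat_not_dvd_one {N : ℕ} (hN : 1 < N) : ¬ (N : 𝓞 F) ∣ 1 := by
  intro hsN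
  have h2 : IsUnit (N : 𝓞 F) := isUnit_of_dvd_one hsN
  have h3 := (Ideal.absNorm_eq_one_iff (I := Ideal.span {((N : ℕ) : 𝓞 F)})).2 (Ideal.span_singleton_eq_top.2 h2)
  rw [Ideal.absNorm_span_natCast] at h3
  have h4 : Module.finrank ℤ (𝓞 F) ≠ 0 := by
    rw [RingOfIntegers.rank]; exact Module.finrank_pos.ne'
  have := (Nat.pow_eq_one.1 h3).resolve_right h4
  omega

lemma ne_zero_of_cong {N : ℕ} (hN : 1 < N) {a : 𝓞 F} (h : (N : 𝓞 F) ∣ a - 1) : a ≠ 0 := by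
  rintro rfl
  rw [zero_sub, dvd_neg] at h
  exact nat_not_dvd_one hN h

lemma cop_of_cong {R : Type*} [CommRing R] {N a : R} (h : N ∣ a - 1) : IsCoprime a N := by
  obtain ⟨k, hk⟩ := h
  exact ⟨1, -k, by linear_combination hk⟩

lemma Nice.unit_rep {N : ℕ} {s : 𝓞 F} {m : ℕ} (h : Nice N s m) {a : 𝓞 F} (ha : IsCoprime a s) :
    ∃ r : ℕ, s ∣ a - r ∧ r.Coprime m := by
  obtain ⟨t, ht⟩ := h.rep a
  have hm : (0 : ℤ) < m := by exact_mod_cast h.pos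
  have h1 : s ∣ ((t - t % m : ℤ) : 𝓞 F) := (h.dvd_iff _).2 ⟨t / m, by have := Int.emod_add_mul_ediv t m; linarith⟩
  have h2 : ((t % m).toNat : ℤ) = t % m := Int.toNat_of_nonneg (Int.emod_nonneg _ hm.ne')
  have h3 : s ∣ a - (((t % m).toNat : ℕ) : 𝓞 F) := by
    have := dvd_add ht h1
    have h4 : (((t % m).toNat : ℕ) : 𝓞 F) = ((t % m : ℤ) : 𝓞 F) := by
      have := congrArg (Int.cast : ℤ → 𝓞 F) h2
      rwa [Int.cast_natCast] at this
    rw [h4]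
    convert this using 1
    push_cast; ring
  refine ⟨(t % m).toNat, h3, ?_⟩
  generalize (t % m).toNat = r at *
  obtain ⟨v, w, hvw⟩ := ha
  obtain ⟨v', hv'⟩ := h.rep v
  have h5 : s ∣ ((r * v' - 1 : ℤ) : 𝓞 F) := by
    obtain ⟨k1, hk1⟩ := h3
    obtain ⟨k2, hk2⟩ := hv'
    refine ⟨-k1 * v' - k2 * a - w, ?_⟩
    push_cast
    linear_combination (-v') * hk1 - a * hk2 + hvw
  obtain ⟨k, hk⟩ := (h.dvd_iff _).1 h5
  rw [← Nat.isCoprime_iff_coprime]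
  exact ⟨v', -k, by linear_combination hk⟩

lemma Nice.dvd_nat {N : ℕ} {s : 𝓞 F} {m : ℕ} (h : Nice N s m) {x y : ℕ} (hxy : x ≡ y [MOD m]) :
    s ∣ (x : 𝓞 F) - y := by
  have := (h.dvd_iff ((x : ℤ) - y)).2 (by
    have := hxy.symm.dvd; exact_mod_cast this)
  simpa using this

lemma conj_row {R : Type*} [CommRing R] (ε : Rˣ) (γ : SL R) : ea (hh ε * γ * (hh ε)⁻¹) = ea γ ∧
    eb (hh ε * γ * (hh ε)⁻¹) = (ε : R) ^ 2 * eb γ := by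
  constructor <;> simp
  · rw [mul_comm, ← mul_assoc]; simp
  · ring

lemma Good.conj_sub {R : Type*} [CommRing R] {N : R} {f : SL R → A} (h : Good N f) (ε : Rˣ) :
    Good N (fun γ => f (hh ε * γ * (hh ε)⁻¹) - f γ) := by
  refine ⟨AddOn.sub ?_ h.add, fun x => ?_, fun x => ?_⟩
  · intro x hx y hy
    have : hh ε * (x * y) * (hh ε)⁻¹ = (hh ε * x * (hh ε)⁻¹) * (hh ε * y * (hh ε)⁻¹) := by group
    simp only [this, h.add _ (Gm_conj hx _) _ (Gm_conj hy _)]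
  · simp only [hh_conj_uu, h.u, sub_zero]
    exact h.u' ⟨ε ^ 2 * x, by ring⟩
  · have := hh_conj_ll ε⁻¹ (N * x)
    rw [hh_inv, inv_inv] at this
    simp only [this, h.l, sub_zero]
    exact h.l' ⟨(ε⁻¹ : Rˣ) ^ 2 * x, by ring⟩

/-- natural `a'` reduction. -/
lemma exists_special (htot : ∀ v : InfinitePlace F, v.IsReal) (Q : ℕ) (hQ : 0 < Q) (h4 : 4 ∣ Q) :
    ∃ N' : ℕ, 1 < N' ∧ Q ∣ N' ∧ (∀ l : ℕ, l.Prime → l ≤ Module.finrank ℚ F → l ∣ N') ∧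
    ∀ s m, Nice N' s m → ∀ a : 𝓞 F, IsCoprime a s → ∃ a' : ℕ, Sp F Q a' ∧ a' ≡ 1 [MOD Q] ∧ s ∣ (a' : 𝓞 F) - a := by
  obtain ⟨D, hD, h⟩ := partD F htot Q hQ h4
  refine ⟨Q * D * (Module.finrank ℚ F).factorial, ?_, ?_, ?_, ?_⟩
  · have := Nat.le_of_dvd hQ h4
    have h1 := (Module.finrank ℚ F).factorial_pos
    calc 1 < Q * 1 * 1 := by omega
      _ ≤ _ := Nat.mul_le_mul (Nat.mul_le_mul le_rfl hD) h1
  · rw [mul_assoc]; exact Dvd.intro _ rfl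
  · intro l hl hle
    exact (Nat.dvd_factorial hl.pos hle).mul_left _
  · intro s m hs a ha
    obtain ⟨r, hr, hrm⟩ := hs.unit_rep ha
    have hc : m.Coprime D := by
      refine Nat.Coprime.coprime_dvd_right ?_ hs.cop
      exact (Dvd.intro_left _ rfl : D ∣ Q * D).mul_right _
    obtain ⟨a', h1, h2, h3⟩ := h m hs.pos hc r hrm
    refine ⟨a', h1, h2, ?_⟩
    have := dvd_sub (hs.dvd_nat h3) hr
    convert this using 1; ring

theorem partA (htot : ∀ v : InfinitePlace F, v.IsReal)
    (hη : ∃ ε : (𝓞 F)ˣ, ∀ k : ℕ, 0 < k → ε ^ k ≠ 1) (ε : (𝓞 F)ˣ) (N : ℕ) (hN : 0 < N)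
    (f : SL (𝓞 F) → A) (hf : AddOn (Gm (N : 𝓞 F)) f) :
    ∃ N' : ℕ, 0 < N' ∧ ∀ γ ∈ Gm (N' : 𝓞 F), f (hh ε * γ * (hh ε)⁻¹) = f γ := by
  obtain ⟨N0, hN0, -, hg⟩ := exists_good (A := A) hη N hN
  have hf0 := hg f hf
  have hg0 := hf0.conj_sub ε
  obtain ⟨k, hk, hkc⟩ := unit_cong (N := (N0 : 𝓞 F)) (by exact_mod_cast hN0.ne')
  obtain ⟨Nn, hNn1, hQN, hsm, hspec⟩ := exists_special htot (N0 ^ 2 * (4 * k)) (by positivity) ⟨N0 ^ 2 * k, by ring⟩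
  have hN0Q : N0 ^ 2 ∣ N0 ^ 2 * (4 * k) := Dvd.intro _ rfl
  have hN0n : N0 ^ 2 ∣ Nn := hN0Q.trans hQN
  refine ⟨N0 * Nn, by positivity, fun γ hγ => ?_⟩
  rw [← sub_eq_zero]
  have cN : (N0 : 𝓞 F) ∣ ((N0 * Nn : ℕ) : 𝓞 F) := by push_cast; exact Dvd.intro _ rfl
  have cNn : (Nn : 𝓞 F) ∣ ((N0 * Nn : ℕ) : 𝓞 F) := by push_cast; exact Dvd.intro_left _ rfl
  have hγ0 := Gm_mono cN hγ
  rw [← hg0.row hγ0 rfl rfl]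
  have hadm := Adm.of_mem hγ0
  obtain ⟨b0, hb0⟩ := hγ.2.1
  push_cast at hb0
  have haN : (Nn : 𝓞 F) ∣ ea γ - 1 := cNn.trans hγ.1
  have hcb : IsCoprime (ea γ) (Nn * b0 : 𝓞 F) :=
    hadm.cop.of_isCoprime_of_dvd_right ⟨N0, by rw [hb0]; ring⟩
  obtain ⟨s, m, hs1, hs2, hs⟩ := nice_exists Nn hNn1 hsm (ea γ) (Nn * b0)
    (ne_zero_of_cong hNn1 haN) hcb (cop_of_cong haN)
  obtain ⟨hadm1, hr1⟩ := hg0.row_b hadm (b' := N0 * s) (Dvd.intro _ rfl) (by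
    obtain ⟨c, hc⟩ := hs1
    exact ⟨N0 * c, by rw [hb0]; linear_combination N0 * hc⟩)
  rw [← hr1]
  have hcs : IsCoprime (ea γ) s := hadm1.cop.of_isCoprime_of_dvd_right (Dvd.intro_left _ rfl)
  obtain ⟨a', ⟨ha'0, M, hMQ, hM⟩, ha'Q, ha's⟩ := hspec s m hs (ea γ) hcs
  have hN2 : ((N0 : 𝓞 F) ^ 2) ∣ Nn := by exact_mod_cast Nat.cast_dvd_cast (α := 𝓞 F) hN0n
  have hcsN : IsCoprime ((N0 : 𝓞 F) ^ 2) s := ((cop_of_cong hs2).of_isCoprime_of_dvd_right hN2).symm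
  have ha'2 : ((N0 : 𝓞 F) ^ 2) ∣ (a' : 𝓞 F) - 1 := by
    have h1 : ((N0 ^ 2 : ℕ) : ℤ) ∣ (a' : ℤ) - 1 := by
      have := (ha'Q.of_dvd hN0Q).symm.dvd; exact_mod_cast this
    obtain ⟨c, hc⟩ := h1
    refine ⟨c, ?_⟩
    have := congrArg (Int.castRingHom (𝓞 F)) hc
    simpa using this
  obtain ⟨hadm2, hr2⟩ := hg0.row_a (a' := (a' : 𝓞 F)) hadm1 (by
    have h1 := hcsN.mul_dvd (show (N0 : 𝓞 F) ^ 2 ∣ (a' : 𝓞 F) - ea γ by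
      have := dvd_sub ha'2 (hN2.trans haN); convert this using 1; ring) ha's
    convert h1 using 1; ring)
  rw [← hr2]
  obtain ⟨δ, hδ, hδa, hδb⟩ := hadm2.exists
  rw [hg0.row hδ hδa hδb]
  have hco : M.Coprime (4 * k) := hMQ.coprime_dvd_right (Dvd.intro_left _ rfl)
  obtain ⟨w, -, hw⟩ := Nat.exists_mul_mod_eq_one_of_coprime hco (by omega)
  have hw' := Nat.div_add_mod (M * w) (4 * k)
  rw [hw] at hw'
  set v := M * w / (4 * k)
  -- F(Mw) = F(0)
  have e1 : f (hh (ε ^ (M * w)) * δ * (hh (ε ^ (M * w)))⁻¹) = f δ := by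
    obtain ⟨c1, c2⟩ := conj_row (ε ^ (M * w)) δ
    rw [← hf0.row (Gm_conj hδ _) c1 c2, ← hf0.row hδ rfl rfl]
    refine (hf0.row_b (Adm.of_mem hδ) (hδ.2.1.mul_left _) ?_).2
    have h1 := hM ε ((isCoprime_one_left).of_isCoprime_of_dvd_left ε.isUnit.dvd)
    have h2 : (a' : 𝓞 F) ∣ ((ε ^ (M * w) : (𝓞 F)ˣ) : 𝓞 F) ^ 2 - 1 := by
      have h3 := h1.trans (sub_one_dvd_pow_sub_one ((ε : 𝓞 F) ^ (2 * M)) w)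
      convert h3 using 2
      push_cast; ring
    rw [hδa]
    have := h2.mul_right (eb δ)
    convert this using 1; ring
  have e2 : f (hh (ε ^ (M * w)) * δ * (hh (ε ^ (M * w)))⁻¹) = f (hh ε * δ * (hh ε)⁻¹) := by
    have h1 : hh ((ε ^ k) ^ (4 * v)) ∈ Gm (N0 : 𝓞 F) := by
      rw [hh_pow]; exact pow_mem (hh_mem_Gm (hkc ε)) _
    have h2 : ε ^ (M * w) = (ε ^ k) ^ (4 * v) * ε := by
      rw [← hw', pow_succ, ← pow_mul]; congr 2; ring
    have h3 := hf0.add.conj h1 (Gm_conj hδ (hh ε))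
    rw [← h3, h2, hh_mul]
    congr 1
    group
  rw [← e2, e1, sub_self]
end PD
end PartA1

section PartB1
open NumberField
namespace PD
variable {F : Type*} [Field F] [NumberField F] {A : Type*} [AddCommGroup A]

noncomputable def io (F : Type*) [Field F] [NumberField F] : 𝓞 F →+* F := algebraMap (𝓞 F) F

lemma io_inj : Function.Injective (io F) := RingOfIntegers.coe_injective

noncomputable def toF (F : Type*) [Field F] [NumberField F] : SL (𝓞 F) →* SL F :=
  Matrix.SpecialLinearGroup.map (io F)

@[simp] lemma ea_toF (x : SL (𝓞 F)) : ea (toF F x) = io F (ea x) := rfl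
@[simp] lemma eb_toF (x : SL (𝓞 F)) : eb (toF F x) = io F (eb x) := rfl
@[simp] lemma ec_toF (x : SL (𝓞 F)) : ec (toF F x) = io F (ec x) := rfl
@[simp] lemma ed_toF (x : SL (𝓞 F)) : ed (toF F x) = io F (ed x) := rfl

lemma toF_inj : Function.Injective (toF F) := by
  intro x y h
  apply ext4 <;> apply io_inj
  · exact congrArg ea h
  · exact congrArg eb h
  · exact congrArg ec h
  · exact congrArg ed h

noncomputable def GF (F : Type*) [Field F] [NumberField F] (N : ℕ) : Subgroup (SL F) :=
  (Gm (N : 𝓞 F)).map (toF F)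

lemma mem_GF_of {N : ℕ} {x : SL F} (a b c d : 𝓞 F) (ha : ea x = 1 + N * io F a) (hb : eb x = N * io F b)
    (hc : ec x = N * io F c) (hd : ed x = 1 + N * io F d) : x ∈ GF F N := by
  have hdet : (1 + N * a) * (1 + N * d) - (N * b) * (N * c) = 1 := by
    apply io_inj
    have := edet x
    rw [ha, hb, hc, hd] at this
    simp only [map_sub, map_mul, map_add, map_one, map_natCast]
    exact this
  refine ⟨mk2 _ _ _ _ hdet, ⟨?_, ?_, ?_, ?_⟩, ?_⟩
  · simp
  · simp
  · simp
  · simp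
  · apply ext4
    · simp [ha]
    · simp [hb]
    · simp [hc]
    · simp [hd]

lemma exists_denom (x : F) : ∃ t : ℕ, 0 < t ∧ ∃ y : 𝓞 F, (t : F) * x = io F y := by
  obtain ⟨⟨τ, b⟩, hτ⟩ := IsLocalization.surj (Algebra.algebraMapSubmonoid (𝓞 F) (nonZeroDivisors ℤ)) x
  obtain ⟨n, hn, hb⟩ := b.2
  have hn0 : n ≠ 0 := nonZeroDivisors.ne_zero hn
  have hτ : x * io F (b : 𝓞 F) = io F τ := hτ
  rw [← hb] at hτ
  have hτ : x * (n : F) = io F τ := by rw [← hτ]; simp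
  refine ⟨n.natAbs, Int.natAbs_pos.2 hn0, ?_⟩
  rcases Int.natAbs_eq n with h | h
  · refine ⟨τ, ?_⟩
    have : (n : F) = ((n.natAbs : ℕ) : F) := by rw [← Int.cast_natCast, ← h]
    rw [this] at hτ
    rw [← hτ, mul_comm]
  · refine ⟨-τ, ?_⟩
    have : (n : F) = -((n.natAbs : ℕ) : F) := by rw [← Int.cast_natCast, ← Int.cast_neg, ← h]
    rw [this] at hτ
    rw [map_neg, ← hτ]; ring

lemma conj_bdd (g : SL F) (N : ℕ) (hN : 0 < N) : ∃ N' : ℕ, 0 < N' ∧ ∀ γ ∈ GF F N', g * γ * g⁻¹ ∈ GF F N := by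
  obtain ⟨t1, h1, p, hp⟩ := exists_denom (ea g)
  obtain ⟨t2, h2, q, hq⟩ := exists_denom (eb g)
  obtain ⟨t3, h3, r, hr⟩ := exists_denom (ec g)
  obtain ⟨t4, h4, w, hw⟩ := exists_denom (ed g)
  refine ⟨(t1 * t2 * t3 * t4) ^ 2 * N, by positivity, ?_⟩
  rintro _ ⟨γ, ⟨⟨a, ha⟩, ⟨b, hb⟩, ⟨c, hc⟩, ⟨d, hd⟩⟩, rfl⟩
  obtain ⟨P, hP⟩ : ∃ P : 𝓞 F, (t1 * t2 * t3 * t4 : F) * ea g = io F P := ⟨t2 * t3 * t4 * p, by simp only [map_mul, map_natCast]; rw [← hp]; ring⟩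
  obtain ⟨Q, hQ⟩ : ∃ P : 𝓞 F, (t1 * t2 * t3 * t4 : F) * eb g = io F P := ⟨t1 * t3 * t4 * q, by simp only [map_mul, map_natCast]; rw [← hq]; ring⟩
  obtain ⟨S, hS⟩ : ∃ P : 𝓞 F, (t1 * t2 * t3 * t4 : F) * ec g = io F P := ⟨t1 * t2 * t4 * r, by simp only [map_mul, map_natCast]; rw [← hr]; ring⟩
  obtain ⟨W, hW⟩ : ∃ P : 𝓞 F, (t1 * t2 * t3 * t4 : F) * ed g = io F P := ⟨t1 * t2 * t3 * w, by simp only [map_mul, map_natCast]; rw [← hw]; ring⟩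
  have ha := congrArg (io F) ha
  have hb := congrArg (io F) hb
  have hc := congrArg (io F) hc
  have hd := congrArg (io F) hd
  simp only [Nat.cast_mul, Nat.cast_pow, map_sub, map_mul, map_one, map_pow, map_natCast] at ha hb hc hd
  have e := edet g
  refine mem_GF_of (P * W * a + Q * W * c - P * S * b - Q * S * d) (-P * Q * a - Q * Q * c + P * P * b + Q * P * d)
    (S * W * a + W * W * c - S * S * b - W * S * d) (-S * Q * a - Q * W * c + P * S * b + W * P * d) ?_ ?_ ?_ ?_
  · simp only [map_add, map_sub, map_mul, map_neg]; rw [← hP, ← hQ, ← hS, ← hW]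
    simp; linear_combination ea g * ed g * ha + eb g * ed g * hc - ea g * ec g * hb - eb g * ec g * hd + e
  · simp only [map_add, map_sub, map_mul, map_neg]; rw [← hP, ← hQ]
    simp; linear_combination -ea g * eb g * ha - eb g * eb g * hc + ea g * ea g * hb + eb g * ea g * hd
  · simp only [map_add, map_sub, map_mul, map_neg]; rw [← hS, ← hW]
    simp; linear_combination ec g * ed g * ha + ed g * ed g * hc - ec g * ec g * hb - ed g * ec g * hd
  · simp only [map_add, map_sub, map_mul, map_neg]; rw [← hP, ← hQ, ← hS, ← hW]
    simp; linear_combination -ec g * eb g * ha - eb g * ed g * hc + ea g * ec g * hb + ed g * ea g * hd + e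

lemma GF_mono {N M : ℕ} (h : N ∣ M) : GF F M ≤ GF F N :=
  Subgroup.map_mono (Gm_mono (Nat.cast_dvd_cast h))

def Inv (A : Type*) [AddCommGroup A] (g : SL F) : Prop :=
  ∀ N : ℕ, 0 < N → ∀ f : SL F → A, AddOn (GF F N) f → ∃ N' : ℕ, 0 < N' ∧ ∀ γ ∈ GF F N', f (g * γ * g⁻¹) = f γ

lemma Inv.mul {g h : SL F} (hg : Inv A g) (hh : Inv A h) : Inv A (g * h) := by
  intro N hN f hf
  obtain ⟨N1, h1, e1⟩ := hg N hN f hf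
  obtain ⟨N2, h2, e2⟩ := conj_bdd h N1 h1
  obtain ⟨N3, h3, e3⟩ := hh N hN f hf
  refine ⟨N2 * N3, by positivity, fun γ hγ => ?_⟩
  rw [← e3 γ (GF_mono (Dvd.intro_left _ rfl) hγ), ← e1 _ (e2 γ (GF_mono (Dvd.intro _ rfl) hγ))]
  congr 1; group

lemma Inv.inv {g : SL F} (hg : Inv A g) : Inv A g⁻¹ := by
  intro N hN f hf
  obtain ⟨N1, h1, e1⟩ := hg N hN f hf
  obtain ⟨N2, h2, e2⟩ := conj_bdd g⁻¹ N1 h1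
  refine ⟨N2, h2, fun γ hγ => ?_⟩
  rw [← e1 _ (e2 γ hγ)]
  congr 1; group

lemma Inv.conj {g : SL F} (hg : Inv A g) (k : SL F) : Inv A (k * g * k⁻¹) := by
  intro N hN f hf
  obtain ⟨N1, h1, e1⟩ := conj_bdd k N hN
  obtain ⟨N2, h2, e2⟩ := hg N1 h1 (fun x => f (k * x * k⁻¹)) (by
    intro x hx y hy
    have : k * (x * y) * k⁻¹ = (k * x * k⁻¹) * (k * y * k⁻¹) := by group
    simp only [this]
    exact hf _ (e1 _ hx) _ (e1 _ hy))
  obtain ⟨N3, h3, e3⟩ := conj_bdd k⁻¹ N2 h2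
  refine ⟨N3, h3, fun γ hγ => ?_⟩
  have := e2 _ (e3 γ hγ)
  convert this using 2 <;> group

lemma inv_unit (htot : ∀ v : InfinitePlace F, v.IsReal)
    (hη : ∃ ε : (𝓞 F)ˣ, ∀ k : ℕ, 0 < k → ε ^ k ≠ 1) (ε : (𝓞 F)ˣ) : Inv A (toF F (hh ε)) := by
  intro N hN f hf
  obtain ⟨N', h1, h2⟩ := partA htot hη ε N hN (fun x => f (toF F x)) (by
    intro x hx y hy
    simp only [map_mul]
    exact hf _ ⟨x, hx, rfl⟩ _ ⟨y, hy, rfl⟩)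
  refine ⟨N', h1, ?_⟩
  rintro _ ⟨γ, hγ, rfl⟩
  have := h2 γ hγ
  simpa only [map_mul, map_inv] using this

lemma inv_uu (htot : ∀ v : InfinitePlace F, v.IsReal)
    (hη : ∃ ε : (𝓞 F)ˣ, ∀ k : ℕ, 0 < k → ε ^ k ≠ 1) (x : F) : Inv A (uu x) ∧ Inv A (ll x) := by
  obtain ⟨ε, hε⟩ := id hη
  have h0 : (io F (ε : 𝓞 F) ^ 2 - 1) ≠ 0 := by
    intro h
    apply hε 2 (by omega)
    ext1
    apply io_inj
    simpa using sub_eq_zero.1 h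
  have hε0 : io F (ε : 𝓞 F) ≠ 0 := by
    exact (map_ne_zero_iff _ io_inj).2 ε.ne_zero
  have hεi : io F ((ε⁻¹ : (𝓞 F)ˣ) : 𝓞 F) * io F (ε : 𝓞 F) = 1 := by
    have := ε.inv_mul
    have := congrArg (io F) this
    simpa only [map_mul, map_one] using this
  have hi := inv_unit (A := A) htot hη ε
  have hεi' : io F ((ε⁻¹ : (𝓞 F)ˣ) : 𝓞 F) = (io F (ε : 𝓞 F))⁻¹ := eq_inv_of_mul_eq_one_left hεi
  generalize hm : io F (ε : 𝓞 F) = m at *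
  constructor
  · have h1 := hi.mul (hi.inv.conj (uu (x / (m ^ 2 - 1))))
    convert h1 using 1
    apply ext4
    · simp [hεi', hm, hε0]
    · simp [hεi', hm, hε0]; field_simp; ring
    · simp
    · simp [hεi', hm, hε0]
  · have h1 := hi.inv.mul (hi.conj (ll (x / (m ^ 2 - 1))))
    convert h1 using 1
    apply ext4
    · simp [hεi', hm, hε0]
    · simp
    · simp [hεi', hm, hε0]; field_simp; ring
    · simp [hεi', hm, hε0]

lemma inv_hh (htot : ∀ v : InfinitePlace F, v.IsReal)
    (hη : ∃ ε : (𝓞 F)ˣ, ∀ k : ℕ, 0 < k → ε ^ k ≠ 1) (s : Fˣ) : Inv A (hh s) := by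
  have h := inv_uu (A := A) htot hη
  have e : hh s = uu (s : F) * ll (-(s : F)⁻¹) * uu (s : F) * (uu (-1) * ll 1 * uu (-1)) := by
    have := s.ne_zero
    apply ext4 <;> simp
  rw [e]
  exact (((h _).1.mul (h _).2).mul (h _).1).mul (((h _).1.mul (h _).2).mul (h _).1)

theorem partB (htot : ∀ v : InfinitePlace F, v.IsReal)
    (hη : ∃ ε : (𝓞 F)ˣ, ∀ k : ℕ, 0 < k → ε ^ k ≠ 1) (s : 𝓞 F) (hs : s ≠ 0) (N : ℕ) (hN : 0 < N)
    (f : SL (𝓞 F) → A) (hf : AddOn (Gm (N : 𝓞 F)) f) :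
    ∃ R : ℕ, 0 < R ∧ ∀ γ ∈ Gm (R : 𝓞 F), ∀ δ : SL (𝓞 F), ea δ = ea γ → eb δ = s ^ 2 * eb γ →
      s ^ 2 * ec δ = ec γ → ed δ = ed γ → f δ = f γ := by
  have hs' : (io F s) ≠ 0 := (map_ne_zero_iff _ io_inj).2 hs
  have hl : ∀ x, f (Function.invFun (toF F) (toF F x)) = f x := fun x => by
    rw [Function.leftInverse_invFun toF_inj]
  obtain ⟨R, hR, h⟩ := inv_hh (A := A) htot hη (Units.mk0 (io F s) hs') N hN
    (fun x => f (Function.invFun (toF F) x)) (by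
    rintro _ ⟨x, hx, rfl⟩ _ ⟨y, hy, rfl⟩
    simp only [← map_mul, hl]
    exact hf x hx y hy)
  refine ⟨R, hR, fun γ hγ δ ha hb hc hd => ?_⟩
  have h1 := h _ ⟨γ, hγ, rfl⟩
  have h2 : hh (Units.mk0 (io F s) hs') * toF F γ * (hh (Units.mk0 (io F s) hs'))⁻¹ = toF F δ := by
    apply ext4
    · simp [ha]; field_simp
    · simp [hb]; ring
    · simp [← hc]; field_simp
    · simp [hd]; field_simp
  rw [h2] at h1
  simpa only [hl] using h1
end PD
end PartB1

section PartC1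
open NumberField
namespace PD
variable {F : Type*} [Field F] [NumberField F] {A : Type*} [AddCommGroup A]

lemma C1s (htot : ∀ v : InfinitePlace F, v.IsReal)
    (hη : ∃ ε : (𝓞 F)ˣ, ∀ k : ℕ, 0 < k → ε ^ k ≠ 1) (s : 𝓞 F) (hs : s ≠ 0) (N : ℕ) (hN : 0 < N)
    (f : SL (𝓞 F) → A) (hf : Good (N : 𝓞 F) f) (D : SL (𝓞 F) → SL (𝓞 F))
    (hD : ∀ γ : SL (𝓞 F), s ^ 2 ∣ ec γ → ea (D γ) = ea γ ∧ eb (D γ) = s ^ 2 * eb γ ∧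
      s ^ 2 * ec (D γ) = ec γ ∧ ed (D γ) = ed γ)
    (hDm : ∀ γ δ : SL (𝓞 F), s ^ 2 ∣ ec γ → s ^ 2 ∣ ec δ → D (γ * δ) = D γ * D δ) :
    ∀ γ ∈ Del (N : 𝓞 F) (Ideal.span {s ^ 2 * (N : 𝓞 F)}), f (D γ) = f γ := by
  have hN0 : (N : 𝓞 F) ≠ 0 := by exact_mod_cast hN.ne'
  have hs2 : s ^ 2 ≠ 0 := pow_ne_zero _ hs
  obtain ⟨R, hR, hRf⟩ := partB htot hη s hs N hN f hf.add
  have mem : ∀ γ ∈ Del (N : 𝓞 F) (Ideal.span {s ^ 2 * (N : 𝓞 F)}),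
      s ^ 2 ∣ ec γ ∧ γ ∈ Gm (N : 𝓞 F) ∧ D γ ∈ Gm (N : 𝓞 F) := by
    intro γ hγ
    rw [mem_Del, Ideal.span_singleton_mul_span_singleton, Ideal.mem_span_singleton,
      Ideal.mem_span_singleton, Ideal.mem_span_singleton] at hγ
    obtain ⟨h1, h2, h3⟩ := hγ
    have h3' := dvd_of_mul_right_dvd h3
    obtain ⟨e1, e2, e3, e4⟩ := hD γ h3'
    refine ⟨h3', mem_Gm' (dvd_of_mul_right_dvd h1) h2 (dvd_of_mul_left_dvd h3), mem_Gm' ?_ ?_ ?_⟩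
    · rw [e1]; exact dvd_of_mul_right_dvd h1
    · rw [e2]; exact h2.mul_left _
    · rw [← e3] at h3
      exact (mul_dvd_mul_iff_left hs2).1 h3
  have key := lemL (N : 𝓞 F) (Ideal.span {s ^ 2 * (N : 𝓞 F)}) (R : 𝓞 F) (by exact_mod_cast hR.ne')
    (fun γ => f (D γ) - f γ) ?_ ?_ ?_ ?_
  · intro γ hγ; exact sub_eq_zero.1 (key γ hγ)
  · intro x hx y hy
    obtain ⟨x1, x2, x3⟩ := mem x hx
    obtain ⟨y1, y2, y3⟩ := mem y hy
    change f (D (x * y)) - f (x * y) = (f (D x) - f x) + (f (D y) - f y)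
    rw [hDm x y x1 y1, hf.add _ x3 _ y3, hf.add _ x2 _ y2]; abel
  · intro y
    rw [hf.u' (Dvd.intro _ rfl)]
    have h0 : s ^ 2 ∣ ec (uu (N * y)) := by simp
    obtain ⟨e1, e2, e3, e4⟩ := hD _ h0
    have : D (uu (N * y)) = uu (s ^ 2 * (N * y)) := by
      apply ext4
      · rw [e1]; rfl
      · rw [e2]; rfl
      · simp [hs] at e3 ⊢; exact e3
      · rw [e4]; rfl
    rw [this, hf.u' ⟨s ^ 2 * y, by ring⟩, sub_zero]
  · intro y hy
    obtain ⟨z, rfl⟩ := Ideal.mem_span_singleton.1 hy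
    rw [hf.l' ⟨s ^ 2 * z, by ring⟩]
    have h0 : s ^ 2 ∣ ec (ll (s ^ 2 * N * z)) := ⟨N * z, by simp; ring⟩
    obtain ⟨e1, e2, e3, e4⟩ := hD _ h0
    have : D (ll (s ^ 2 * N * z)) = ll (N * z) := by
      apply ext4
      · rw [e1]; rfl
      · rw [e2]; simp
      · have : s ^ 2 * ec (D (ll (s ^ 2 * N * z))) = s ^ 2 * (N * z) := by
          rw [e3]; simp; ring
        exact mul_left_cancel₀ hs2 this
      · rw [e4]; rfl
    rw [this, hf.l' (Dvd.intro _ rfl), sub_zero]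
  · intro γ hγ hγ'
    obtain ⟨e1, e2, e3, e4⟩ := hD _ (mem γ hγ').1
    rw [hRf γ hγ _ e1 e2 e3 e4, sub_self]

lemma exists_D (s : 𝓞 F) (hs : s ≠ 0) : ∃ D : SL (𝓞 F) → SL (𝓞 F),
    (∀ γ : SL (𝓞 F), s ^ 2 ∣ ec γ → ea (D γ) = ea γ ∧ eb (D γ) = s ^ 2 * eb γ ∧
      s ^ 2 * ec (D γ) = ec γ ∧ ed (D γ) = ed γ) ∧
    (∀ γ δ : SL (𝓞 F), s ^ 2 ∣ ec γ → s ^ 2 ∣ ec δ → D (γ * δ) = D γ * D δ) := by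
  have hs2 : s ^ 2 ≠ 0 := pow_ne_zero _ hs
  have h1 : ∀ γ : SL (𝓞 F), ∃ δ : SL (𝓞 F), s ^ 2 ∣ ec γ → ea δ = ea γ ∧ eb δ = s ^ 2 * eb γ ∧
      s ^ 2 * ec δ = ec γ ∧ ed δ = ed γ := by
    intro γ
    by_cases h : s ^ 2 ∣ ec γ
    · obtain ⟨c, hc⟩ := h
      refine ⟨mk2 (ea γ) (s ^ 2 * eb γ) c (ed γ) ?_, fun _ => ⟨rfl, rfl, hc.symm, rfl⟩⟩
      have := edet γ
      rw [hc] at this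
      linear_combination this
    · exact ⟨1, fun h' => absurd h' h⟩
  choose D hD using h1
  refine ⟨D, hD, fun γ δ h1 h2 => ?_⟩
  have h3 : s ^ 2 ∣ ec (γ * δ) := by
    simp only [ec_mul]; exact dvd_add (h1.mul_right _) (h2.mul_left _)
  obtain ⟨a1, b1, c1, d1⟩ := hD γ h1
  obtain ⟨a2, b2, c2, d2⟩ := hD δ h2
  obtain ⟨a3, b3, c3, d3⟩ := hD _ h3
  apply ext4
  · rw [a3]; simp only [ea_mul]; rw [a1, a2, b1, ← c2]; ring
  · rw [b3]; simp only [eb_mul]; rw [a1, b2, b1, d2]; ring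
  · apply mul_left_cancel₀ hs2
    rw [c3]; simp only [ec_mul]; rw [← c1, a2, d1, ← c2]; ring
  · rw [d3]; simp only [ed_mul]; rw [← c1, b2, d1, d2]; ring

structure Ctx (A : Type*) [AddCommGroup A] (F : Type*) [Field F] [NumberField F] (p N Q N' : ℕ) : Prop where
  htot : ∀ v : InfinitePlace F, v.IsReal
  hη : ∃ ε : (𝓞 F)ˣ, ∀ k : ℕ, 0 < k → ε ^ k ≠ 1
  hp : ∀ k : ℕ, k.Coprime p → ∀ x : A, k • x = 0 → x = 0
  hpQ : p ∣ Q
  hN : 0 < N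
  h30 : 30 ∣ N
  hNQ : N ^ 3 ∣ Q
  hN' : 1 < N'
  hQN : Q ∣ N'
  hsm : ∀ l : ℕ, l.Prime → l ≤ Module.finrank ℚ F → l ∣ N'
  spec : ∀ (s : 𝓞 F) (m : ℕ), Nice N' s m → ∀ a : 𝓞 F, IsCoprime a s →
      ∃ a' : ℕ, Sp F Q a' ∧ a' ≡ 1 [MOD Q] ∧ s ∣ (a' : 𝓞 F) - a

lemma Nice.dvd_m {N : ℕ} {s : 𝓞 F} {m : ℕ} (h : Nice N s m) : s ∣ (m : 𝓞 F) := by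
  have := (h.dvd_iff m).2 (dvd_refl _)
  exact_mod_cast this

lemma Nice.ne {N : ℕ} {s : 𝓞 F} {m : ℕ} (h : Nice N s m) : s ≠ 0 := by
  rintro rfl
  have := zero_dvd_iff.1 h.dvd_m
  have h2 := h.pos
  have : m = 0 := by exact_mod_cast this
  omega

lemma nat_cop {a b : ℕ} (h : a.Coprime b) : IsCoprime (a : 𝓞 F) (b : 𝓞 F) := by
  have h1 : IsCoprime (a : ℤ) (b : ℤ) := Nat.isCoprime_iff_coprime.2 h
  have := h1.map (Int.castRingHom (𝓞 F))
  simpa using this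

lemma Nice.copN {N : ℕ} {s : 𝓞 F} {m : ℕ} (h : Nice N s m) : IsCoprime s (N : 𝓞 F) :=
  (nat_cop h.cop).of_isCoprime_of_dvd_left h.dvd_m

variable {p N Q N' : ℕ}

lemma Ctx.N3 (hc : Ctx A F p N Q N') : (N : 𝓞 F) ^ 3 ∣ (N' : 𝓞 F) := by
  have := Nat.cast_dvd_cast (α := 𝓞 F) (hc.hNQ.trans hc.hQN)
  exact_mod_cast this

lemma Ctx.copN (hc : Ctx A F p N Q N') {s : 𝓞 F} {m : ℕ} (hs : Nice N' s m) : IsCoprime s (N : 𝓞 F) :=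
  hs.copN.of_isCoprime_of_dvd_right ((dvd_pow_self _ (by norm_num)).trans hc.N3)

/-- subgroup a = 1 mod N^2, b in N, c in s^2 N -/
def Dp (N s : 𝓞 F) : Subgroup (SL (𝓞 F)) where
  carrier := {γ | N ^ 2 ∣ ea γ - 1 ∧ N ∣ eb γ ∧ s ^ 2 * N ∣ ec γ ∧ N ^ 2 ∣ ed γ - 1}
  one_mem' := by simp
  mul_mem' := by
    rintro y z ⟨⟨a1, e1⟩, ⟨b1, e2⟩, ⟨c1, e3⟩, ⟨d1, e4⟩⟩ ⟨⟨a2, e5⟩, ⟨b2, e6⟩, ⟨c2, e7⟩, ⟨d2, e8⟩⟩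
    rw [sub_eq_iff_eq_add] at e1 e4 e5 e8
    refine ⟨?_, ?_, ?_, ?_⟩
    · rw [ea_mul, e1, e5, e2, e7]
      exact ⟨N ^ 2 * a1 * a2 + a1 + a2 + b1 * s ^ 2 * c2, by ring⟩
    · rw [eb_mul, e2, e6]; exact ⟨ea y * b2 + b1 * ed z, by ring⟩
    · rw [ec_mul, e3, e7]; exact ⟨c1 * ea z + ed y * c2, by ring⟩
    · rw [ed_mul, e4, e8, e3, e6]
      exact ⟨N ^ 2 * d1 * d2 + d1 + d2 + b2 * s ^ 2 * c1, by ring⟩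
  inv_mem' := by
    rintro y ⟨a1, b1, c1, d1⟩
    simp only [Set.mem_setOf_eq, ea_inv, eb_inv, ec_inv, ed_inv, dvd_neg]
    exact ⟨d1, b1, c1, a1⟩

lemma mem_Dp' {N s : 𝓞 F} {γ : SL (𝓞 F)} (ha : N ^ 2 ∣ ea γ - 1) (hb : N ∣ eb γ) (hc : s ^ 2 * N ∣ ec γ) :
    γ ∈ Dp N s := by
  refine ⟨ha, hb, hc, ?_⟩
  have h1 : N ^ 2 ∣ eb γ * ec γ := by rw [pow_two]; exact mul_dvd_mul hb (dvd_of_mul_left_dvd hc)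
  have := dvd_sub h1 (ha.mul_left (ed γ))
  convert this using 1
  linear_combination edet γ

lemma Dp_le {N s : 𝓞 F} : Dp N s ≤ Gm N := fun γ h =>
  mem_Gm' ((dvd_pow_self _ (by norm_num)).trans h.1) h.2.1 (dvd_of_mul_left_dvd h.2.2.1)

lemma pow_ea {N s : 𝓞 F} {γ : SL (𝓞 F)} (h : γ ∈ Dp N s) (k : ℕ) :
    s ^ 2 * N ^ 2 ∣ ea (γ ^ k) - ea γ ^ k := by
  induction k with
  | zero => simp
  | succ k ih =>
    have h1 : γ ^ k ∈ Dp N s := pow_mem h k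
    obtain ⟨b1, hb1⟩ := h1.2.1
    obtain ⟨c1, hc1⟩ := h.2.2.1
    obtain ⟨x, hx⟩ := ih
    rw [pow_succ γ, ea_mul, hb1, hc1, pow_succ (ea γ)]
    exact ⟨x * ea γ + b1 * c1, by linear_combination (ea γ) * hx⟩

theorem C2 (hc : Ctx A F p N Q N') (f : SL (𝓞 F) → A) (hf : Good (N : 𝓞 F) f) (s : 𝓞 F) (m : ℕ)
    (hs : Nice N' s m) (a b : 𝓞 F) (ha : (N : 𝓞 F) ^ 2 ∣ a - 1) (hb : (N : 𝓞 F) ∣ b) (hab : IsCoprime a b)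
    (has : IsCoprime a s) : row f N a (s ^ 2 * b) = row f N a b := by
  have hN0 : (N : 𝓞 F) ≠ 0 := by exact_mod_cast hc.hN.ne'
  have hsN := hc.copN hs
  obtain ⟨D, hD, hDm⟩ := exists_D s hs.ne
  have key := C1s hc.htot hc.hη s hs.ne N hc.hN f hf D hD hDm
  set g : SL (𝓞 F) → A := fun γ => f (D γ) - f γ with hg
  have hDp : ∀ γ ∈ Dp (N : 𝓞 F) s, s ^ 2 ∣ ec γ ∧ D γ ∈ Gm (N : 𝓞 F) := by
    intro γ hγ
    have h3 := dvd_of_mul_right_dvd hγ.2.2.1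
    obtain ⟨e1, e2, e3, e4⟩ := hD γ h3
    refine ⟨h3, mem_Gm' ?_ ?_ ?_⟩
    · rw [e1]; exact (Dp_le hγ).1
    · rw [e2]; exact hγ.2.1.mul_left _
    · have := hγ.2.2.1
      rw [← e3] at this
      exact (mul_dvd_mul_iff_left (pow_ne_zero _ hs.ne)).1 this
  have hga : AddOn (Dp (N : 𝓞 F) s) g := by
    intro x hx y hy
    simp only [hg]
    rw [hDm x y (hDp x hx).1 (hDp y hy).1, hf.add _ (hDp x hx).2 _ (hDp y hy).2,
      hf.add _ (Dp_le hx) _ (Dp_le hy)]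
    abel
  -- vanishing
  have hv : ∀ γ ∈ Dp (N : 𝓞 F) s, s ^ 2 ∣ ea γ - 1 → g γ = 0 := by
    intro γ hγ h1
    simp only [hg]
    rw [key γ ?_, sub_self]
    rw [mem_Del, Ideal.span_singleton_mul_span_singleton, Ideal.mem_span_singleton,
      Ideal.mem_span_singleton, Ideal.mem_span_singleton]
    refine ⟨?_, hγ.2.1, hγ.2.2.1⟩
    have := (hsN.pow (m := 2) (n := 2)).mul_dvd h1 hγ.1
    convert this using 1; ring
  have hpm : m.Coprime p := hs.cop.coprime_dvd_right (hc.hpQ.trans hc.hQN)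
  have hv' : ∀ γ ∈ Dp (N : 𝓞 F) s, s ∣ ea γ - 1 → g γ = 0 := by
    intro γ hγ h1
    apply hc.hp m hpm
    rw [← hga.pow hγ]
    apply hv _ (pow_mem hγ _)
    have h2 := (dvd_of_mul_right_dvd (pow_ea hγ m))
    have h3 : s ^ 2 ∣ ea γ ^ m - 1 := by
      have h4 : ea γ ^ m - 1 = (ea γ - 1) * ∑ i ∈ Finset.range m, ea γ ^ i := (mul_geom_sum _ _).symm
      rw [h4, pow_two]
      refine mul_dvd_mul h1 ?_
      have h5 : ∑ i ∈ Finset.range m, ea γ ^ i = ∑ i ∈ Finset.range m, (ea γ ^ i - 1) + m := by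
        simp
      rw [h5]
      exact dvd_add (Finset.dvd_sum fun i _ => h1.trans (sub_one_dvd_pow_sub_one _ _)) hs.dvd_m
    have := dvd_add h2 h3
    convert this using 1; ring
  have hdep : ∀ γ ∈ Dp (N : 𝓞 F) s, ∀ δ ∈ Dp (N : 𝓞 F) s, s ∣ ea γ - ea δ → g γ = g δ := by
    intro γ hγ δ hδ h
    have h1 := hga _ (mul_mem hγ (inv_mem hδ)) _ hδ
    rw [inv_mul_cancel_right, hv' _ (mul_mem hγ (inv_mem hδ)), zero_add] at h1
    · exact h1
    · rw [ea_mul, ea_inv, ec_inv]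
      have h2 : s ∣ ec δ := (dvd_pow_self s two_ne_zero).trans (hDp δ hδ).1
      have := dvd_sub (h.mul_right (ed δ)) (dvd_sub (h2.mul_left (eb γ)) (h2.mul_left (eb δ)))
      convert this using 1
      linear_combination edet δ
  have hex : ∀ a b : 𝓞 F, (N : 𝓞 F) ^ 2 ∣ a - 1 → (N : 𝓞 F) ∣ b → IsCoprime a b → IsCoprime a s →
      ∃ γ ∈ Dp (N : 𝓞 F) s, ea γ = a ∧ eb γ = b ∧ g γ = row f N a (s ^ 2 * b) - row f N a b := by
    intro a b ha hb hab has
    have hN : IsCoprime a (N : 𝓞 F) := cop_of_cong ((dvd_pow_self _ two_ne_zero).trans ha)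
    have hco : IsCoprime a (b * (s ^ 2 * N)) := hab.mul_right ((has.pow_right).mul_right hN)
    obtain ⟨x, y, hxy⟩ := hco
    have hm : mk2 a b (-(s ^ 2 * N * y)) x (by linear_combination hxy) ∈ Dp (N : 𝓞 F) s :=
      mem_Dp' ha hb ⟨-y, by simp⟩
    refine ⟨_, hm, rfl, rfl, ?_⟩
    obtain ⟨e1, e2, e3, e4⟩ := hD _ (hDp _ hm).1
    rw [hf.row (a := a) (b := b) (Dp_le hm) rfl rfl, hf.row (a := a) (b := s ^ 2 * b) (hDp _ hm).2 e1 e2]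
  obtain ⟨γ, hγ, hγa, hγb, hγg⟩ := hex a b ha hb hab has
  rw [← sub_eq_zero, ← hγg]
  obtain ⟨a1, ⟨ha0, M, hMQ, hM⟩, haQ, has1⟩ := hc.spec s m hs a has
  have hN2Q : N ^ 2 ∣ Q := (pow_dvd_pow N (by norm_num)).trans hc.hNQ
  have ha1 : ((N : 𝓞 F) ^ 2) ∣ (a1 : 𝓞 F) - 1 := by
    have h1 : ((N ^ 2 : ℕ) : ℤ) ∣ (a1 : ℤ) - 1 := by
      have := (haQ.of_dvd hN2Q).symm.dvd; exact_mod_cast this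
    obtain ⟨c, hc⟩ := h1
    refine ⟨c, ?_⟩
    have := congrArg (Int.castRingHom (𝓞 F)) hc
    simpa using this
  have ha1s : IsCoprime (a1 : 𝓞 F) s := by
    obtain ⟨k, hk⟩ := has1
    have : (a1 : 𝓞 F) = a + s * k := by linear_combination hk
    rw [this]; exact IsCoprime.add_mul_left_left has k
  have ha1N : IsCoprime (a1 : 𝓞 F) N := cop_of_cong ((dvd_pow_self _ two_ne_zero).trans ha1)
  have hstep : ∀ j : ℕ, row f N (a1 : 𝓞 F) (s ^ (2 * j) * N) = j • g γ + row f N (a1 : 𝓞 F) N := by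
    intro j
    induction j with
    | zero => simp
    | succ j ih =>
      obtain ⟨δ, hδ, hδa, hδb, hδg⟩ := hex a1 (s ^ (2 * j) * N) ha1 (Dvd.intro_left _ rfl)
        ((ha1s.pow_right).mul_right ha1N) ha1s
      have h1 := hdep δ hδ γ hγ (by rw [hδa, hγa]; exact has1)
      rw [h1, ih] at hδg
      have h2 : s ^ (2 * (j + 1)) * (N : 𝓞 F) = s ^ 2 * (s ^ (2 * j) * N) := by ring
      rw [h2, succ_nsmul]
      rw [eq_sub_iff_add_eq] at hδg
      rw [← hδg]; abel
  apply hc.hp M (hMQ.coprime_dvd_right hc.hpQ)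
  have h1 := hstep M
  have hadm : Adm (N : 𝓞 F) a1 N := ⟨(dvd_pow_self _ two_ne_zero).trans ha1, dvd_refl _, ha1N⟩
  rw [(hf.row_b hadm (b' := s ^ (2 * M) * N) (Dvd.intro_left _ rfl) ?_).2] at h1
  · simpa using h1
  · have := (hM s ha1s.symm).mul_right (N : 𝓞 F)
    convert this using 1; ring
end PD
end PartC1

section PartC3
open NumberField
namespace PD

lemma conic_prime (l : ℕ) (hl : l.Prime) (hm : l.Coprime 30) (q : ℤ) (hq : IsCoprime q l) :
    ∃ X Y : ℤ, IsCoprime X l ∧ IsCoprime Y l ∧ (l : ℤ) ∣ X ^ 2 + Y ^ 2 - q := by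
  have : Fact l.Prime := ⟨hl⟩
  have cop : ∀ x : ℤ, (x : ZMod l) ≠ 0 → IsCoprime x l := by
    intro x hx
    rw [isCoprime_comm, (Nat.prime_iff_prime_int.1 hl).coprime_iff_not_dvd]
    rwa [← ZMod.intCast_zmod_eq_zero_iff_dvd] 
  have hlift : ∀ x y : ZMod l, x ≠ 0 → y ≠ 0 → x ^ 2 + y ^ 2 = q →
      ∃ X Y : ℤ, IsCoprime X l ∧ IsCoprime Y l ∧ (l : ℤ) ∣ X ^ 2 + Y ^ 2 - q := by
    intro x y hx hy h
    obtain ⟨X, rfl⟩ := ZMod.intCast_surjective x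
    obtain ⟨Y, rfl⟩ := ZMod.intCast_surjective y
    refine ⟨X, Y, cop _ hx, cop _ hy, ?_⟩
    rw [← ZMod.intCast_zmod_eq_zero_iff_dvd]
    push_cast
    rw [h, sub_self]
  have hq0 : (q : ZMod l) ≠ 0 := by
    rw [Ne, ZMod.intCast_zmod_eq_zero_iff_dvd, ← (Nat.prime_iff_prime_int.1 hl).coprime_iff_not_dvd]
    exact hq.symm
  have hnz : ∀ k : ℕ, k ∣ 30 → (k : ZMod l) ≠ 0 := by
    intro k hk h
    rw [ZMod.natCast_eq_zero_iff] at h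
    have h1 : l ∣ 1 := by
      rw [← Nat.Coprime.gcd_eq_one hm]; exact Nat.dvd_gcd (dvd_refl _) (h.trans hk)
    exact hl.one_lt.ne' (Nat.dvd_one.1 h1)
  have h5 : (5 : ZMod l) ≠ 0 := by exact_mod_cast hnz 5 (by norm_num)
  have h3 : (3 : ZMod l) ≠ 0 := by exact_mod_cast hnz 3 (by norm_num)
  have h2 : (2 : ZMod l) ≠ 0 := by exact_mod_cast hnz 2 (by norm_num)
  have h4 : (4 : ZMod l) ≠ 0 := by
    have : (4 : ZMod l) = 2 * 2 := by norm_num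
    rw [this]; exact mul_ne_zero h2 h2
  have hsq : ∀ x : ZMod l, x ^ 2 = q → ∃ X Y : ℤ, IsCoprime X l ∧ IsCoprime Y l ∧ (l : ℤ) ∣ X ^ 2 + Y ^ 2 - q := by
    intro x hx
    have hx0 : x ≠ 0 := by rintro rfl; exact hq0 (by rw [← hx]; simp)
    refine hlift (x * 3 / 5) (x * 4 / 5) (div_ne_zero (mul_ne_zero hx0 h3) h5)
      (div_ne_zero (mul_ne_zero hx0 h4) h5) ?_
    rw [← hx]; field_simp; ring
  obtain ⟨x, y, hxy⟩ := ZMod.sq_add_sq l (q : ZMod l)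
  by_cases hx : x = 0
  · subst hx; exact hsq y (by simpa using hxy)
  by_cases hy : y = 0
  · subst hy; exact hsq x (by simpa using hxy)
  exact hlift x y hx hy hxy

lemma conic_pp (l : ℕ) (hl : l.Prime) (k : ℕ) (hm : l.Coprime 30) (q : ℤ) (hq : IsCoprime q l) :
    ∃ X Y : ℤ, IsCoprime X (l ^ (k + 1) : ℕ) ∧ IsCoprime Y (l ^ (k + 1) : ℕ) ∧
      ((l ^ (k + 1) : ℕ) : ℤ) ∣ X ^ 2 + Y ^ 2 - q := by
  obtain ⟨X, Y, hX, hY, h⟩ := conic_prime l hl hm q hq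
  have hX' : IsCoprime X ((l ^ (k + 1) : ℕ) : ℤ) := by push_cast; exact hX.pow_right
  have hY' : IsCoprime Y ((l ^ (k + 1) : ℕ) : ℤ) := by push_cast; exact hY.pow_right
  obtain ⟨i, j, hij⟩ := id hX'
  -- i X = 1 mod l^(k+1)
  set v := q - Y ^ 2 with hv
  set w := v * i ^ 2 with hw
  have hw1 : (l : ℤ) ∣ w - 1 := by
    obtain ⟨c, hc⟩ := h
    refine ⟨-c * i ^ 2 - j * l ^ k * (i * X + 1), ?_⟩
    push_cast at hij
    rw [hw, hv]
    linear_combination (-i ^ 2) * hc + (i * X + 1) * hij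
  have hpw : ((l ^ (k + 1) : ℕ) : ℤ) ∣ w ^ (l ^ k) - 1 := by
    have := dvd_sub_pow_of_dvd_sub hw1 k
    rw [one_pow] at this
    exact_mod_cast this
  have hodd : Odd (l ^ k) := by
    apply Odd.pow
    rw [← Nat.coprime_two_right]
    exact hm.coprime_dvd_right (by norm_num)
  obtain ⟨e, he⟩ := hodd
  have hsq : ((l ^ (k + 1) : ℕ) : ℤ) ∣ (X * w ^ (e + 1)) ^ 2 - v := by
    obtain ⟨c, hc⟩ := hpw
    rw [he] at hc
    obtain ⟨P, hP⟩ : ∃ P : ℤ, P = ((l ^ (k + 1) : ℕ) : ℤ) := ⟨_, rfl⟩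
    rw [← hP] at hc hij ⊢
    have h1 : (X * w ^ (e + 1)) ^ 2 = X ^ 2 * w * w ^ (2 * e + 1) := by ring
    have h2 : w ^ (2 * e + 1) = 1 + P * c := by linear_combination hc
    rw [h1, h2, hw]
    exact ⟨X ^ 2 * (v * i ^ 2) * c - v * j * (i * X + 1), by linear_combination v * (i * X + 1) * hij⟩
  refine ⟨X * w ^ (e + 1), Y, ?_, hY', ?_⟩
  · refine hX'.mul_left (IsCoprime.pow_left ?_)
    push_cast
    refine IsCoprime.pow_right ?_
    obtain ⟨c, hc⟩ := hw1
    exact ⟨1, -c, by linear_combination hc⟩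
  · convert hsq using 1; rw [hv]; ring

theorem conic (m : ℕ) (h0 : 0 < m) (hm : m.Coprime 30) (q : ℤ) (hq : IsCoprime q m) :
    ∃ X Y : ℤ, IsCoprime X m ∧ IsCoprime Y m ∧ (m : ℤ) ∣ X ^ 2 + Y ^ 2 - q := by
  induction m using Nat.recOnPosPrimePosCoprime with
  | zero => omega
  | one => exact ⟨1, 1, isCoprime_one_left, isCoprime_one_left, by simp⟩
  | prime_pow p n hp hn =>
    obtain ⟨k, rfl⟩ : ∃ k, n = k + 1 := ⟨n - 1, by omega⟩
    refine conic_pp p hp k (hm.coprime_dvd_left (dvd_pow_self _ (by omega))) q ?_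
    push_cast at hq
    exact hq.of_isCoprime_of_dvd_right (dvd_pow_self _ (by omega))
  | coprime a b ha hb hab iha ihb =>
    obtain ⟨X1, Y1, hX1, hY1, h1⟩ := iha (by omega) (hm.coprime_dvd_left (Dvd.intro _ rfl))
      (hq.of_isCoprime_of_dvd_right (by push_cast; exact Dvd.intro _ rfl))
    obtain ⟨X2, Y2, hX2, hY2, h2⟩ := ihb (by omega) (hm.coprime_dvd_left (Dvd.intro_left _ rfl))
      (hq.of_isCoprime_of_dvd_right (by push_cast; exact Dvd.intro_left _ rfl))
    have hc : IsCoprime (a : ℤ) (b : ℤ) := Nat.isCoprime_iff_coprime.2 hab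
    obtain ⟨u, v, huv⟩ := id hc
    have crt : ∀ x y : ℤ, ∃ z k1 k2, z = x + a * k1 ∧ z = y + b * k2 := fun x y =>
      ⟨x * (v * b) + y * (u * a), u * (y - x), v * (x - y), by linear_combination x * huv,
        by linear_combination y * huv⟩
    obtain ⟨X, k1, k2, e1, e2⟩ := crt X1 X2
    obtain ⟨Y, k3, k4, e3, e4⟩ := crt Y1 Y2
    push_cast
    refine ⟨X, Y, IsCoprime.mul_right ?_ ?_, IsCoprime.mul_right ?_ ?_, hc.mul_dvd ?_ ?_⟩
    · rw [e1]; exact IsCoprime.add_mul_left_left hX1 _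
    · rw [e2]; exact IsCoprime.add_mul_left_left hX2 _
    · rw [e3]; exact IsCoprime.add_mul_left_left hY1 _
    · rw [e4]; exact IsCoprime.add_mul_left_left hY2 _
    · obtain ⟨c, hc⟩ := h1
      rw [e1, e3]; exact ⟨c + 2 * X1 * k1 + a * k1 ^ 2 + 2 * Y1 * k3 + a * k3 ^ 2, by linear_combination hc⟩
    · obtain ⟨c, hc⟩ := h2
      rw [e2, e4]; exact ⟨c + 2 * X2 * k2 + b * k2 ^ 2 + 2 * Y2 * k4 + b * k4 ^ 2, by linear_combination hc⟩
end PD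
end PartC3

section PartC4
open NumberField
namespace PD
variable {F : Type*} [Field F] [NumberField F] {A : Type*} [AddCommGroup A]
variable {p N Q N' : ℕ}

lemma cop_of_inv {R : Type*} [CommRing R] {β x y : R} (h : β ∣ x * y - 1) : IsCoprime β x := by
  obtain ⟨c, hc⟩ := h
  exact ⟨-c, y, by linear_combination hc⟩

lemma inv_of_cop {R : Type*} [CommRing R] {β x : R} (h : IsCoprime β x) : ∃ y, β ∣ x * y - 1 := by
  obtain ⟨c, y, h⟩ := h
  exact ⟨y, -c, by linear_combination h⟩

lemma crt_cop {R : Type*} [CommRing R] {β s x y : R} (h : IsCoprime β s) (hx : IsCoprime β x) (hy : IsCoprime s y) :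
    ∃ z, β ∣ z - x ∧ s ∣ z - y ∧ IsCoprime (β * s) z := by
  obtain ⟨u, v, huv⟩ := h
  have h1 : x * (v * s) + y * (u * β) = x + β * (u * (y - x)) := by linear_combination x * huv
  have h2 : x * (v * s) + y * (u * β) = y + s * (v * (x - y)) := by linear_combination y * huv
  refine ⟨x * (v * s) + y * (u * β), ?_, ?_, IsCoprime.mul_left ?_ ?_⟩
  · rw [h1]; exact ⟨u * (y - x), by ring⟩
  · rw [h2]; exact ⟨v * (x - y), by ring⟩
  · rw [h1]; exact IsCoprime.add_mul_left_right hx _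
  · rw [h2]; exact IsCoprime.add_mul_left_right hy _

lemma Ctx.lift (hc : Ctx A F p N Q N') (β x : 𝓞 F) (h1 : (N' : 𝓞 F) ∣ β - 1) (hx : IsCoprime β x) :
    ∃ s m, Nice N' s m ∧ β ∣ s - x ∧ (N' : 𝓞 F) ∣ s - 1 := by
  obtain ⟨s, m, e1, e2, e3⟩ := nice_exists N' hc.hN' hc.hsm β x (ne_zero_of_cong hc.hN' h1) hx (cop_of_cong h1)
  exact ⟨s, m, e3, e1, e2⟩

noncomputable def Psi (f : SL (𝓞 F) → A) (N : ℕ) (β e κ r : 𝓞 F) : A :=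
  row f N (1 + N ^ 3 * e * (r - 1)) (κ * N * β)

/-- hypotheses on β -/
structure BB (N N' : ℕ) (β e : 𝓞 F) (m : ℕ) : Prop where
  nice : Nice N' β m
  one : (N' : 𝓞 F) ∣ β - 1
  he : β ∣ N ^ 3 * e - 1

lemma psi_eq (hc : Ctx A F p N Q N') {f : SL (𝓞 F) → A} (hf : Good (N : 𝓞 F) f) {β e : 𝓞 F} {m : ℕ}
    (hB : BB N N' β e m) {κ r a : 𝓞 F} (hκ : κ ∣ N) (ha : (N : 𝓞 F) ^ 3 ∣ a - 1) (har : β ∣ a - r)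
    (hr : IsCoprime β r) : row f N a (κ * N * β) = Psi f N β e κ r := by
  have hN1 : (N : 𝓞 F) ∣ a - 1 := (dvd_pow_self _ (by norm_num)).trans ha
  have haN : IsCoprime a (N : 𝓞 F) := cop_of_cong hN1
  have haβ : IsCoprime a β := by
    obtain ⟨c, hc⟩ := har
    have : a = r + β * c := by linear_combination hc
    rw [this]; exact IsCoprime.add_mul_left_left hr.symm c
  have hadm : Adm (N : 𝓞 F) a (κ * N * β) :=
    ⟨hN1, ⟨κ * β, by ring⟩, ((haN.of_isCoprime_of_dvd_right hκ).mul_right haN).mul_right haβ⟩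
  refine (hf.row_a hadm ?_).2.symm
  have h1 : (N : 𝓞 F) ^ 3 ∣ 1 + N ^ 3 * e * (r - 1) - a := by
    obtain ⟨c, hc⟩ := ha
    exact ⟨e * (r - 1) - c, by linear_combination -hc⟩
  have h2 : β ∣ 1 + N ^ 3 * e * (r - 1) - a := by
    obtain ⟨c, hc⟩ := har
    obtain ⟨d, hd⟩ := hB.he
    exact ⟨d * (r - 1) - c, by linear_combination (r - 1) * hd - hc⟩
  have h3 := ((hc.copN hB.nice).symm.pow_left (m := 3)).mul_dvd h1 h2
  obtain ⟨k, hk⟩ := hκ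
  refine dvd_trans ⟨k, ?_⟩ h3
  linear_combination (N : 𝓞 F) ^ 2 * β * hk

lemma Ctx.two (hc : Ctx A F p N Q N') : (2 : 𝓞 F) ∣ N := by
  have : 2 ∣ N := dvd_trans (by norm_num) hc.h30
  exact_mod_cast Nat.cast_dvd_cast (α := 𝓞 F) this

lemma R2 (hc : Ctx A F p N Q N') {f : SL (𝓞 F) → A} (hf : Good (N : 𝓞 F) f) {β e : 𝓞 F} {m : ℕ}
    (hB : BB N N' β e m) {r r' ρ' s0 z0 : 𝓞 F} (hr : IsCoprime β r) (hr' : β ∣ r' * ρ' - 1)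
    (hs0 : IsCoprime β s0) (hz0 : IsCoprime β z0) (h : β ∣ r * s0 ^ 2 + ρ' - 2 * z0 ^ 2) :
    Psi f N β e 1 r + Psi f N β e 1 r' = Psi f N β e 2 (r * r') := by
  have hN3 := hc.N3
  obtain ⟨s, ms, hs, hsβ, hs1⟩ := hc.lift β s0 hB.one hs0
  have hβs : IsCoprime β s := by
    obtain ⟨c, hc⟩ := hsβ
    have : s = s0 + β * c := by linear_combination hc
    rw [this]; exact IsCoprime.add_mul_left_right hs0 c
  obtain ⟨zz, hz1, hz2, hz3⟩ := crt_cop (s := s) (y := 1) hβs hz0 isCoprime_one_right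
  have hβs1 : (N' : 𝓞 F) ∣ β * s - 1 := by
    have := dvd_add (hB.one.mul_right s) hs1
    convert this using 1; ring
  obtain ⟨z, mz, hz, hzβs, hzN⟩ := hc.lift (β * s) zz hβs1 hz3
  have hzβ : β ∣ z - z0 := by
    have := dvd_add (dvd_of_mul_right_dvd hzβs) hz1
    convert this using 1; ring
  have hzs : s ∣ z - 1 := by
    have := dvd_add (dvd_of_mul_left_dvd hzβs) hz2
    convert this using 1; ring
  -- a
  set a : 𝓞 F := 1 + N ^ 3 * e * (r - 1) with ha
  have haN : (N : 𝓞 F) ^ 3 ∣ a - 1 := ⟨e * (r - 1), by rw [ha]; ring⟩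
  have haβ : β ∣ a - r := by
    obtain ⟨d, hd⟩ := hB.he
    exact ⟨d * (r - 1), by rw [ha]; linear_combination (r - 1) * hd⟩
  set d' : 𝓞 F := 2 * z ^ 2 - a * s ^ 2 with hd'
  have hs1' := hN3.trans hs1
  have hzN' := hN3.trans hzN
  have hd'N : (N : 𝓞 F) ^ 3 ∣ d' - 1 := by
    have := dvd_sub (hzN'.mul_left (2 * (z + 1))) (dvd_add (haN.mul_right (s ^ 2)) (hs1'.mul_left (s + 1)))
    convert this using 1; rw [hd']; ring
  have hd'β : β ∣ d' - ρ' := by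
    have := dvd_sub (dvd_sub (hzβ.mul_left (2 * (z + z0))) h)
      (dvd_add (haβ.mul_right (s ^ 2)) (hsβ.mul_left (r * (s + s0))))
    convert this using 1; rw [hd']; ring
  have c2 : IsCoprime (2 : 𝓞 F) s := ((hc.copN hs).of_isCoprime_of_dvd_right hc.two).symm
  have hd's : IsCoprime d' s := by
    obtain ⟨c, hc⟩ := hzs
    have : d' = 2 + s * (2 * c * (z + 1) - a * s) := by rw [hd']; linear_combination (2 * (z + 1)) * hc
    rw [this]; exact IsCoprime.add_mul_left_left c2 _
  have hd'N' : IsCoprime d' ((N : 𝓞 F) ^ 3) := cop_of_cong hd'N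
  have hd'β' : IsCoprime d' β := by
    obtain ⟨c, hc⟩ := hd'β
    have : d' = ρ' + β * c := by linear_combination hc
    rw [this]; refine IsCoprime.add_mul_left_left (cop_of_inv (y := r') ?_).symm _
    rwa [mul_comm]
  have hco : IsCoprime ((N : 𝓞 F) ^ 3 * β * s ^ 2) d' :=
    ((hd'N'.mul_right hd'β').mul_right hd's.pow_right).symm
  obtain ⟨a', k, hk⟩ := inv_of_cop hco
  have ha'N : (N : 𝓞 F) ^ 3 ∣ a' - 1 := by
    obtain ⟨c, hc⟩ := hd'N
    exact ⟨β * s ^ 2 * k - c * a', by linear_combination hk - a' * hc⟩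
  have ha'β : β ∣ a' - r' := by
    obtain ⟨c, hc⟩ := hd'β
    obtain ⟨c2, hc2⟩ := hr'
    refine ⟨r' * (N ^ 3 * s ^ 2 * k) - r' * a' * c - a' * c2, ?_⟩
    linear_combination r' * hk - r' * a' * hc - a' * hc2
  have ha's : IsCoprime a' s := (cop_of_inv (β := s) (y := d') ⟨N ^ 3 * β * s * k, by linear_combination hk⟩).symm
  have ha'β' : IsCoprime β a' := cop_of_inv (y := d') ⟨N ^ 3 * s ^ 2 * k, by linear_combination hk⟩
  have hcr' : IsCoprime β r' := cop_of_inv hr'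
  have haβ' : IsCoprime a β := by
    obtain ⟨c, hc⟩ := haβ
    have : a = r + β * c := by linear_combination hc
    rw [this]; exact IsCoprime.add_mul_left_left hr.symm c
  have dN : (N : 𝓞 F) ∣ (N : 𝓞 F) ^ 3 := dvd_pow_self _ (by norm_num)
  have dN2 : (N : 𝓞 F) ^ 2 ∣ (N : 𝓞 F) ^ 3 := pow_dvd_pow _ (by norm_num)
  have hadm : Adm (N : 𝓞 F) a (N * β) := ⟨dN.trans haN, Dvd.intro _ rfl,
    (cop_of_cong (dN.trans haN)).mul_right haβ'⟩
  obtain ⟨hA, hrow⟩ := hf.row_mul (a' := a') (b' := s ^ 2 * (N * β)) (c' := N ^ 2 * k) (d' := d') hadm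
    (dN.trans ha'N) ⟨s ^ 2 * β, by ring⟩ ⟨N * k, by ring⟩ (by linear_combination hk)
  have hb : a * (s ^ 2 * (N * β)) + N * β * d' = z ^ 2 * (2 * N * β) := by rw [hd']; ring
  rw [hb] at hA hrow
  have e1 : row f N a (N * β) = Psi f N β e 1 r := by
    rw [← psi_eq hc hf hB (one_dvd _) haN haβ hr, one_mul]
  have e2 : row f N a' (s ^ 2 * (N * β)) = Psi f N β e 1 r' := by
    rw [← psi_eq hc hf hB (one_dvd _) ha'N ha'β hcr', one_mul]
    exact C2 hc f hf s ms hs a' (N * β) (dN2.trans ha'N) (Dvd.intro _ rfl)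
      ((cop_of_cong (dN.trans ha'N)).mul_right ha'β'.symm) ha's
  rw [e1, e2] at hrow
  rw [← hrow]
  set a2 := a * a' + N * β * (N ^ 2 * k) with ha2
  have ha2N : (N : 𝓞 F) ^ 3 ∣ a2 - 1 := by
    have := dvd_add (dvd_add (haN.mul_right a') ha'N) (Dvd.intro (β * k) rfl : (N : 𝓞 F) ^ 3 ∣ N ^ 3 * (β * k))
    convert this using 1; rw [ha2]; ring
  have ha2β : β ∣ a2 - r * r' := by
    have := dvd_add (dvd_add (haβ.mul_right a') (ha'β.mul_left r)) (Dvd.intro (N ^ 3 * k) rfl : β ∣ β * (N ^ 3 * k))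
    convert this using 1; rw [ha2]; ring
  rw [← psi_eq hc hf hB hc.two ha2N ha2β (hr.mul_right hcr')]
  exact C2 hc f hf z mz hz a2 _ (dN2.trans ha2N) ⟨2 * β, by ring⟩
    (hA.cop.of_isCoprime_of_dvd_right (Dvd.intro_left _ rfl))
    (hA.cop.of_isCoprime_of_dvd_right ⟨z * (2 * N * β), by ring⟩)

lemma row_one {f : SL (𝓞 F) → A} {N : 𝓞 F} (hf : Good N f) (x : 𝓞 F) (hx : N ∣ x) : row f N 1 x = 0 := by
  rw [hf.row (a := 1) (b := x) (uu_mem' hx) rfl rfl]; exact hf.u' hx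

lemma R1 (hc : Ctx A F p N Q N') {f : SL (𝓞 F) → A} (hf : Good (N : 𝓞 F) f) {β e : 𝓞 F} {m : ℕ}
    (hB : BB N N' β e m) {t w : 𝓞 F} (ht : β ∣ t * w - 1) : Psi f N β e 2 (-t ^ 2) = 0 := by
  have hN3 := hc.N3
  have hcw : IsCoprime β w := cop_of_inv (y := t) (by rwa [mul_comm])
  have hct : IsCoprime β t := cop_of_inv ht
  obtain ⟨s, ms, hs, hsβ, hs1⟩ := hc.lift β w hB.one hcw
  have hβs : IsCoprime β s := by
    obtain ⟨c, hc⟩ := hsβ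
    have : s = w + β * c := by linear_combination hc
    rw [this]; exact IsCoprime.add_mul_left_right hcw c
  have hs1' := hN3.trans hs1
  have hβ1' := hN3.trans hB.one
  have c2 : IsCoprime (2 : 𝓞 F) s := ((hc.copN hs).of_isCoprime_of_dvd_right hc.two).symm
  set d' : 𝓞 F := 2 * β - s ^ 2 with hd'
  have hd'N : (N : 𝓞 F) ^ 3 ∣ d' - 1 := by
    have := dvd_sub (hβ1'.mul_left 2) (hs1'.mul_left (s + 1))
    convert this using 1; rw [hd']; ring
  have hd's : IsCoprime d' s := by
    have : d' = 2 * β + s * (-s) := by rw [hd']; ring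
    rw [this]; exact IsCoprime.add_mul_left_left (c2.mul_left hβs) _
  have hco : IsCoprime ((N : 𝓞 F) ^ 3 * s ^ 2) d' :=
    ((cop_of_cong hd'N).mul_right hd's.pow_right).symm
  obtain ⟨a', k, hk⟩ := inv_of_cop hco
  have ha'N : (N : 𝓞 F) ^ 3 ∣ a' - 1 := by
    obtain ⟨c, hc⟩ := hd'N
    exact ⟨s ^ 2 * k - c * a', by linear_combination hk - a' * hc⟩
  have ha's : IsCoprime a' s := (cop_of_inv (β := s) (y := d') ⟨N ^ 3 * s * k, by linear_combination hk⟩).symm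
  have dN : (N : 𝓞 F) ∣ (N : 𝓞 F) ^ 3 := dvd_pow_self _ (by norm_num)
  have dN2 : (N : 𝓞 F) ^ 2 ∣ (N : 𝓞 F) ^ 3 := pow_dvd_pow _ (by norm_num)
  have hadm : Adm (N : 𝓞 F) 1 N := ⟨by simp, dvd_refl _, isCoprime_one_left⟩
  obtain ⟨hA, hrow⟩ := hf.row_mul (a' := a') (b' := s ^ 2 * N) (c' := N ^ 2 * k) (d' := d') hadm
    (dN.trans ha'N) (Dvd.intro_left _ rfl) ⟨N * k, by ring⟩ (by linear_combination hk)
  have hb : 1 * (s ^ 2 * (N : 𝓞 F)) + N * d' = 2 * N * β := by rw [hd']; ring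
  rw [hb] at hrow
  have e2 : row f N a' (s ^ 2 * N) = 0 := by
    rw [C2 hc f hf s ms hs a' N (dN2.trans ha'N) (dvd_refl _) (cop_of_cong (dN.trans ha'N)) ha's,
      ← row_one hf (N : 𝓞 F) (dvd_refl _)]
    refine (hf.row_a hadm ?_).2
    rw [← pow_two]; exact dN2.trans ha'N
  rw [row_one hf _ (dvd_refl _), e2, add_zero] at hrow
  rw [← hrow]
  symm
  refine psi_eq hc hf hB hc.two ?_ ?_ ?_
  · have := dvd_add ha'N (Dvd.intro k rfl : (N : 𝓞 F) ^ 3 ∣ N ^ 3 * k)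
    convert this using 1; ring
  · -- a'' d' = 1 + 2 β N^3 k
    obtain ⟨c1, h1⟩ := hsβ
    obtain ⟨c3, h3⟩ := ht
    have h4 : β ∣ (a' + N ^ 3 * k) * s ^ 2 + 1 :=
      ⟨2 * a' , by rw [hd'] at hk; linear_combination -hk⟩
    have h5 : β ∣ s * t - 1 := ⟨c1 * t + c3, by linear_combination t * h1 + h3⟩
    have := dvd_sub (h4.mul_left (t ^ 2)) (h5.mul_left ((a' + N ^ 3 * k) * (s * t + 1)))
    convert this using 1; ring
  · exact (hct.pow_right).neg_right

lemma Psi_zero (hc : Ctx A F p N Q N') (hp2 : p.Coprime 2) {f : SL (𝓞 F) → A} (hf : Good (N : 𝓞 F) f) {β e : 𝓞 F} {m : ℕ}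
    (hB : BB N N' β e m) {a : 𝓞 F} (har : IsCoprime β a) : Psi f N β e 1 a = 0 := by
  have hN3 := hc.N3
  have h1 : Psi f N β e 1 1 = 0 := by
    rw [Psi, sub_self, mul_zero, add_zero]; exact row_one hf _ ⟨β, by ring⟩
  have hβN := hc.copN hB.nice
  have h30 : (30 : 𝓞 F) ∣ N := by exact_mod_cast Nat.cast_dvd_cast (α := 𝓞 F) hc.h30
  have c3 : IsCoprime β (3 : 𝓞 F) := hβN.of_isCoprime_of_dvd_right (dvd_trans ⟨10, by norm_num⟩ h30)
  have c2 : IsCoprime β (2 : 𝓞 F) := hβN.of_isCoprime_of_dvd_right hc.two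
  obtain ⟨θ, hθ⟩ := inv_of_cop c3
  have cθ : IsCoprime β θ := cop_of_inv (y := 3) (by rwa [mul_comm])
  have hBe : ∀ t w : 𝓞 F, β ∣ t * w - 1 → Psi f N β e 1 (t ^ 2) = Psi f N β e 2 (t ^ 2) := by
    intro t w htw
    have cw : IsCoprime β w := cop_of_inv (y := t) (by rwa [mul_comm])
    have := R2 hc hf hB (r := 1) (r' := t ^ 2) (ρ' := w ^ 2) (s0 := w) (z0 := w) isCoprime_one_right
      (by have := htw.mul_right (t * w + 1); convert this using 1; ring) cw cw (by
        have : 1 * w ^ 2 + w ^ 2 - 2 * w ^ 2 = 0 := by ring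
        rw [this]; exact dvd_zero _)
    rw [h1, zero_add, one_mul] at this
    exact this
  have hC : ∀ t w : 𝓞 F, β ∣ t * w - 1 → Psi f N β e 1 (-1) + Psi f N β e 1 (t ^ 2) = 0 := by
    intro t w htw
    have cw : IsCoprime β w := cop_of_inv (y := t) (by rwa [mul_comm])
    have := R2 hc hf hB (r := -1) (r' := t ^ 2) (ρ' := w ^ 2) (s0 := θ * w) (z0 := 2 * (θ * w))
      isCoprime_one_right.neg_right
      (by have := htw.mul_right (t * w + 1); convert this using 1; ring) (cθ.mul_right cw)
      (c2.mul_right (cθ.mul_right cw)) (by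
        have := hθ.mul_right (-(3 * θ + 1) * w ^ 2)
        convert this using 1; ring)
    rw [this, neg_one_mul]
    exact R1 hc hf hB htw
  have hm1 : Psi f N β e 1 (-1) = 0 := by
    have := hC 1 1 (by simp)
    rwa [one_pow, h1, add_zero] at this
  have hsq : ∀ t w : 𝓞 F, β ∣ t * w - 1 → Psi f N β e 2 (t ^ 2) = 0 := by
    intro t w htw
    have := hC t w htw
    rw [hm1, zero_add] at this
    rw [← hBe t w htw, this]
  obtain ⟨ai, hai⟩ := inv_of_cop har
  obtain ⟨r, hr, hrm⟩ := hB.nice.unit_rep har.symm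
  have hm30 : m.Coprime 30 := hB.nice.cop.coprime_dvd_right
    (hc.h30.trans ((dvd_pow_self _ (by norm_num)).trans (hc.hNQ.trans hc.hQN)))
  have hq : IsCoprime (2 * (r : ℤ)) (m : ℤ) := by
    have h2 : IsCoprime (2 : ℤ) (m : ℤ) := by
      exact_mod_cast Nat.isCoprime_iff_coprime.2 (hm30.coprime_dvd_right (by norm_num : 2 ∣ 30)).symm
    exact h2.mul_left (Nat.isCoprime_iff_coprime.2 hrm)
  obtain ⟨X, Y, hX, hY, hXY⟩ := conic m hB.nice.pos hm30 (2 * (r : ℤ)) hq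
  have toβ : ∀ x : ℤ, IsCoprime x (m : ℤ) → IsCoprime β (x : 𝓞 F) := by
    intro x hx
    have := hx.symm.map (Int.castRingHom (𝓞 F))
    simp only [map_natCast, eq_intCast, Int.cast_natCast] at this
    exact this.of_isCoprime_of_dvd_left hB.nice.dvd_m
  have hXY' : β ∣ (X : 𝓞 F) ^ 2 + Y ^ 2 - 2 * a := by
    have := (hB.nice.dvd_iff _).2 hXY
    push_cast at this
    have := dvd_sub this (hr.mul_left 2)
    convert this using 1; ring
  obtain ⟨z, hz⟩ := inv_of_cop (toβ Y hY)
  have cz : IsCoprime β z := cop_of_inv (y := (Y : 𝓞 F)) (by rwa [mul_comm])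
  have cai : IsCoprime β ai := cop_of_inv (y := a) (by rwa [mul_comm])
  have := R2 hc hf hB (r := a) (r' := a) (ρ' := ai) (s0 := X * z * ai) (z0 := z) har hai
    (((toβ X hX).mul_right cz).mul_right cai) cz (by
      -- a X²z²ai² + ai - 2 z²
      obtain ⟨c1, e1⟩ := hai
      obtain ⟨c2, e2⟩ := hz
      obtain ⟨c3, e3⟩ := hXY'
      refine ⟨ai * z ^ 2 * c3 + c1 * X ^ 2 * z ^ 2 * ai + 2 * z ^ 2 * c1 - ai * c2 * (Y * z + 1), ?_⟩
      linear_combination ai * z ^ 2 * e3 + (X ^ 2 * z ^ 2 * ai + 2 * z ^ 2) * e1 - ai * (Y * z + 1) * e2)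
  rw [← pow_two, hsq a ai hai, ← two_nsmul] at this
  exact hc.hp 2 hp2.symm _ this

theorem partC (htot : ∀ v : InfinitePlace F, v.IsReal)
    (hη : ∃ ε : (𝓞 F)ˣ, ∀ k : ℕ, 0 < k → ε ^ k ≠ 1) (p : ℕ) (hp0 : 0 < p) (hp2 : p.Coprime 2)
    (hA : ∀ k : ℕ, k.Coprime p → ∀ x : A, k • x = 0 → x = 0) (N : ℕ) (hN : 0 < N)
    (f : SL (𝓞 F) → A) (hf : AddOn (Gm (N : 𝓞 F)) f) :
    ∃ R : ℕ, 0 < R ∧ ∀ γ ∈ Gm (R : 𝓞 F), f γ = 0 := by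
  obtain ⟨N0, hN0, -, hg⟩ := exists_good (A := A) hη N hN
  have hf0 := (hg f hf).mono (M := ((30 * N0 : ℕ) : 𝓞 F)) (by push_cast; exact Dvd.intro_left _ rfl)
  generalize hN1 : 30 * N0 = N1 at hf0
  have hN1p : 0 < N1 := by omega
  obtain ⟨Nn, hNn1, hQN, hsm, hspec⟩ := exists_special htot (N1 ^ 3 * (4 * p)) (by positivity) ⟨N1 ^ 3 * p, by ring⟩
  have hc : Ctx A F p N1 (N1 ^ 3 * (4 * p)) Nn := ⟨htot, hη, hA, ⟨N1 ^ 3 * 4, by ring⟩, hN1p, ⟨N0, hN1.symm⟩,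
    Dvd.intro _ rfl, hNn1, hQN, hsm, hspec⟩
  refine ⟨N1 * Nn, by positivity, fun γ hγ => ?_⟩
  have cN : (N1 : 𝓞 F) ∣ ((N1 * Nn : ℕ) : 𝓞 F) := by push_cast; exact Dvd.intro _ rfl
  have cNn : (Nn : 𝓞 F) ∣ ((N1 * Nn : ℕ) : 𝓞 F) := by push_cast; exact Dvd.intro_left _ rfl
  have hγ0 := Gm_mono cN hγ
  rw [← hf0.row hγ0 rfl rfl]
  have hadm := Adm.of_mem hγ0
  obtain ⟨b0, hb0⟩ := hγ.2.1
  push_cast at hb0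
  have haN : (Nn : 𝓞 F) ∣ ea γ - 1 := cNn.trans hγ.1
  have hcb : IsCoprime (ea γ) (Nn * b0 : 𝓞 F) :=
    hadm.cop.of_isCoprime_of_dvd_right ⟨N1, by rw [hb0]; ring⟩
  obtain ⟨β, m, hs1, hs2, hs⟩ := nice_exists Nn hNn1 hsm (ea γ) (Nn * b0)
    (ne_zero_of_cong hNn1 haN) hcb (cop_of_cong haN)
  obtain ⟨hadm1, hr1⟩ := hf0.row_b hadm (b' := N1 * β) (Dvd.intro _ rfl) (by
    obtain ⟨c, hc⟩ := hs1
    exact ⟨N1 * c, by rw [hb0]; linear_combination N1 * hc⟩)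
  rw [← hr1]
  have hcs : IsCoprime (ea γ) β := hadm1.cop.of_isCoprime_of_dvd_right (Dvd.intro_left _ rfl)
  obtain ⟨e, he⟩ := inv_of_cop (β := β) (x := (N1 : 𝓞 F) ^ 3) (hc.copN hs).pow_right
  have hB : BB N1 Nn β e m := ⟨hs, hs2, he⟩
  rw [← one_mul ((N1 : 𝓞 F) * β), ← mul_assoc, psi_eq hc hf0 hB (one_dvd _) (hc.N3.trans haN) (by simp) hcs.symm]
  exact Psi_zero hc hp2 hf0 hB hcs.symm
end PD
end PartC4

section PartP2
open NumberField
namespace PD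
variable {F : Type*} [Field F] [NumberField F] {A : Type*} [AddCommGroup A]

lemma mem_Del1 {n : Ideal (𝓞 F)} {γ : SL (𝓞 F)} : γ ∈ Del 1 n ↔ ea γ - 1 ∈ n ∧ ec γ ∈ n := by
  rw [mem_Del, Ideal.span_singleton_one, Ideal.top_mul]
  simp

theorem partII (htot : ∀ v : InfinitePlace F, v.IsReal)
    (hη : ∃ ε : (𝓞 F)ˣ, ∀ k : ℕ, 0 < k → ε ^ k ≠ 1) (n : Ideal (𝓞 F)) (hn : n ≠ ⊥)
    (p : ℕ) (hp : p.Prime) (h6 : ¬ p ∣ 6) (hcop : Ideal.span {(p : 𝓞 F)} ⊔ n = ⊤)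
    (hA : ∀ k : ℕ, k.Coprime p → ∀ x : A, k • x = 0 → x = 0)
    (f : SL (𝓞 F) → A) (hf : AddOn (Del 1 n) f) : ∀ γ ∈ Del 1 n, f γ = 0 := by
  have hp2 : p.Coprime 2 := by
    rw [hp.coprime_iff_not_dvd]; exact fun h => h6 (h.trans (by norm_num))
  have hp3 : p.Coprime 3 := by
    rw [hp.coprime_iff_not_dvd]; exact fun h => h6 (h.trans (by norm_num))
  obtain ⟨N, hN0, hNn⟩ : ∃ N : ℕ, 0 < N ∧ (N : 𝓞 F) ∈ n :=
    ⟨Ideal.absNorm n, Nat.pos_of_ne_zero (by rwa [Ne, Ideal.absNorm_eq_zero_iff]), Ideal.absNorm_mem n⟩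
  have dmem : ∀ {x : 𝓞 F} {M : ℕ}, (M : 𝓞 F) ∈ n → (M : 𝓞 F) ∣ x → x ∈ n := by
    rintro x M h ⟨c, rfl⟩; exact Ideal.mul_mem_right _ _ h
  have hle : Gm (N : 𝓞 F) ≤ Del 1 n := fun γ h => mem_Del1.2 ⟨dmem hNn h.1, dmem hNn h.2.2.1⟩
  obtain ⟨R0, hR0, hfR0⟩ := partC htot hη p hp.pos hp2 hA N hN0 f (hf.mono hle)
  obtain ⟨e, R2, hR2p, hR⟩ := Nat.exists_eq_pow_mul_and_not_dvd (n := R0 * N) (by positivity) p hp.ne_one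
  have hRp : 0 < R0 * N := by positivity
  have hfR : ∀ γ ∈ Gm ((R0 * N : ℕ) : 𝓞 F), f γ = 0 := fun γ h =>
    hfR0 γ (Gm_mono (by push_cast; exact Dvd.intro _ rfl) h)
  have hRn : ((R0 * N : ℕ) : 𝓞 F) ∈ n := dmem hNn (by push_cast; exact Dvd.intro_left _ rfl)
  generalize hRdef : R0 * N = R at *
  clear hRdef
  have hcR : (p ^ e).Coprime R2 := Nat.Coprime.pow_left _ (hp.coprime_iff_not_dvd.2 hR2p)
  have hR2n : (R2 : 𝓞 F) ∈ n := by
    have h1 : IsCoprime (Ideal.span {(p : 𝓞 F)}) n := Ideal.isCoprime_iff_sup_eq.2 hcop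
    have h2 : IsCoprime (Ideal.span {(p : 𝓞 F)} ^ e) n := h1.pow_left
    rw [Ideal.span_singleton_pow] at h2
    obtain ⟨x, hx, y, hy, hxy⟩ := Ideal.isCoprime_iff_exists.1 h2
    obtain ⟨z, rfl⟩ := Ideal.mem_span_singleton.1 hx
    have : (R2 : 𝓞 F) = z * (R : 𝓞 F) + y * R2 := by
      rw [hR]; push_cast; linear_combination -(R2 : 𝓞 F) * hxy
    rw [this]
    exact add_mem (Ideal.mul_mem_left _ _ hRn) (Ideal.mul_mem_right _ _ hy)
  obtain ⟨a, ha1, ha2⟩ := Nat.chineseRemainder hcR 2 1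
  have hap : ((p ^ e : ℕ) : ℤ) ∣ (a : ℤ) - 2 := ha1.symm.dvd
  have haR2 : ((R2 : ℕ) : ℤ) ∣ (a : ℤ) - 1 := ha2.symm.dvd
  have haR : IsCoprime (a : ℤ) (R : ℤ) := by
    rw [hR]; push_cast
    refine IsCoprime.mul_right ?_ ?_
    · by_cases he : e = 0
      · subst he; simpa using isCoprime_one_right
      obtain ⟨c, hc⟩ := hap
      have : (a : ℤ) = 2 + (p : ℤ) ^ e * c := by push_cast at hc; linear_combination hc
      rw [this]
      refine IsCoprime.add_mul_left_left ?_ _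
      have := (Nat.isCoprime_iff_coprime.2 hp2).symm.pow_right (n := e)
      exact_mod_cast this
    · obtain ⟨c, hc⟩ := haR2
      have : (a : ℤ) = 1 + R2 * c := by linear_combination hc
      rw [this]; exact IsCoprime.add_mul_left_left isCoprime_one_left _
  obtain ⟨d, k, hdk⟩ : ∃ d k : ℤ, a * d - R * (R * k) = 1 := by
    obtain ⟨u, v, h⟩ := haR.pow_right (n := 2)
    exact ⟨u, -v, by linear_combination h⟩
  have cast : ∀ {x y : ℤ}, x ∣ y → (x : 𝓞 F) ∣ (y : 𝓞 F) := fun h => (Int.castRingHom (𝓞 F)).map_dvd h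
  have hap' : (p : 𝓞 F) ^ e ∣ (a : 𝓞 F) - 2 := by have := cast hap; push_cast at this; exact this
  have haR2' : (R2 : 𝓞 F) ∣ (a : 𝓞 F) - 1 := by have := cast haR2; push_cast at this; exact this
  have hdet : (a : 𝓞 F) * (d : 𝓞 F) - (R : 𝓞 F) * ((R : 𝓞 F) * (k : 𝓞 F)) = 1 := by
    have := congrArg (Int.castRingHom (𝓞 F)) hdk
    simpa using this
  have hR' : (R : 𝓞 F) = (p : 𝓞 F) ^ e * R2 := by rw [hR]; push_cast; ring
  set t : SL (𝓞 F) := mk2 (a : 𝓞 F) R (R * k) d hdet with ht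
  have htm : t ∈ Del 1 n := mem_Del1.2 ⟨dmem hR2n haR2', Ideal.mul_mem_right _ _ hRn⟩
  have h4 : ∀ y : 𝓞 F, (R : 𝓞 F) ∣ ((a : 𝓞 F) ^ 2 - 4) * (R2 * y) := by
    intro y
    obtain ⟨c, hc⟩ := hap'
    rw [hR']; exact ⟨c * (a + 2) * y, by linear_combination (a + 2) * R2 * y * hc⟩
  have hRle : Gm (R : 𝓞 F) ≤ Del 1 n := fun γ h => mem_Del1.2 ⟨dmem hRn h.1, dmem hRn h.2.2.1⟩
  have hum : ∀ y : 𝓞 F, uu y ∈ Del 1 n := fun y => mem_Del1.2 (by simp)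
  have hlm : ∀ y ∈ n, ll y ∈ Del 1 n := fun y hy => mem_Del1.2 (by simpa using hy)
  have hR2c : R2.Coprime p := ((hp.coprime_iff_not_dvd).2 hR2p).symm
  have pu : ∀ (j : ℕ) (y : 𝓞 F), uu (j * y) = uu y ^ j := by
    intro j y
    induction j with
    | zero => apply ext4 <;> simp
    | succ j ih => rw [pow_succ, ← ih, ← uu_add]; congr 1; push_cast; ring
  have pl : ∀ (j : ℕ) (y : 𝓞 F), ll (j * y) = ll y ^ j := by
    intro j y
    induction j with
    | zero => apply ext4 <;> simp
    | succ j ih => rw [pow_succ, ← ih, ← ll_add]; congr 1; push_cast; ring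
  have fin : ∀ z : A, R2 • z = 4 • (R2 • z) → z = 0 := by
    intro z hz
    apply hA R2 hR2c
    apply hA 3 hp3.symm
    have : 4 • (R2 • z) = 3 • (R2 • z) + R2 • z := by rw [← succ_nsmul]
    rw [this] at hz
    simpa using hz
  have hu : ∀ y : 𝓞 F, f (uu y) = 0 := by
    intro y
    apply fin
    rw [← hf.pow (hum y), ← pu]
    have e1 : t * uu (R2 * y) * t⁻¹ = (t * uu (R2 * y) * t⁻¹ * (uu ((4 : ℕ) * (R2 * y)))⁻¹) * uu ((4 : ℕ) * (R2 * y)) := by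
      group
    have m1 : t * uu (R2 * y) * t⁻¹ * (uu ((4 : ℕ) * (R2 * y)))⁻¹ ∈ Gm (R : 𝓞 F) := by
      apply mem_Gm'
      · simp [ht]
        exact ⟨-(a * k * R2 * y), by linear_combination hdet⟩
      · simp [ht]
        have := dvd_add (h4 y) (Dvd.intro ((a : 𝓞 F) * k * 4 * (R2 * y) ^ 2) rfl : (R : 𝓞 F) ∣ R * (a * k * 4 * (R2 * y) ^ 2))
        convert this using 1
        linear_combination (-4 * R2 * y) * hdet
      · simp [ht]
        exact ⟨-(R * k * k * R2 * y), by ring⟩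
    have h := hf.conj htm (hum (R2 * y))
    rw [e1, hf _ (hRle m1) _ (hum _), hfR _ m1, zero_add, pu 4, hf.pow (hum _)] at h
    exact h.symm
  have hl : ∀ y ∈ n, f (ll y) = 0 := by
    intro y hy
    have hy' : (R2 : 𝓞 F) * y ∈ n := Ideal.mul_mem_left _ _ hy
    have hy4 : ((4 : ℕ) : 𝓞 F) * (R2 * y) ∈ n := Ideal.mul_mem_left _ _ hy'
    apply fin
    rw [← hf.pow (hlm y hy), ← pl]
    have e1 : t⁻¹ * ll (R2 * y) * t⁻¹⁻¹ = (t⁻¹ * ll (R2 * y) * t⁻¹⁻¹ * (ll ((4 : ℕ) * (R2 * y)))⁻¹) * ll ((4 : ℕ) * (R2 * y)) := by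
      group
    have m1 : t⁻¹ * ll (R2 * y) * t⁻¹⁻¹ * (ll ((4 : ℕ) * (R2 * y)))⁻¹ ∈ Gm (R : 𝓞 F) := by
      apply mem_Gm'
      · simp [ht]
        exact ⟨-(a * R2 * y) + R * R2 * y * 4 * R2 * y, by linear_combination hdet⟩
      · simp [ht]
        exact ⟨-(R * R2 * y), by ring⟩
      · simp [ht]
        have := dvd_sub (h4 y) (Dvd.intro ((a : 𝓞 F) * 4 * (R2 * y) ^ 2) rfl : (R : 𝓞 F) ∣ R * (a * 4 * (R2 * y) ^ 2))
        convert this using 1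
        linear_combination (-4 * R2 * y) * hdet
    have h := hf.conj (inv_mem htm) (hlm _ hy')
    rw [e1, hf _ (hRle m1) _ (hlm _ hy4), hfR _ m1, zero_add, pl 4, hf.pow (hlm _ hy')] at h
    exact h.symm
  refine lemL 1 n (R : 𝓞 F) (by exact_mod_cast hRp.ne') f hf (fun y => hu _) hl (fun γ h _ => hfR γ h)
end PD
end PartP2

section PartP3
open NumberField
namespace PD
variable {F : Type*} [Field F] [NumberField F]

lemma exists_unit (htot : ∀ v : InfinitePlace F, v.IsReal) (hd : 2 ≤ Module.finrank ℚ F) :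
    ∃ ε : (𝓞 F)ˣ, ∀ k : ℕ, 0 < k → ε ^ k ≠ 1 := by
  have h0 : InfinitePlace.nrComplexPlaces F = 0 :=
    nrComplexPlaces_eq_zero_iff.2 ⟨fun v => htot v⟩
  have h1 := InfinitePlace.card_add_two_mul_card_eq_rank F
  have h2 := InfinitePlace.card_eq_nrRealPlaces_add_nrComplexPlaces F
  have h3 : 0 < Units.rank F := by rw [Units.rank]; omega
  refine ⟨Units.fundSystem F ⟨0, h3⟩, fun k hk h => ?_⟩
  have h4 : Units.fundSystem F ⟨0, h3⟩ ∈ Units.torsion F :=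
    isOfFinOrder_iff_pow_eq_one.2 ⟨k, hk, h⟩
  obtain ⟨e, -, he⟩ := Units.exist_unique_eq_mul_prod F (Units.fundSystem F ⟨0, h3⟩)
  have e1 := he (⟨_, h4⟩, 0) (by simp)
  have e2 := he (1, Pi.single ⟨0, h3⟩ 1) (by
    simp only [OneMemClass.coe_one, one_mul]
    rw [Finset.prod_eq_single ⟨0, h3⟩]
    · simp
    · intro b _ hb; simp [Pi.single_eq_of_ne hb]
    · simp)
  have e3 := congrFun (congrArg Prod.snd (e1.trans e2.symm)) ⟨0, h3⟩
  simp at e3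

/-- elements of order prime to p -/
def Tp (B : Type*) [CommGroup B] (p : ℕ) : Subgroup B where
  carrier := {x | ∃ k : ℕ, k.Coprime p ∧ x ^ k = 1}
  one_mem' := ⟨1, by simp, by simp⟩
  mul_mem' := by
    rintro x y ⟨k, hk, hx⟩ ⟨l, hl, hy⟩
    refine ⟨k * l, Nat.Coprime.mul_left hk hl, ?_⟩
    rw [mul_pow, pow_mul, hx, mul_comm k, pow_mul, hy]; simp
  inv_mem' := by
    rintro x ⟨k, hk, hx⟩
    exact ⟨k, hk, by simp [hx]⟩

lemma Tp_spec (B : Type*) [CommGroup B] (p : ℕ) : ∀ k : ℕ, k.Coprime p →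
    ∀ x : Additive (B ⧸ Tp B p), k • x = 0 → x = 0 := by
  intro k hk x hx
  induction x using Additive.rec with | _ x =>
  induction x using QuotientGroup.induction_on with | H x =>
  have h1 : ((x ^ k : B) : B ⧸ Tp B p) = 1 := hx
  rw [QuotientGroup.eq_one_iff] at h1
  obtain ⟨l, hl, h⟩ := h1
  have h2 : (x : B ⧸ Tp B p) = 1 := by
    rw [QuotientGroup.eq_one_iff]
    exact ⟨k * l, Nat.Coprime.mul_left hk hl, by rw [pow_mul, h]⟩
  exact h2

noncomputable def toG (F : Type*) [Field F] [NumberField F] : SL (𝓞 F) →* (Matrix (Fin 2) (Fin 2) F)ˣ :=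
  Matrix.SpecialLinearGroup.toGL.comp (toF F)

lemma toG_val (γ : SL (𝓞 F)) : (toG F γ).val = !![algebraMap (𝓞 F) F (ea γ), algebraMap (𝓞 F) F (eb γ);
    algebraMap (𝓞 F) F (ec γ), algebraMap (𝓞 F) F (ed γ)] := by
  ext i j; fin_cases i <;> fin_cases j <;> rfl

theorem final_ge2 
    (htot : ∀ v : InfinitePlace F, v.IsReal) (hη : ∃ ε : (𝓞 F)ˣ, ∀ k : ℕ, 0 < k → ε ^ k ≠ 1)
    (n : Ideal (𝓞 F)) (hn : n ≠ ⊥)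
    (Γ Z : Subgroup (Matrix (Fin 2) (Fin 2) F)ˣ)
    (hΓ : ∀ A : (Matrix (Fin 2) (Fin 2) F)ˣ, A ∈ Γ ↔
      ∃ a b c d : 𝓞 F,
        A.val = !![algebraMap (𝓞 F) F a, algebraMap (𝓞 F) F b;
                   algebraMap (𝓞 F) F c, algebraMap (𝓞 F) F d] ∧
        c ∈ n ∧ d - 1 ∈ n ∧
        ∃ u : (𝓞 F)ˣ, (u : 𝓞 F) = a * d - b * c ∧
          ∀ φ : F →+* ℝ, 0 < φ (algebraMap (𝓞 F) F (u : 𝓞 F)))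
    (hZ : ∀ A : (Matrix (Fin 2) (Fin 2) F)ˣ, A ∈ Z ↔
      A ∈ Γ ∧ ∃ x : F, A.val = x • (1 : Matrix (Fin 2) (Fin 2) F))
    [hnorm : (Z.subgroupOf Γ).Normal]
    (Upos Usq : Subgroup (𝓞 F)ˣ)
    (hUpos : ∀ u : (𝓞 F)ˣ, u ∈ Upos ↔
      ∀ φ : F →+* ℝ, 0 < φ (algebraMap (𝓞 F) F (u : 𝓞 F)))
    (hUsq : ∀ u : (𝓞 F)ˣ, u ∈ Usq ↔ ∃ v : (𝓞 F)ˣ, ((v : 𝓞 F) - 1 ∈ n) ∧ u = v ^ 2)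
    (p : ℕ) (hp : p.Prime)
    (h6 : ¬ (p ∣ 6))
    (hcopn : Ideal.span {(p : 𝓞 F)} ⊔ n = ⊤)
    (hcard : ¬ p ∣ Nat.card (Upos ⧸ Usq.subgroupOf Upos)) :
    ∀ x : Abelianization (Γ ⧸ Z.subgroupOf Γ), x ^ p = 1 → x = 1 := by
  classical
  set B := Abelianization (Γ ⧸ Z.subgroupOf Γ)
  let q0 : Γ →* B := (Abelianization.of).comp (QuotientGroup.mk' (Z.subgroupOf Γ))
  have hq0s : Function.Surjective q0 := by
    intro x
    induction x using QuotientGroup.induction_on with | H x =>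
    induction x using QuotientGroup.induction_on with | H x =>
    exact ⟨x, rfl⟩
  let q : Γ →* B ⧸ Tp B p := (QuotientGroup.mk' (Tp B p)).comp q0
  have hT := Tp_spec B p
  have hmem : ∀ γ ∈ Del 1 n, toG F γ ∈ Γ := by
    intro γ hγ
    obtain ⟨h1, h2⟩ := mem_Del1.1 hγ
    refine (hΓ _).2 ⟨_, _, _, _, toG_val γ, h2, ?_, 1, by rw [edet]; rfl, by simp⟩
    have : ed γ - 1 = eb γ * ec γ - ed γ * (ea γ - 1) := by linear_combination edet γ
    rw [this]; exact sub_mem (Ideal.mul_mem_left _ _ h2) (Ideal.mul_mem_left _ _ h1)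
  let f : SL (𝓞 F) → Additive (B ⧸ Tp B p) := fun γ =>
    if h : γ ∈ Del 1 n then Additive.ofMul (q ⟨toG F γ, hmem γ h⟩) else 0
  have hf : AddOn (Del 1 n) f := by
    intro x hx y hy
    simp only [f, dif_pos hx, dif_pos hy, dif_pos (mul_mem hx hy)]
    rw [← ofMul_mul, ← map_mul]
    congr 2
    ext1
    simp
  have hf0 := partII htot hη n hn p hp h6 hcopn hT f hf
  have hk0 : Nat.card (Upos ⧸ Usq.subgroupOf Upos) ≠ 0 := fun h => hcard (by rw [h]; exact dvd_zero _)
  set k := Nat.card (Upos ⧸ Usq.subgroupOf Upos)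
  have hq : ∀ γ : Γ, q γ = 1 := by
    intro γ
    have hk : k.Coprime p := ((hp.coprime_iff_not_dvd).2 hcard).symm
    have key : q (γ ^ k) = 1 := by
      obtain ⟨a0, b0, c0, d0, hv0, -, -, u0, hu0, hupos⟩ := (hΓ _).1 γ.2
      obtain ⟨a, b, c, d, hv, hcn, hdn, u, hu, -⟩ := (hΓ _).1 (γ ^ k).2
      have hdet : (algebraMap (𝓞 F) F) (u : 𝓞 F) = (algebraMap (𝓞 F) F) ((u0 ^ k : (𝓞 F)ˣ) : 𝓞 F) := by
        have h1 : (γ ^ k : Γ).1.val.det = (γ.1.val.det) ^ k := by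
          rw [← Matrix.det_pow]; simp
        rw [hv, hv0, Matrix.det_fin_two_of, Matrix.det_fin_two_of] at h1
        rw [Units.val_pow_eq_pow_val, map_pow, hu, hu0]
        simpa only [map_sub, map_mul] using h1
      have huk : u = u0 ^ k := by ext1; exact RingOfIntegers.coe_injective hdet
      have hu0p : u0 ∈ Upos := (hUpos _).2 hupos
      have hsq : u0 ^ k ∈ Usq := by
        have h1 : ((⟨u0, hu0p⟩ : Upos) : Upos ⧸ Usq.subgroupOf Upos) ^ k = 1 := pow_card_eq_one'
        have h2 : (((⟨u0, hu0p⟩ : Upos) ^ k : Upos) : Upos ⧸ Usq.subgroupOf Upos) = 1 := h1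
        rw [QuotientGroup.eq_one_iff] at h2
        exact h2
      obtain ⟨v, hvn, hv2⟩ := (hUsq _).1 hsq
      rw [← huk] at hv2
      have hvi : ((v⁻¹ : (𝓞 F)ˣ) : 𝓞 F) - 1 ∈ n := by
        have : ((v⁻¹ : (𝓞 F)ˣ) : 𝓞 F) - 1 = -((v⁻¹ : (𝓞 F)ˣ) : 𝓞 F) * ((v : 𝓞 F) - 1) := by
          linear_combination v.inv_mul
        rw [this]; exact Ideal.mul_mem_left _ _ hvn
      obtain ⟨w, hw⟩ : ∃ w : 𝓞 F, w = ((v⁻¹ : (𝓞 F)ˣ) : 𝓞 F) := ⟨_, rfl⟩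
      have hvw : (v : 𝓞 F) * w = 1 := by rw [hw]; simp
      rw [← hw] at hvi
      have hdet1 : (a * w) * (d * w) - (b * w) * (c * w) = 1 := by
        have h3 : (v : 𝓞 F) ^ 2 = a * d - b * c := by rw [← hu, hv2]; simp
        linear_combination (-w ^ 2) * h3 + (v * w + 1) * hvw
      have hdw : d * w - 1 ∈ n := by
        have : d * w - 1 = (d - 1) * w + (w - 1) := by ring
        rw [this]; exact add_mem (Ideal.mul_mem_right _ _ hdn) hvi
      have hcw : c * w ∈ n := Ideal.mul_mem_right _ _ hcn
      have hδ : mk2 (a * w) (b * w) (c * w) (d * w) hdet1 ∈ Del 1 n := by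
        refine mem_Del1.2 ⟨?_, hcw⟩
        simp only [ea_mk]
        have : a * w - 1 = (b * w) * (c * w) - (a * w) * (d * w - 1) := by linear_combination hdet1
        rw [this]; exact sub_mem (Ideal.mul_mem_left _ _ hcw) (Ideal.mul_mem_left _ _ hdw)
      have h0 := hf0 _ hδ
      simp only [f, dif_pos hδ] at h0
      have h0' : q ⟨toG F _, hmem _ hδ⟩ = 1 := h0
      -- scalar
      set v' : Fˣ := Units.map (algebraMap (𝓞 F) F).toMonoidHom v with hv'
      have hvF : (v' : F) = algebraMap (𝓞 F) F v := rfl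
      let s : (Matrix (Fin 2) (Fin 2) F)ˣ := Units.map (algebraMap F (Matrix (Fin 2) (Fin 2) F)).toMonoidHom v'
      have hsval : s.val = !![algebraMap (𝓞 F) F v, 0; 0, algebraMap (𝓞 F) F v] := by
        have : s.val = algebraMap F (Matrix (Fin 2) (Fin 2) F) (v' : F) := rfl
        rw [this, hvF, Matrix.algebraMap_eq_diagonal]
        ext i j; fin_cases i <;> fin_cases j <;> simp
      have hsΓ : s ∈ Γ := by
        refine (hΓ _).2 ⟨v, 0, 0, v, by rw [hsval]; simp, zero_mem _, hvn, v ^ 2, by simp [pow_two], ?_⟩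
        intro φ
        rw [Units.val_pow_eq_pow_val, map_pow, map_pow]
        have : φ (algebraMap (𝓞 F) F (v : 𝓞 F)) ≠ 0 := by
          rw [← hvF]; simp
        positivity
      have hsZ : s ∈ Z := (hZ _).2 ⟨hsΓ, algebraMap (𝓞 F) F v, by
        rw [hsval]; ext i j; fin_cases i <;> fin_cases j <;> simp⟩
      have hqs : q ⟨s, hsΓ⟩ = 1 := by
        have : (QuotientGroup.mk' (Z.subgroupOf Γ)) ⟨s, hsΓ⟩ = 1 :=
          (QuotientGroup.eq_one_iff _).2 hsZ
        simp only [q, q0, MonoidHom.comp_apply, this, map_one]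
      have hprod : γ ^ k = ⟨s, hsΓ⟩ * ⟨toG F _, hmem _ hδ⟩ := by
        ext1
        ext1
        rw [hv, Subgroup.coe_mul, Units.val_mul, hsval, toG_val, Matrix.mul_fin_two]
        have e : ∀ x : 𝓞 F, algebraMap (𝓞 F) F x = algebraMap (𝓞 F) F v * algebraMap (𝓞 F) F (x * w) := by
          intro x
          rw [← map_mul]
          congr 1
          linear_combination (-x) * hvw
        simp only [ea_mk, eb_mk, ec_mk, ed_mk, zero_mul, add_zero, zero_add, ← e]
      rw [hprod, map_mul, hqs, h0', one_mul]
    rw [map_pow] at key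
    exact hT k hk (Additive.ofMul (q γ)) key
  intro x hx
  obtain ⟨γ, rfl⟩ := hq0s x
  have h1 : q0 γ ∈ Tp B p := (QuotientGroup.eq_one_iff _).1 (hq γ)
  obtain ⟨l, hl, h2⟩ := h1
  have h3 : orderOf (q0 γ) ∣ 1 := by
    rw [← Nat.Coprime.gcd_eq_one hl]
    exact Nat.dvd_gcd (orderOf_dvd_of_pow_eq_one h2) (orderOf_dvd_of_pow_eq_one hx)
  exact orderOf_eq_one_iff.1 (Nat.dvd_one.1 h3)
end PD
end PartP3

section PartQ1
open NumberField
namespace PD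

section Qcore
variable {G : Type*} [Group G] (Γ0 : Subgroup G)

noncomputable def tz (x : G ⧸ Γ0) : G := Quotient.out x

lemma tz_mk (x : G ⧸ Γ0) : ((tz Γ0 x : G) : G ⧸ Γ0) = x := QuotientGroup.out_eq' x

lemma tz_mem (g : G) (x : G ⧸ Γ0) : (tz Γ0 (g • x))⁻¹ * (g * tz Γ0 x) ∈ Γ0 := by
  rw [← QuotientGroup.eq, tz_mk]
  conv_lhs => rw [← tz_mk Γ0 x]
  rfl

variable {B : Type*} [CommGroup B] (f : Γ0 →* B)

noncomputable def Fc (g : G) (x : G ⧸ Γ0) : Additive B := Additive.ofMul (f ⟨_, tz_mem Γ0 g x⟩)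

lemma Fc_mul (g h : G) (x : G ⧸ Γ0) : Fc Γ0 f (g * h) x = Fc Γ0 f g (h • x) + Fc Γ0 f h x := by
  unfold Fc
  rw [← ofMul_mul, ← map_mul]
  congr 2
  ext1
  simp only [Subgroup.coe_mul, mul_smul]
  group

lemma Fc_one (x : G ⧸ Γ0) : Fc Γ0 f 1 x = 0 := by
  have := Fc_mul Γ0 f 1 1 x
  simpa using this

lemma Fc_base (γ : Γ0) : Fc Γ0 f γ ((1 : G) : G ⧸ Γ0) = Additive.ofMul (f γ) := by
  have h1 : (γ : G) • ((1 : G) : G ⧸ Γ0) = ((1 : G) : G ⧸ Γ0) := by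
    change (((γ : G) * 1 : G) : G ⧸ Γ0) = _
    rw [mul_one, eq_comm, QuotientGroup.eq]
    simp
  have h2 : tz Γ0 ((1 : G) : G ⧸ Γ0) ∈ Γ0 := by
    have := (QuotientGroup.eq (s := Γ0)).1 (tz_mk Γ0 ((1 : G) : G ⧸ Γ0)).symm
    simpa using this
  unfold Fc
  have : (⟨_, tz_mem Γ0 γ ((1 : G) : G ⧸ Γ0)⟩ : Γ0) = (⟨_, h2⟩ : Γ0)⁻¹ * (γ * ⟨_, h2⟩) := by
    ext1
    simp only [Subgroup.coe_mul, Subgroup.coe_inv, h1]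
  rw [this, map_mul f, map_mul f, map_inv f, mul_comm (f γ), inv_mul_cancel_left]

noncomputable def perS (S : G) (hS : S * S = 1) : Equiv.Perm ((G ⧸ Γ0) × ((G ⧸ Γ0) →₀ ℤ)) :=
  Function.Involutive.toPerm
    (fun q => (S • q.1, q.2 + Finsupp.single (S • q.1) 1 - Finsupp.single q.1 1)) (by
      rintro ⟨x, v⟩
      have : S • S • x = x := by rw [smul_smul, hS, one_smul]
      simp only [this]
      ext1
      · rfl
      · simp only; abel)

noncomputable def perU (U : G) : Equiv.Perm ((G ⧸ Γ0) × ((G ⧸ Γ0) →₀ ℤ)) :=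
  (MulAction.toPerm U).prodCongr (Equiv.refl _)

theorem Qcore {G : Type} [Group G] (S U : G) (hS : S * S = 1) (hU : U * U * U = 1)
    (hgen : Subgroup.closure {S, U} = ⊤)
    (huniv : ∀ (H : Type) [Group H] (s u : H), s * s = 1 → u * u * u = 1 →
      ∃ φ : G →* H, φ S = s ∧ φ U = u) (Γ0 : Subgroup G) :
    ∃ θ : Γ0 →* Multiplicative ((G ⧸ Γ0) →₀ ℤ), ∀ (B : Type*) [CommGroup B] (f : Γ0 →* B) (γ : Γ0),
      θ γ = 1 → f γ ^ 6 = 1 := by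
  classical
  obtain ⟨φ, hφS, hφU⟩ := huniv _ (perS Γ0 S hS) (perU Γ0 U)
    (by
      ext1 q
      exact (Function.Involutive.toPerm_involutive _) q)
    (by
      ext1 ⟨x, v⟩
      change (U • U • U • x, v) = (x, v)
      rw [smul_smul, smul_smul, hU, one_smul])
  have hmem : ∀ P : G → Prop, P S → P U → P 1 → (∀ g h, P g → P h → P (g * h)) →
      (∀ g, P g → P g⁻¹) → ∀ g, P g := by
    intro P h1 h2 h3 h4 h5 g
    have hg : g ∈ Subgroup.closure {S, U} := by rw [hgen]; trivial
    induction hg using Subgroup.closure_induction with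
    | mem x hx =>
      rcases hx with rfl | hx
      · exact h1
      · rw [Set.mem_singleton_iff.1 hx]; exact h2
    | one => exact h3
    | mul x y _ _ hx hy => exact h4 x y hx hy
    | inv x _ hx => exact h5 x hx
  let t : G → (G ⧸ Γ0) → ((G ⧸ Γ0) →₀ ℤ) := fun g x => (φ g (x, 0)).2
  have hφ : ∀ g, ∀ x v, φ g (x, v) = (g • x, v + t g x) := by
    refine hmem _ ?_ ?_ ?_ ?_ ?_
    · intro x v
      simp only [t, hφS]
      change (S • x, v + Finsupp.single (S • x) 1 - Finsupp.single x 1) = 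
        (S • x, v + (0 + Finsupp.single (S • x) 1 - Finsupp.single x 1))
      congr 1; abel
    · intro x v
      simp only [t, hφU]
      change (U • x, v) = (U • x, v + 0)
      rw [add_zero]
    · intro x v
      simp [t]
    · intro g h hg hh x v
      have : t (g * h) x = t h x + t g (h • x) := by
        change (φ (g * h) (x, 0)).2 = _
        rw [map_mul, Equiv.Perm.mul_apply, hh, hg, zero_add]
      rw [map_mul, Equiv.Perm.mul_apply, hh, hg, this, mul_smul, add_assoc]
    · intro g hg x v
      have key : ∀ w, φ g⁻¹ (x, w) = (g⁻¹ • x, w - t g (g⁻¹ • x)) := by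
        intro w
        rw [map_inv, Equiv.Perm.inv_eq_iff_eq, hg]
        simp
      have : t g⁻¹ x = - t g (g⁻¹ • x) := by
        change (φ g⁻¹ (x, 0)).2 = _
        rw [key]; simp
      rw [key, this, sub_eq_add_neg]
  have tmul : ∀ g h x, t (g * h) x = t g (h • x) + t h x := by
    intro g h x
    change (φ (g * h) (x, 0)).2 = _
    rw [map_mul, Equiv.Perm.mul_apply, hφ, hφ, zero_add, add_comm]
  have t1 : ∀ x, t 1 x = 0 := by intro x; simp [t]
  have tS : ∀ x, t S x = Finsupp.single (S • x) 1 - Finsupp.single x 1 := by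
    intro x
    simp only [t, hφS]
    change 0 + Finsupp.single (S • x) 1 - Finsupp.single x 1 = _
    rw [zero_add]
  have tU : ∀ x, t U x = 0 := by
    intro x
    simp only [t, hφU]
    rfl
  have hbase : ∀ γ : Γ0, (γ : G) • ((1 : G) : G ⧸ Γ0) = ((1 : G) : G ⧸ Γ0) := by
    intro γ
    change (((γ : G) * 1 : G) : G ⧸ Γ0) = _
    rw [mul_one, eq_comm, QuotientGroup.eq]
    simp
  refine ⟨{ toFun := fun γ => Multiplicative.ofAdd (t γ ((1 : G) : G ⧸ Γ0))
            map_one' := by simp [t1]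
            map_mul' := fun a b => by
              rw [Subgroup.coe_mul, tmul, hbase, ofAdd_add] }, ?_⟩
  intro B _ f γ hγ
  have hγ' : t γ ((1 : G) : G ⧸ Γ0) = 0 := hγ
  let p2 : (G ⧸ Γ0) → Additive B := fun x => -(3 • Fc Γ0 f S x)
  let p3 : (G ⧸ Γ0) → Additive B := fun x => -(4 • Fc Γ0 f U x + 2 • Fc Γ0 f U (U • x))
  let Λ : ((G ⧸ Γ0) →₀ ℤ) →+ Additive B :=
    Finsupp.liftAddHom (fun x => (zmultiplesHom (Additive B)) (p2 x - p3 x))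
  have hΛ : ∀ x, Λ (Finsupp.single x 1) = p2 x - p3 x := by
    intro x; simp [Λ]
  have main : ∀ g, ∀ x, 6 • Fc Γ0 f g x = Λ (t g x) + p3 (g • x) - p3 x := by
    refine hmem _ ?_ ?_ ?_ ?_ ?_
    · intro x
      rw [tS, map_sub, hΛ, hΛ]
      have h1 := Fc_mul Γ0 f S S x
      rw [hS, Fc_one] at h1
      have h2 : Fc Γ0 f S (S • x) = - Fc Γ0 f S x := eq_neg_of_add_eq_zero_left h1.symm
      simp only [p2, h2]
      abel
    · intro x
      rw [tU, map_zero]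
      have h1 := Fc_mul Γ0 f (U * U) U x
      rw [hU, Fc_one, Fc_mul] at h1
      have h2 : Fc Γ0 f U (U • U • x) = - Fc Γ0 f U (U • x) - Fc Γ0 f U x := by
        rw [← sub_eq_zero, h1]; abel
      simp only [p3, h2]
      abel
    · intro x; simp [Fc_one, t1]
    · intro g h hg hh x
      rw [Fc_mul, tmul, map_add, mul_smul, smul_add, hg, hh]; abel
    · intro g hg x
      have h1 := Fc_mul Γ0 f g g⁻¹ x
      have h2 := tmul g g⁻¹ x
      rw [mul_inv_cancel, Fc_one] at h1
      rw [mul_inv_cancel, t1] at h2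
      have h3 : Fc Γ0 f g⁻¹ x = - Fc Γ0 f g (g⁻¹ • x) := eq_neg_of_add_eq_zero_right h1.symm
      have h4 : t g⁻¹ x = - t g (g⁻¹ • x) := eq_neg_of_add_eq_zero_right h2.symm
      rw [h3, h4, smul_neg, hg, map_neg, smul_inv_smul]; abel
  have h := main γ ((1 : G) : G ⧸ Γ0)
  rw [hγ', map_zero, hbase, Fc_base, zero_add, sub_self] at h
  exact h

end Qcore
end PD
end PartQ1

section PartQ2
open NumberField
namespace PD
open UpperHalfPlane MatrixGroups

noncomputable def ppi : SL(2, ℤ) →* Equiv.Perm ℍ := MulAction.toPermHom SL(2, ℤ) ℍ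

lemma ppi_apply (g : SL(2, ℤ)) (z : ℍ) : ppi g z = g • z := rfl

def mU : SL(2, ℤ) := ModularGroup.T * ModularGroup.S

lemma ppi_neg_one : ppi (-1) = 1 := by
  ext1 z
  rw [ppi_apply, ModularGroup.SL_neg_smul, one_smul]; rfl

lemma ppi_ker (g : SL(2, ℤ)) : ppi g = 1 ↔ g = 1 ∨ g = -1 := by
  constructor
  · intro h
    have key : ∀ z : ℍ, ((g 0 0 : ℤ) : ℂ) * z + ((g 0 1 : ℤ) : ℂ) = z * (((g 1 0 : ℤ) : ℂ) * z + ((g 1 1 : ℤ) : ℂ)) := by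
      intro z
      have h1 : g • z = z := by rw [← ppi_apply, h]; rfl
      have h2 := coe_specialLinearGroup_apply g z
      rw [h1] at h2
      have h3 : (((g 1 0 : ℤ) : ℂ) * z + ((g 1 1 : ℤ) : ℂ)) ≠ 0 := by
        have := denom_ne_zero (g : GL (Fin 2) ℝ) z
        simpa [denom] using this
      simp only [eq_intCast, Complex.ofReal_intCast] at h2
      exact ((eq_div_iff h3).1 h2).symm
    have k1 := key ⟨Complex.I, by simp⟩
    have k2 := key ⟨2 * Complex.I, by simp⟩
    simp only at k1 k2
    have k1r := congrArg Complex.re k1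
    have k1i := congrArg Complex.im k1
    have k2r := congrArg Complex.re k2
    simp at k1r k1i k2r
    have hd := Matrix.det_fin_two g.1
    rw [g.2] at hd
    have e1 : g 0 0 = g 1 1 := by exact_mod_cast k1i
    have e2 : g 0 1 = - g 1 0 := by exact_mod_cast k1r
    have e3 : g 1 0 = 0 := by
      have : (g 1 0 : ℝ) = 0 := by
        have : (g 0 1 : ℝ) = - g 1 0 := by exact_mod_cast e2
        linarith
      exact_mod_cast this
    have e4 : g 0 1 = 0 := by rw [e2, e3]; rfl
    change 1 = g 0 0 * g 1 1 - g 0 1 * g 1 0 at hd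
    rw [← e1, e3] at hd
    have : g 0 0 * g 0 0 = 1 := by linarith
    rcases mul_self_eq_one_iff.1 this with h5 | h5
    · left
      ext i j; fin_cases i <;> fin_cases j <;> simp [e3, e4, ← e1, h5]
    · right
      ext i j; fin_cases i <;> fin_cases j <;> simp [e3, e4, ← e1, h5]
  · rintro (rfl | rfl)
    · exact map_one _
    · exact ppi_neg_one

noncomputable def pS : Equiv.Perm ℍ := ppi ModularGroup.S
noncomputable def pU : Equiv.Perm ℍ := ppi mU

lemma pS2 : pS * pS = 1 := by
  rw [pS, ← map_mul, ppi_ker]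
  right
  decide

lemma pU3 : pU * pU * pU = 1 := by
  rw [pU, ← map_mul, ← map_mul, ppi_ker]
  right
  decide

lemma pS_coe (z : ℍ) : ((pS z : ℍ) : ℂ) = -(z : ℂ)⁻¹ := by
  rw [pS, ppi_apply, modular_S_smul]; simp

lemma pU_coe (z : ℍ) : ((pU z : ℍ) : ℂ) = 1 - (z : ℂ)⁻¹ := by
  rw [pU, ppi_apply, mU, mul_smul, modular_S_smul, modular_T_smul]
  simp [sub_eq_add_neg]

lemma pS_re (z : ℍ) : (pS z).re = - z.re / Complex.normSq z := by
  have := congrArg Complex.re (pS_coe z)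
  simpa [neg_div] using this

lemma pU_re (z : ℍ) : (pU z).re = 1 - z.re / Complex.normSq z := by
  have := congrArg Complex.re (pU_coe z)
  simpa using this

lemma nsq_pos (z : ℍ) : 0 < Complex.normSq (z : ℂ) := Complex.normSq_pos.2 z.ne_zero

lemma pU_pp (z : ℍ) (h : z.re < 0) : 0 < (pU z).re := by
  rw [pU_re]
  have := div_neg_of_neg_of_pos h (nsq_pos z)
  linarith

lemma pUU_pp (z : ℍ) (h : z.re < 0) : 0 < (pU (pU z)).re := by
  rw [pU_re, sub_pos, div_lt_one (nsq_pos _)]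
  have h1 : 1 < (pU z).re := by
    rw [pU_re]
    have := div_neg_of_neg_of_pos h (nsq_pos z)
    linarith
  rw [Complex.normSq_apply]
  simp only [coe_re, coe_im]
  nlinarith [(pU z).im_pos]

lemma pS_pp (z : ℍ) (h : 0 < z.re) : (pS z).re < 0 := by
  rw [pS_re]
  exact div_neg_of_neg_of_pos (by linarith) (nsq_pos z)

def zhom {H : Type*} [Group H] (m : ℕ) (g : H) (hg : g ^ m = 1) : Multiplicative (ZMod m) →* H :=
  AddMonoidHom.toMultiplicativeLeft (ZMod.lift m ⟨zmultiplesHom (Additive H) (Additive.ofMul g), by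
    simp [← ofMul_pow, hg]⟩)

lemma zhom_pow {H : Type*} [Group H] (m : ℕ) (g : H) (hg : g ^ m = 1) (k : ℕ) :
    zhom m g hg (Multiplicative.ofAdd (k : ZMod m)) = g ^ k := by
  change Additive.toMul (ZMod.lift m _ (k : ZMod m)) = g ^ k
  have h : (k : ZMod m) = ((k : ℤ) : ZMod m) := by simp
  rw [h, ZMod.lift_coe]
  simp

abbrev kk : Bool → ℕ := fun b => if b then 3 else 2
abbrev HH (b : Bool) : Type := Multiplicative (ZMod (kk b))

/-- family of homs -/
def fam {H : Type*} [Group H] (s u : H) (hs : s * s = 1) (hu : u * u * u = 1) (b : Bool) : HH b →* H :=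
  match b with
  | false => zhom 2 s (by rw [pow_two, hs])
  | true => zhom 3 u (by rw [pow_three', hu])

lemma lift_inj : Function.Injective (Monoid.CoprodI.lift (fam pS pU pS2 pU3)) := by
  refine Monoid.CoprodI.lift_injective_of_ping_pong (fam pS pU pS2 pU3) (Or.inr ⟨true, ?_⟩)
    (fun b => if b then {z : ℍ | 0 < z.re} else {z : ℍ | z.re < 0}) ?_ ?_ ?_
  · change 3 ≤ Cardinal.mk (ZMod 3)
    rw [Cardinal.mk_fintype, ZMod.card]; norm_num
  · rintro (_ | _)
    · exact ⟨⟨⟨-1, 1⟩, by simp⟩, by show (-1 : ℝ) < 0; norm_num⟩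
    · exact ⟨⟨⟨1, 1⟩, by simp⟩, by show (0 : ℝ) < 1; norm_num⟩
  · rintro (_ | _) (_ | _) h
    · exact absurd rfl h
    · refine Set.disjoint_left.2 fun z hz hz' => ?_
      simp at hz hz'; linarith
    · refine Set.disjoint_left.2 fun z hz hz' => ?_
      simp at hz hz'; linarith
    · exact absurd rfl h
  · rintro (_ | _) (_ | _) h
    · exact absurd rfl h
    · intro x hx
      have hx' : x = Multiplicative.ofAdd ((1 : ℕ) : ZMod 2) := by
        revert x; decide
      rintro _ ⟨z, hz, rfl⟩
      subst hx'
      change (zhom 2 pS (by rw [pow_two, pS2]) (Multiplicative.ofAdd ((1 : ℕ) : ZMod 2)) z).re < 0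
      rw [zhom_pow, pow_one]
      exact pS_pp z hz
    · intro x hx
      have hx' : x = Multiplicative.ofAdd ((1 : ℕ) : ZMod 3) ∨ x = Multiplicative.ofAdd ((2 : ℕ) : ZMod 3) := by
        revert x; decide
      rintro _ ⟨z, hz, rfl⟩
      rcases hx' with rfl | rfl
      · change 0 < (zhom 3 pU (by rw [pow_three', pU3]) (Multiplicative.ofAdd ((1 : ℕ) : ZMod 3)) z).re
        rw [zhom_pow, pow_one]
        exact pU_pp z hz
      · change 0 < (zhom 3 pU (by rw [pow_three', pU3]) (Multiplicative.ofAdd ((2 : ℕ) : ZMod 3)) z).re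
        rw [zhom_pow, pow_two]
        exact pUU_pp z hz
    · exact absurd rfl h

abbrev PG : Type := (Subgroup.closure ({pS, pU} : Set (Equiv.Perm ℍ)))
noncomputable def gS : PG := ⟨pS, Subgroup.subset_closure (by simp)⟩
noncomputable def gU : PG := ⟨pU, Subgroup.subset_closure (by simp)⟩

lemma ppi_mem (g : SL(2, ℤ)) : ppi g ∈ Subgroup.closure ({pS, pU} : Set (Equiv.Perm ℍ)) := by
  have hg : g ∈ Subgroup.closure {ModularGroup.S, ModularGroup.T} := by
    rw [SpecialLinearGroup.SL2Z_generators]; trivial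
  have hSm : pS ∈ Subgroup.closure ({pS, pU} : Set (Equiv.Perm ℍ)) := Subgroup.subset_closure (by simp)
  have hUm : pU ∈ Subgroup.closure ({pS, pU} : Set (Equiv.Perm ℍ)) := Subgroup.subset_closure (by simp)
  have : Subgroup.closure {ModularGroup.S, ModularGroup.T} ≤ (Subgroup.closure ({pS, pU} : Set (Equiv.Perm ℍ))).comap ppi := by
    rw [Subgroup.closure_le]
    rintro x (rfl | hx)
    · exact hSm
    · rw [Set.mem_singleton_iff.1 hx]
      have : ModularGroup.T = mU * ModularGroup.S⁻¹ := by rw [mU]; group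
      change ppi ModularGroup.T ∈ Subgroup.closure ({pS, pU} : Set (Equiv.Perm ℍ))
      rw [this, map_mul, map_inv]
      exact mul_mem hUm (inv_mem hSm)
  exact this hg

lemma PG_gen : Subgroup.closure {gS, gU} = (⊤ : Subgroup PG) := by
  have := Subgroup.closure_closure_coe_preimage (k := ({pS, pU} : Set (Equiv.Perm ℍ)))
  rw [← this]
  congr 1
  ext x
  simp [gS, gU, Subtype.ext_iff]

lemma PG_univ : ∀ (H : Type) [Group H] (s u : H), s * s = 1 → u * u * u = 1 →
      ∃ φ : PG →* H, φ gS = s ∧ φ gU = u := by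
  intro H _ s u hs hu
  let L := Monoid.CoprodI.lift (fam pS pU pS2 pU3)
  let cS : Monoid.CoprodI HH := Monoid.CoprodI.of (i := false) (Multiplicative.ofAdd ((1 : ℕ) : ZMod 2))
  let cU : Monoid.CoprodI HH := Monoid.CoprodI.of (i := true) (Multiplicative.ofAdd ((1 : ℕ) : ZMod 3))
  have hc : ∀ {H' : Type} [Group H'] (s u : H') (hs : s * s = 1) (hu : u * u * u = 1),
      Monoid.CoprodI.lift (fam s u hs hu) cS = s ∧ Monoid.CoprodI.lift (fam s u hs hu) cU = u := by
    intro H' _ s u hs hu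
    constructor
    · rw [Monoid.CoprodI.lift_of]
      change zhom 2 s (by rw [pow_two, hs]) (Multiplicative.ofAdd ((1 : ℕ) : ZMod 2)) = s
      rw [zhom_pow, pow_one]
    · rw [Monoid.CoprodI.lift_of]
      change zhom 3 u (by rw [pow_three', hu]) (Multiplicative.ofAdd ((1 : ℕ) : ZMod 3)) = u
      rw [zhom_pow, pow_one]
  have hle : Subgroup.closure ({pS, pU} : Set (Equiv.Perm ℍ)) ≤ L.range := by
    rw [Subgroup.closure_le]
    rintro x (rfl | hx)
    · exact ⟨cS, (hc _ _ pS2 pU3).1⟩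
    · rw [Set.mem_singleton_iff.1 hx]; exact ⟨cU, (hc _ _ pS2 pU3).2⟩
  let e := MonoidHom.ofInjective (f := L) lift_inj
  let φ : PG →* H := (Monoid.CoprodI.lift (fam s u hs hu)).comp (e.symm.toMonoidHom.comp (Subgroup.inclusion hle))
  have h1 : e.symm (Subgroup.inclusion hle gS) = cS := by
    rw [MulEquiv.symm_apply_eq]
    ext1
    exact (hc _ _ pS2 pU3).1.symm
  have h2 : e.symm (Subgroup.inclusion hle gU) = cU := by
    rw [MulEquiv.symm_apply_eq]
    ext1
    exact (hc _ _ pS2 pU3).2.symm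
  refine ⟨φ, ?_, ?_⟩
  · change Monoid.CoprodI.lift (fam s u hs hu) (e.symm (Subgroup.inclusion hle gS)) = s
    rw [h1]; exact (hc _ _ hs hu).1
  · change Monoid.CoprodI.lift (fam s u hs hu) (e.symm (Subgroup.inclusion hle gU)) = u
    rw [h2]; exact (hc _ _ hs hu).2

lemma PG_core (Γ0 : Subgroup PG) :
    ∃ θ : Γ0 →* Multiplicative ((PG ⧸ Γ0) →₀ ℤ), ∀ (B : Type*) [CommGroup B] (f : Γ0 →* B) (γ : Γ0),
      θ γ = 1 → f γ ^ 6 = 1 :=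
  Qcore gS gU (Subtype.ext pS2) (Subtype.ext pU3) PG_gen PG_univ Γ0
end PD
end PartQ2

section PartQ3
open NumberField
namespace PD
open MatrixGroups

lemma int_of_rank_one {F : Type*} [Field F] [NumberField F] (hd : Module.finrank ℚ F = 1) (x : 𝓞 F) :
    ∃ m : ℤ, x = (m : 𝓞 F) := by
  have h1 : (algebraMap (𝓞 F) F x) ∈ (⊥ : Subalgebra ℚ F) := by
    rw [Subalgebra.bot_eq_top_of_finrank_eq_one hd]; trivial
  obtain ⟨q, hq⟩ := Algebra.mem_bot.1 h1
  have h2 : IsIntegral ℤ (algebraMap ℚ F q) := by rw [hq]; exact RingOfIntegers.isIntegral_coe x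
  have h3 : IsIntegral ℤ q := (isIntegral_algebraMap_iff (algebraMap ℚ F).injective).1 h2
  obtain ⟨m, hm⟩ := IsIntegrallyClosed.isIntegral_iff.1 h3
  refine ⟨m, RingOfIntegers.coe_injective ?_⟩
  rw [← hq, ← hm]; simp

lemma tpos_unit {F : Type*} [Field F] [NumberField F] (htot : ∀ v : InfinitePlace F, v.IsReal)
    (m : ℤ) (u : (𝓞 F)ˣ) (hu : (u : 𝓞 F) = m)
    (hpos : ∀ φ : F →+* ℝ, 0 < φ (algebraMap (𝓞 F) F (u : 𝓞 F)))
    (hd : Module.finrank ℚ F = 1) : m = 1 := by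
  obtain ⟨v⟩ := (inferInstance : Nonempty (InfinitePlace F))
  have h1 := hpos (InfinitePlace.embedding_of_isReal (htot v))
  rw [hu] at h1
  simp only [map_intCast] at h1
  have h2 : 0 < m := by exact_mod_cast h1
  obtain ⟨k, hk⟩ := int_of_rank_one hd ((u⁻¹ : (𝓞 F)ˣ) : 𝓞 F)
  have h3 : (u : 𝓞 F) * ((u⁻¹ : (𝓞 F)ˣ) : 𝓞 F) = 1 := by simp
  rw [hu, hk] at h3
  have h4 : m * k = 1 := by exact_mod_cast h3
  rcases Int.eq_one_or_neg_one_of_mul_eq_one h4 with h | h <;> omega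

noncomputable def jj (F : Type*) [Field F] : SL(2, ℤ) →* (Matrix (Fin 2) (Fin 2) F)ˣ :=
  Matrix.SpecialLinearGroup.toGL.comp (Matrix.SpecialLinearGroup.map (Int.castRingHom F))

lemma jj_val {F : Type*} [Field F] (g : SL(2, ℤ)) (i k : Fin 2) : (jj F g).val i k = ((g i k : ℤ) : F) := rfl

lemma jj_inj {F : Type*} [Field F] [CharZero F] : Function.Injective (jj F) := by
  intro g h hgh
  ext i k
  have := congrArg (fun A : (Matrix (Fin 2) (Fin 2) F)ˣ => A.val i k) hgh
  simp only [jj_val] at this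
  exact_mod_cast this

theorem final_eq1 {F : Type*} [Field F] [NumberField F]
    (htot : ∀ v : InfinitePlace F, v.IsReal) (hd : Module.finrank ℚ F = 1)
    (n : Ideal (𝓞 F))
    (Γ Z : Subgroup (Matrix (Fin 2) (Fin 2) F)ˣ)
    (hΓ : ∀ A : (Matrix (Fin 2) (Fin 2) F)ˣ, A ∈ Γ ↔
      ∃ a b c d : 𝓞 F,
        A.val = !![algebraMap (𝓞 F) F a, algebraMap (𝓞 F) F b;
                   algebraMap (𝓞 F) F c, algebraMap (𝓞 F) F d] ∧
        c ∈ n ∧ d - 1 ∈ n ∧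
        ∃ u : (𝓞 F)ˣ, (u : 𝓞 F) = a * d - b * c ∧
          ∀ φ : F →+* ℝ, 0 < φ (algebraMap (𝓞 F) F (u : 𝓞 F)))
    (hZ : ∀ A : (Matrix (Fin 2) (Fin 2) F)ˣ, A ∈ Z ↔
      A ∈ Γ ∧ ∃ x : F, A.val = x • (1 : Matrix (Fin 2) (Fin 2) F))
    [hnorm : (Z.subgroupOf Γ).Normal]
    (p : ℕ) (hp : p.Prime)
    (h6 : ¬ (p ∣ 6)) :
    ∀ x : Abelianization (Γ ⧸ Z.subgroupOf Γ), x ^ p = 1 → x = 1 := by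
  classical
  have hle : Γ ≤ (jj F).range := by
    intro A hA
    obtain ⟨a, b, c, d, hv, -, -, u, hu, hupos⟩ := (hΓ _).1 hA
    obtain ⟨a, rfl⟩ := int_of_rank_one hd a
    obtain ⟨b, rfl⟩ := int_of_rank_one hd b
    obtain ⟨c, rfl⟩ := int_of_rank_one hd c
    obtain ⟨d, rfl⟩ := int_of_rank_one hd d
    have h1 : a * d - b * c = 1 := tpos_unit htot _ u (by rw [hu]; push_cast; rfl) hupos hd
    obtain ⟨g, hg⟩ : ∃ g : SL(2, ℤ), g.1 = !![a, b; c, d] :=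
      ⟨⟨!![a, b; c, d], by rw [Matrix.det_fin_two_of, h1]⟩, rfl⟩
    refine ⟨g, ?_⟩
    ext1
    rw [hv]
    ext i k
    rw [jj_val]
    have hgik : g i k = !![a, b; c, d] i k := by rw [← hg]
    rw [hgik]
    fin_cases i <;> fin_cases k <;> simp
  let e := MonoidHom.ofInjective (f := jj F) jj_inj
  let σ : Γ →* SL(2, ℤ) := e.symm.toMonoidHom.comp (Subgroup.inclusion hle)
  have hσ : ∀ γ : Γ, jj F (σ γ) = γ := by
    intro γ
    have : e (e.symm (Subgroup.inclusion hle γ)) = Subgroup.inclusion hle γ := by simp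
    exact congrArg Subtype.val this
  let r : Γ →* PG := (ppi.codRestrict _ ppi_mem).comp σ
  have hr : ∀ γ : Γ, r γ = 1 ↔ γ ∈ Z.subgroupOf Γ := by
    intro γ
    have h1 : r γ = 1 ↔ ppi (σ γ) = 1 := Subtype.ext_iff
    rw [h1, ppi_ker, Subgroup.mem_subgroupOf, hZ]
    constructor
    · intro h
      refine ⟨γ.2, ?_⟩
      rcases h with h | h
      · refine ⟨1, ?_⟩
        rw [← hσ, h]; simp
      · refine ⟨-1, ?_⟩
        rw [← hσ, h]
        ext i k
        rw [jj_val]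
        fin_cases i <;> fin_cases k <;> simp
    · rintro ⟨-, x, hx⟩
      rw [← hσ] at hx
      have k : ∀ i k, ((σ γ i k : ℤ) : F) = (x • (1 : Matrix (Fin 2) (Fin 2) F)) i k := by
        intro i k; rw [← hx, jj_val]
      have k00 := k 0 0
      have k01 := k 0 1
      have k10 := k 1 0
      have k11 := k 1 1
      simp at k00 k01 k10 k11
      have e1 : σ γ 0 0 = σ γ 1 1 := by
        have := k00.trans k11.symm
        exact_mod_cast this
      have hdet := Matrix.det_fin_two (σ γ).1
      rw [(σ γ).2] at hdet
      change 1 = σ γ 0 0 * σ γ 1 1 - σ γ 0 1 * σ γ 1 0 at hdet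
      rw [k01, ← e1] at hdet
      have : σ γ 0 0 * σ γ 0 0 = 1 := by linarith
      rcases mul_self_eq_one_iff.1 this with h5 | h5
      · left
        ext i j; fin_cases i <;> fin_cases j <;> simp [k01, k10, ← e1, h5]
      · right
        ext i j; fin_cases i <;> fin_cases j <;> simp [k01, k10, ← e1, h5]
  obtain ⟨θ, hθ⟩ := PG_core r.range
  let q : Γ →* Abelianization (Γ ⧸ Z.subgroupOf Γ) :=
    (Abelianization.of).comp (QuotientGroup.mk' (Z.subgroupOf Γ))
  have hqs : Function.Surjective q := by
    intro x
    induction x using QuotientGroup.induction_on with | H x =>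
    induction x using QuotientGroup.induction_on with | H x =>
    exact ⟨x, rfl⟩
  have hkq : ∀ γ, r γ = 1 → q γ = 1 := by
    intro γ h
    have : (QuotientGroup.mk' (Z.subgroupOf Γ)) γ = 1 := (QuotientGroup.eq_one_iff _).2 ((hr γ).1 h)
    simp only [q, MonoidHom.comp_apply, this, map_one]
  let f : r.range →* Abelianization (Γ ⧸ Z.subgroupOf Γ) :=
    (QuotientGroup.lift r.ker q (fun γ h => hkq γ h)).comp
      (QuotientGroup.quotientKerEquivRange r).symm.toMonoidHom
  have hf : ∀ γ, f (r.rangeRestrict γ) = q γ := by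
    intro γ
    have : (QuotientGroup.quotientKerEquivRange r).symm (r.rangeRestrict γ) = (γ : Γ ⧸ r.ker) := by
      rw [MulEquiv.symm_apply_eq]; rfl
    change QuotientGroup.lift r.ker q (fun γ h => hkq γ h) ((QuotientGroup.quotientKerEquivRange r).symm (r.rangeRestrict γ)) = _
    rw [this]; rfl
  let θ' : Abelianization (Γ ⧸ Z.subgroupOf Γ) →* Multiplicative ((PG ⧸ r.range) →₀ ℤ) :=
    Abelianization.lift (QuotientGroup.lift (Z.subgroupOf Γ) (θ.comp r.rangeRestrict) (by
      intro γ h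
      have : r.rangeRestrict γ = 1 := Subtype.ext ((hr γ).2 h)
      rw [MonoidHom.mem_ker, MonoidHom.comp_apply, this, map_one]))
  have hθ' : ∀ γ, θ' (q γ) = θ (r.rangeRestrict γ) := fun γ => rfl
  intro x hx
  obtain ⟨γ, rfl⟩ := hqs x
  have h1 : θ (r.rangeRestrict γ) = 1 := by
    rw [← hθ']
    have h2 : θ' (q γ) ^ p = 1 := by rw [← map_pow, hx, map_one]
    have h3 : p • Multiplicative.toAdd (θ' (q γ)) = 0 := h2
    have h4 := (smul_eq_zero.1 h3).resolve_left hp.ne_zero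
    exact h4
  have h2 := hθ _ f _ h1
  rw [hf] at h2
  have h3 : orderOf (q γ) ∣ 1 := by
    rw [← Nat.Coprime.gcd_eq_one ((hp.coprime_iff_not_dvd).2 h6)]
    exact Nat.dvd_gcd (orderOf_dvd_of_pow_eq_one hx) (orderOf_dvd_of_pow_eq_one h2)
  exact orderOf_eq_one_iff.1 (Nat.dvd_one.1 h3)
end PD
end PartQ3


open NumberField

/-- **Torsion-freeness of the abelianized arithmetic group.**  Let `F` be a totally real number
field, `n` a nonzero ideal of `o_F`, and `Γ = Γ₁(o_F, n) ⊆ GL₂(F)` (entries in `o_F`, lower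
left entry in `n`, lower right entry `≡ 1 mod n`, determinant a totally positive unit).  Let
`Z = Γ ∩ F^×` be the central subgroup of scalar matrices in `Γ`.  If `℘` is a prime coprime to
`6`, to `n`, and to the order of `o_{F,+}^×/o_{F,n}^{×2}`, then the abelianization of `Γ/Z` has
no `℘`-torsion. -/
theorem abelianization_no_p_torsion
    (F : Type*) [Field F] [NumberField F]
    (htot : ∀ v : InfinitePlace F, v.IsReal)
    (n : Ideal (𝓞 F)) (hn : n ≠ ⊥)
    (Γ Z : Subgroup (Matrix (Fin 2) (Fin 2) F)ˣ)
    (hΓ : ∀ A : (Matrix (Fin 2) (Fin 2) F)ˣ, A ∈ Γ ↔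
      ∃ a b c d : 𝓞 F,
        A.val = !![algebraMap (𝓞 F) F a, algebraMap (𝓞 F) F b;
                   algebraMap (𝓞 F) F c, algebraMap (𝓞 F) F d] ∧
        c ∈ n ∧ d - 1 ∈ n ∧
        ∃ u : (𝓞 F)ˣ, (u : 𝓞 F) = a * d - b * c ∧
          ∀ φ : F →+* ℝ, 0 < φ (algebraMap (𝓞 F) F (u : 𝓞 F)))
    (hZ : ∀ A : (Matrix (Fin 2) (Fin 2) F)ˣ, A ∈ Z ↔
      A ∈ Γ ∧ ∃ x : F, A.val = x • (1 : Matrix (Fin 2) (Fin 2) F))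
    [hnorm : (Z.subgroupOf Γ).Normal]
    (Upos Usq : Subgroup (𝓞 F)ˣ)
    (hUpos : ∀ u : (𝓞 F)ˣ, u ∈ Upos ↔
      ∀ φ : F →+* ℝ, 0 < φ (algebraMap (𝓞 F) F (u : 𝓞 F)))
    (hUsq : ∀ u : (𝓞 F)ˣ, u ∈ Usq ↔ ∃ v : (𝓞 F)ˣ, ((v : 𝓞 F) - 1 ∈ n) ∧ u = v ^ 2)
    (hle : Usq ≤ Upos)
    (℘ : ℕ) (hp : ℘.Prime)
    (h6 : ¬ (℘ ∣ 6))
    (hcopn : Ideal.span {(℘ : 𝓞 F)} ⊔ n = ⊤)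
    (hcard : ¬ ℘ ∣ Nat.card (Upos ⧸ Usq.subgroupOf Upos)) :
    ∀ x : Abelianization (Γ ⧸ Z.subgroupOf Γ), x ^ ℘ = 1 → x = 1 := by
  rcases lt_or_ge (Module.finrank ℚ F) 2 with h | h
  · have h1 : 0 < Module.finrank ℚ F := Module.finrank_pos
    exact PD.final_eq1 htot (by omega) n Γ Z hΓ hZ ℘ hp h6
  · exact PD.final_ge2 htot (PD.exists_unit htot h) n hn Γ Z hΓ hZ Upos Usq hUpos hUsq ℘ hp h6
      hcopn hcard
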